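/- arXiv:math-ph/0304044 — 2 statements merged into one kernel-verified Lean document; each statement's English description precedes it below -/
import Mathlib

section
/- Let b ≥ 1 and let f be a nonconstant real analytic function on 𝕋^b (a ℤ^b-periodic real analytic function on ℝ^b). Then there exists λ₀ = λ₀(f) such that for every λ > λ₀, every energy E ∈ ℝ, and every incommensurate frequency vector ω ∈ 𝕋^b, the Lyapunov exponent of the quasiperiodic Schrödinger cocycle satisfies γ(E) > (1/2)·ln λ. -/
open MeasureTheory Filter

noncomputable section

/-- The Frobenius norm of a 2×2 real matrix. -/
def matNorm (M : Matrix (Fin 2) (Fin 2) ℝ) : ℝ := Real.sqrt (∑ i, ∑ j, (M i j) ^ 2)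

/-- The `k`-step transfer matrix `M_k(θ,E) = ∏_{n=k-1}^{0} A(θ + nω, E)` of the quasiperiodic
Schrödinger cocycle with potential `λ f`, where `A(θ,E) = [[E - λ f(θ), -1],[1,0]]`. -/
def transfer (b : ℕ) (f : (Fin b → ℝ) → ℝ) (lam E : ℝ) (ω θ : Fin b → ℝ) :
    ℕ → Matrix (Fin 2) (Fin 2) ℝ
  | 0 => 1
  | (k + 1) => !![E - lam * f (θ + (k : ℝ) • ω), -1; 1, 0] * transfer b f lam E ω θ k

/-- `γ` is the Lyapunov exponent at energy `E`:
`γ = lim_{k→∞} (1/k) ∫_{𝕋^b} log ‖M_k(θ,E)‖ dθ`. -/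
def HasLyapunov (b : ℕ) (f : (Fin b → ℝ) → ℝ) (lam E : ℝ) (ω : Fin b → ℝ) (γ : ℝ) : Prop :=
  Tendsto (fun k : ℕ => (1 / (k : ℝ)) *
      ∫ θ in Set.Icc (0 : Fin b → ℝ) 1, Real.log (matNorm (transfer b f lam E ω θ k)))
    atTop (nhds γ)

/-- `ω ∈ 𝕋^b` is incommensurate: `n ⬝ ω ∉ ℤ` for every nonzero integer vector `n`. -/
def Incommensurate (b : ℕ) (ω : Fin b → ℝ) : Prop :=
  ∀ n : Fin b → ℤ, n ≠ 0 → ∀ m : ℤ, (∑ i, (n i : ℝ) * ω i) ≠ (m : ℝ)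

section Separation

/-- `x` lies within sup-distance `δ` of an integer vector. -/
def NearInt {b : ℕ} (δ : ℝ) (x : Fin b → ℝ) : Prop :=
  ∃ l : Fin b → ℤ, ∀ j, |x j - l j| ≤ δ

theorem NearInt.neg {b : ℕ} {δ : ℝ} {x : Fin b → ℝ} (h : NearInt δ x) : NearInt δ (-x) := by
  obtain ⟨l, hl⟩ := h
  refine ⟨-l, fun j => ?_⟩
  have : (-x) j - ((-l) j : ℤ) = -(x j - l j) := by simp; ring
  rw [this, abs_neg]
  exact hl j

/-- The multiples `n • ω`, `n ∈ S`, are pairwise `δ`-separated modulo `ℤ^b`. -/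
def Separated {b : ℕ} (δ : ℝ) (ω : Fin b → ℝ) (S : Finset ℕ) : Prop :=
  ∀ n ∈ S, ∀ m ∈ S, n ≠ m → ¬ NearInt δ (((n : ℝ) - m) • ω)

theorem Separated.card_le {b : ℕ} {a : ℕ} {ω : Fin b → ℝ} {S : Finset ℕ}
    (h : Separated ((1 / 4 : ℝ) ^ a) ω S) : S.card ≤ (4 ^ a) ^ b := by
  classical
  let φ : ℕ → Fin b → ℕ := fun n j => ⌊(4 : ℝ) ^ a * Int.fract ((n : ℝ) * ω j)⌋₊
  have hmaps : ∀ n ∈ S, φ n ∈ Fintype.piFinset (fun _ : Fin b => Finset.range (4 ^ a)) := by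
    intro n _
    rw [Fintype.mem_piFinset]
    intro j
    rw [Finset.mem_range]
    have h1 : (4 : ℝ) ^ a * Int.fract ((n : ℝ) * ω j) < ((4 ^ a : ℕ) : ℝ) := by
      push_cast
      have := Int.fract_lt_one ((n : ℝ) * ω j)
      have h4 : (0 : ℝ) < 4 ^ a := by positivity
      nlinarith
    exact (Nat.floor_lt (by have := Int.fract_nonneg ((n : ℝ) * ω j); positivity)).2 h1
  have hinj : Set.InjOn φ S := by
    intro n hn m hm hnm
    by_contra hne
    refine h n hn m hm hne ⟨fun j => ⌊(n : ℝ) * ω j⌋ - ⌊(m : ℝ) * ω j⌋, fun j => ?_⟩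
    have hj : ⌊(4 : ℝ) ^ a * Int.fract ((n : ℝ) * ω j)⌋₊ =
        ⌊(4 : ℝ) ^ a * Int.fract ((m : ℝ) * ω j)⌋₊ := congrFun hnm j
    have h4 : (0 : ℝ) < 4 ^ a := by positivity
    have n1 := Nat.floor_le (mul_nonneg h4.le (Int.fract_nonneg ((n : ℝ) * ω j)))
    have n2 := Nat.lt_floor_add_one ((4 : ℝ) ^ a * Int.fract ((n : ℝ) * ω j))
    have m1 := Nat.floor_le (mul_nonneg h4.le (Int.fract_nonneg ((m : ℝ) * ω j)))
    have m2 := Nat.lt_floor_add_one ((4 : ℝ) ^ a * Int.fract ((m : ℝ) * ω j))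
    rw [hj] at n1 n2
    have e : (((n : ℝ) - m) • ω) j - ((⌊(n : ℝ) * ω j⌋ - ⌊(m : ℝ) * ω j⌋ : ℤ) : ℝ) =
        Int.fract ((n : ℝ) * ω j) - Int.fract ((m : ℝ) * ω j) := by
      simp only [Pi.smul_apply, smul_eq_mul, Int.cast_sub, Int.fract]; ring
    rw [e, one_div, inv_pow, ← one_div, le_div_iff₀ h4]
    have : |Int.fract ((n : ℝ) * ω j) - Int.fract ((m : ℝ) * ω j)| * 4 ^ a =
        |4 ^ a * Int.fract ((n : ℝ) * ω j) - 4 ^ a * Int.fract ((m : ℝ) * ω j)| := by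
      rw [← mul_sub, abs_mul, abs_of_pos h4, mul_comm]
    rw [this, abs_le]
    constructor <;> linarith
  have := Finset.card_le_card_of_injOn φ hmaps hinj
  simpa using this

open Classical in
/-- The largest size of a `δ`-separated family of multiples `n • ω`, `n ≤ N`. -/
noncomputable def packing {b : ℕ} (δ : ℝ) (ω : Fin b → ℝ) (N : ℕ) : ℕ :=
  ((Finset.range (N + 1)).powerset.filter (Separated δ ω)).sup Finset.card

theorem Separated.card_le_packing {b : ℕ} {δ : ℝ} {ω : Fin b → ℝ} {N : ℕ} {S : Finset ℕ}
    (h : Separated δ ω S) (hS : ∀ n ∈ S, n ≤ N) : S.card ≤ packing δ ω N := by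
  classical
  unfold packing
  apply Finset.le_sup (f := Finset.card)
  rw [Finset.mem_filter, Finset.mem_powerset]
  refine ⟨fun n hn => Finset.mem_range.2 (Nat.lt_succ_of_le (hS n hn)), h⟩

theorem exists_separated_card_eq {b : ℕ} (δ : ℝ) (ω : Fin b → ℝ) (N : ℕ) :
    ∃ S : Finset ℕ, Separated δ ω S ∧ (∀ n ∈ S, n ≤ N) ∧ S.card = packing δ ω N := by
  classical
  have hne : ((Finset.range (N + 1)).powerset.filter (Separated δ ω)).Nonempty :=
    ⟨∅, by simp [Separated]⟩
  obtain ⟨S, hS, h⟩ := Finset.exists_mem_eq_sup _ hne Finset.card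
  rw [Finset.mem_filter, Finset.mem_powerset] at hS
  exact ⟨S, hS.2, fun n hn => Nat.lt_succ_iff.1 (Finset.mem_range.1 (hS.1 hn)), h.symm⟩

theorem packing_pos {b : ℕ} (δ : ℝ) (ω : Fin b → ℝ) (N : ℕ) : 1 ≤ packing δ ω N := by
  have : Separated δ ω {0} := by
    intro n hn m hm hne
    rw [Finset.mem_singleton] at hn hm
    exact absurd (hn.trans hm.symm) hne
  simpa using this.card_le_packing (N := N) (by simp)

theorem packing_le {b : ℕ} (a : ℕ) (ω : Fin b → ℝ) (N : ℕ) :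
    packing ((1 / 4 : ℝ) ^ a) ω N ≤ (4 ^ a) ^ b := by
  obtain ⟨S, hS, -, h⟩ := exists_separated_card_eq ((1 / 4 : ℝ) ^ a) ω N
  rw [← h]; exact hS.card_le

/-- Some `m ∈ [(1 - 2^{-a}) 2^i, 2^i]` has `m • ω` within `4^{-a}` of an integer vector. -/
def GoodScale {b : ℕ} (ω : Fin b → ℝ) (i a : ℕ) : Prop :=
  ∃ m : ℕ, 2 ^ a * 2 ^ i ≤ 2 ^ a * m + 2 ^ i ∧ m ≤ 2 ^ i ∧
    NearInt ((1 / 4 : ℝ) ^ a) ((m : ℝ) • ω)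

theorem two_mul_packing_le {b : ℕ} {ω : Fin b → ℝ} {i a : ℕ} (h : ¬ GoodScale ω (i + a + 1) a) :
    2 * packing ((1 / 4 : ℝ) ^ a) ω (2 ^ i) ≤ packing ((1 / 4 : ℝ) ^ a) ω (2 ^ (i + a + 1)) := by
  classical
  obtain ⟨S, hS, hle, hcard⟩ := exists_separated_card_eq ((1 / 4 : ℝ) ^ a) ω (2 ^ i)
  have hpow : 2 ^ (i + a + 1) = 2 * (2 ^ a * 2 ^ i) := by rw [pow_succ, pow_add]; ring
  have hge : 2 ^ i ≤ 2 ^ a * 2 ^ i := Nat.le_mul_of_pos_left _ (by positivity)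
  set t := 2 ^ (i + a + 1) - 2 ^ i with ht
  have ht' : t + 2 ^ i = 2 ^ (i + a + 1) := by omega
  have hcross : ∀ n ∈ S, ∀ n' ∈ S,
      ¬ NearInt ((1 / 4 : ℝ) ^ a) ((((n' + t : ℕ) : ℝ) - n) • ω) := by
    intro n hn n' hn' hnear
    have h1 := hle n hn
    have h2 := hle n' hn'
    have hnt : n ≤ n' + t := by omega
    refine h ⟨n' + t - n, ?_, by omega, ?_⟩
    · have h3 : 2 ^ (i + a + 1) ≤ (n' + t - n) + 2 * 2 ^ i := by omega
      calc 2 ^ a * 2 ^ (i + a + 1) ≤ 2 ^ a * ((n' + t - n) + 2 * 2 ^ i) := Nat.mul_le_mul_left _ h3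
        _ = 2 ^ a * (n' + t - n) + 2 ^ (i + a + 1) := by rw [hpow]; ring
    · rwa [Nat.cast_sub hnt]
  have hinj : Function.Injective (fun n : ℕ => n + t) := add_left_injective t
  have hdisj : Disjoint S (S.image (fun n => n + t)) := by
    rw [Finset.disjoint_left]
    intro n hn hn'
    obtain ⟨n', hn'S, rfl⟩ := Finset.mem_image.1 hn'
    refine hcross _ hn _ hn'S ⟨0, fun j => ?_⟩
    simp
  have hsep : Separated ((1 / 4 : ℝ) ^ a) ω (S ∪ S.image (fun n => n + t)) := by
    intro n hn m hm hne
    rw [Finset.mem_union] at hn hm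
    rcases hn with hn | hn <;> rcases hm with hm | hm
    · exact hS n hn m hm hne
    · obtain ⟨m', hm', rfl⟩ := Finset.mem_image.1 hm
      intro hnear
      refine hcross _ hn _ hm' ?_
      have := hnear.neg
      rwa [← neg_smul, neg_sub] at this
    · obtain ⟨n', hn', rfl⟩ := Finset.mem_image.1 hn
      exact hcross _ hm _ hn'
    · obtain ⟨n', hn', rfl⟩ := Finset.mem_image.1 hn
      obtain ⟨m', hm', rfl⟩ := Finset.mem_image.1 hm
      have := hS n' hn' m' hm' (fun e => hne (by simp [e]))
      simpa using this
  have := hsep.card_le_packing (N := 2 ^ (i + a + 1)) (by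
    intro n hn
    rw [Finset.mem_union] at hn
    rcases hn with hn | hn
    · have := hle n hn; omega
    · obtain ⟨n', hn', rfl⟩ := Finset.mem_image.1 hn
      have := hle n' hn'; show n' + t ≤ _; omega)
  rw [Finset.card_union_of_disjoint hdisj, Finset.card_image_of_injective _ hinj, hcard] at this
  omega

theorem sum_range_shift_sub (L : ℕ → ℝ) (k n : ℕ) :
    ∑ i ∈ Finset.range n, (L (i + k) - L i) = ∑ j ∈ Finset.range k, (L (n + j) - L j) := by
  rw [Finset.sum_sub_distrib, Finset.sum_sub_distrib]
  have h1 := Finset.sum_range_add L k n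
  have h2 := Finset.sum_range_add L n k
  rw [add_comm n k] at h2
  have h3 : ∑ i ∈ Finset.range n, L (i + k) = ∑ i ∈ Finset.range n, L (k + i) := by
    simp only [add_comm]
  linarith

open Classical in
theorem card_bad_le {b : ℕ} (ω : Fin b → ℝ) (a n : ℕ) :
    (((Finset.range n).filter (fun i => ¬ GoodScale ω i a)).card : ℝ) ≤
      (a + 1) * (2 * a * b + 1) := by
  set L : ℕ → ℝ := fun i => Real.logb 2 (packing ((1 / 4 : ℝ) ^ a) ω (2 ^ i)) with hL
  have hL0 : ∀ i, 0 ≤ L i := fun i =>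
    Real.logb_nonneg (by norm_num) (by exact_mod_cast packing_pos _ _ _)
  have hLb : ∀ i, L i ≤ 2 * a * b := by
    intro i
    have h1 : ((packing ((1 / 4 : ℝ) ^ a) ω (2 ^ i) : ℕ) : ℝ) ≤ (4 ^ a) ^ b := by
      exact_mod_cast packing_le a ω (2 ^ i)
    have h0 : (0 : ℝ) < packing ((1 / 4 : ℝ) ^ a) ω (2 ^ i) := by
      exact_mod_cast packing_pos _ _ _
    calc L i ≤ Real.logb 2 ((4 ^ a) ^ b) := Real.logb_le_logb_of_le (by norm_num) h0 h1
      _ = 2 * a * b := by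
        have : ((4 : ℝ) ^ a) ^ b = 2 ^ (2 * a * b : ℕ) := by
          rw [pow_mul, pow_mul]; norm_num
        rw [this, ← Real.rpow_natCast, Real.logb_rpow (by norm_num) (by norm_num)]
        push_cast; ring
  have hmono : ∀ i, L i ≤ L (i + (a + 1)) := by
    intro i
    apply Real.logb_le_logb_of_le (by norm_num)
    · exact_mod_cast packing_pos _ _ _
    · obtain ⟨S, hS, hle, hc⟩ := exists_separated_card_eq ((1 / 4 : ℝ) ^ a) ω (2 ^ i)
      rw [← hc]
      exact_mod_cast hS.card_le_packing
        (fun n hn => (hle n hn).trans (Nat.pow_le_pow_right (by norm_num) (by omega)))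
  have hstep : ∀ i, (if ¬ GoodScale ω (i + (a + 1)) a then (1 : ℝ) else 0) ≤
      L (i + (a + 1)) - L i := by
    intro i
    split_ifs with h
    · simp only [sub_nonneg]; exact hmono i
    · have h2 := two_mul_packing_le (i := i) (a := a) (ω := ω) h
      have h0 : (0 : ℝ) < packing ((1 / 4 : ℝ) ^ a) ω (2 ^ i) := by
        exact_mod_cast packing_pos _ _ _
      have h3 : Real.logb 2 (2 * packing ((1 / 4 : ℝ) ^ a) ω (2 ^ i)) ≤ L (i + (a + 1)) :=
        Real.logb_le_logb_of_le (by norm_num) (by positivity) (by exact_mod_cast h2)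
      rw [Real.logb_mul (by norm_num) h0.ne', Real.logb_self_eq_one (by norm_num)] at h3
      linarith
  have hsum : (((Finset.range n).filter (fun i => ¬ GoodScale ω i a)).card : ℝ) =
      ∑ i ∈ Finset.range n, (if ¬ GoodScale ω i a then (1 : ℝ) else 0) := by
    rw [Finset.sum_boole]
  have hsub : ∑ i ∈ Finset.range n, (if ¬ GoodScale ω i a then (1 : ℝ) else 0) ≤
      ∑ i ∈ Finset.range (a + 1 + n), (if ¬ GoodScale ω i a then (1 : ℝ) else 0) :=
    Finset.sum_le_sum_of_subset_of_nonneg (Finset.range_subset_range.2 (by omega))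
      (fun i _ _ => by split_ifs <;> norm_num)
  have hfirst : ∑ i ∈ Finset.range (a + 1), (if ¬ GoodScale ω i a then (1 : ℝ) else 0) ≤ a + 1 := by
    calc _ ≤ ∑ i ∈ Finset.range (a + 1), (1 : ℝ) :=
          Finset.sum_le_sum (fun i _ => by split_ifs <;> norm_num)
      _ = a + 1 := by simp
  have hsecond : ∑ i ∈ Finset.range n,
      (if ¬ GoodScale ω (a + 1 + i) a then (1 : ℝ) else 0) ≤ (a + 1) * (2 * a * b) := by
    calc _ ≤ ∑ i ∈ Finset.range n, (L (i + (a + 1)) - L i) := by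
          apply Finset.sum_le_sum
          intro i _
          rw [add_comm (a + 1) i]
          exact hstep i
      _ = ∑ j ∈ Finset.range (a + 1), (L (n + j) - L j) := sum_range_shift_sub L (a + 1) n
      _ ≤ ∑ j ∈ Finset.range (a + 1), (2 * a * b : ℝ) :=
          Finset.sum_le_sum (fun j _ => by linarith [hLb (n + j), hL0 j])
      _ = (a + 1) * (2 * a * b) := by simp
  rw [Finset.sum_range_add] at hsub
  rw [hsum]
  nlinarith

open Classical in
theorem exists_scale_error {b : ℕ} (ω : Fin b → ℝ) (a₀ i : ℕ) :
    ∃ e : ℝ, 0 ≤ e ∧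
      e ≤ 2 ^ (a₀ + 1) * ((∑ a ∈ Finset.range (i + 4),
        (if ¬ GoodScale ω i a then (1 : ℝ) else 0) * (1 / 2) ^ a) + (1 / 2) ^ i) ∧
      (e = 1 ∨ ∃ a, a₀ ≤ a ∧ a ≤ i + 3 ∧ GoodScale ω i a ∧ e = (1 / 2) ^ a) := by
  have hone : (1 : ℝ) ≤ 2 ^ (a₀ + 1) := one_le_pow₀ (by norm_num)
  have hterm : ∀ a ∈ Finset.range (i + 4),
      0 ≤ (if ¬ GoodScale ω i a then (1 : ℝ) else 0) * (1 / 2) ^ a := by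
    intro a _; split_ifs <;> positivity
  have hsum0 := Finset.sum_nonneg hterm
  have hbad : ∀ a < i + 4, ¬ GoodScale ω i a → (1 / 2 : ℝ) ^ a ≤ ∑ a ∈ Finset.range (i + 4),
        (if ¬ GoodScale ω i a then (1 : ℝ) else 0) * (1 / 2) ^ a := by
    intro a ha hb
    have := Finset.single_le_sum hterm (Finset.mem_range.2 ha)
    simpa [hb] using this
  have hi0 : (0 : ℝ) ≤ (1 / 2) ^ i := by positivity
  by_cases hex : ∃ a, a ≤ i + 3 ∧ (a₀ ≤ a ∧ GoodScale ω i a)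
  · obtain ⟨a₁, ha₁, hP⟩ := hex
    set a := Nat.findGreatest (fun a => a₀ ≤ a ∧ GoodScale ω i a) (i + 3) with ha
    have hspec : a₀ ≤ a ∧ GoodScale ω i a :=
      Nat.findGreatest_spec (P := fun a => a₀ ≤ a ∧ GoodScale ω i a) ha₁ hP
    have hle : a ≤ i + 3 := Nat.findGreatest_le _
    refine ⟨(1 / 2) ^ a, by positivity, ?_, Or.inr ⟨a, hspec.1, hle, hspec.2, rfl⟩⟩
    have key : (1 / 2 : ℝ) ^ a ≤ 2 * ((∑ a ∈ Finset.range (i + 4),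
        (if ¬ GoodScale ω i a then (1 : ℝ) else 0) * (1 / 2) ^ a) + (1 / 2) ^ i) := by
      rcases hle.eq_or_lt with h | h
      · rw [h, pow_add]; nlinarith
      · have hb : ¬ GoodScale ω i (a + 1) := fun hg =>
          Nat.findGreatest_is_greatest (P := fun a => a₀ ≤ a ∧ GoodScale ω i a)
            (Nat.lt_succ_self _) h ⟨hspec.1.trans (Nat.le_succ _), hg⟩
        have := hbad (a + 1) (by omega) hb
        rw [pow_succ] at this
        linarith
    refine key.trans (mul_le_mul_of_nonneg_right ?_ (by positivity))
    rw [pow_succ]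
    have : (1 : ℝ) ≤ 2 ^ a₀ := one_le_pow₀ (by norm_num)
    linarith
  · refine ⟨1, zero_le_one, ?_, Or.inl rfl⟩
    have h2 : (2 : ℝ) ^ (a₀ + 1) * (1 / 2) ^ a₀ = 2 := by
      rw [pow_succ, mul_right_comm, ← mul_pow]; norm_num
    have hp : (0 : ℝ) < 2 ^ (a₀ + 1) := by positivity
    by_cases h : a₀ < i + 4
    · have hb : ¬ GoodScale ω i a₀ := fun hg => hex ⟨a₀, by omega, le_rfl, hg⟩
      have := hbad a₀ h hb
      nlinarith
    · have : (1 / 2 : ℝ) ^ a₀ ≤ (1 / 2) ^ i :=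
        pow_le_pow_of_le_one (by norm_num) (by norm_num) (by omega)
      nlinarith

theorem exists_summable_errors (b a₀ : ℕ) : ∃ S : ℝ, ∀ ω : Fin b → ℝ, ∃ e : ℕ → ℝ,
    (∀ i, 0 ≤ e i) ∧ (∀ n, ∑ i ∈ Finset.range n, e i ≤ S) ∧
      ∀ i, e i = 1 ∨ ∃ a, a₀ ≤ a ∧ a ≤ i + 3 ∧ GoodScale ω i a ∧ e i = (1 / 2) ^ a := by
  classical
  have hs : Summable (fun a : ℕ => ((a : ℝ) + 1) * (2 * a * b + 1) * (1 / 2) ^ a) := by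
    have h2 := summable_pow_mul_geometric_of_norm_lt_one (R := ℝ) 2 (r := 1 / 2) (by norm_num)
    have h1 := summable_pow_mul_geometric_of_norm_lt_one (R := ℝ) 1 (r := 1 / 2) (by norm_num)
    have h0 := summable_pow_mul_geometric_of_norm_lt_one (R := ℝ) 0 (r := 1 / 2) (by norm_num)
    refine (((h2.mul_left (2 * b : ℝ)).add (h1.mul_left (2 * b + 1 : ℝ))).add h0).congr ?_
    intro a
    ring
  refine ⟨2 ^ (a₀ + 1) * ((∑' a : ℕ, ((a : ℝ) + 1) * (2 * a * b + 1) * (1 / 2) ^ a) + 2),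
    fun ω => ?_⟩
  choose e he0 hele hes using exists_scale_error ω a₀
  refine ⟨e, he0, fun n => ?_, hes⟩
  have hgeo : ∑ i ∈ Finset.range n, (1 / 2 : ℝ) ^ i ≤ 2 := sum_geometric_two_le n
  have hswap : ∑ i ∈ Finset.range n, ∑ a ∈ Finset.range (i + 4),
      (if ¬ GoodScale ω i a then (1 : ℝ) else 0) * (1 / 2) ^ a ≤
      ∑' a : ℕ, ((a : ℝ) + 1) * (2 * a * b + 1) * (1 / 2) ^ a := by
    calc _ ≤ ∑ i ∈ Finset.range n, ∑ a ∈ Finset.range (n + 4),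
          (if ¬ GoodScale ω i a then (1 : ℝ) else 0) * (1 / 2) ^ a := by
          apply Finset.sum_le_sum
          intro i hi
          rw [Finset.mem_range] at hi
          apply Finset.sum_le_sum_of_subset_of_nonneg (Finset.range_subset_range.2 (by omega))
          intro a _ _
          split_ifs <;> positivity
      _ = ∑ a ∈ Finset.range (n + 4), ∑ i ∈ Finset.range n,
          (if ¬ GoodScale ω i a then (1 : ℝ) else 0) * (1 / 2) ^ a := Finset.sum_comm
      _ ≤ ∑ a ∈ Finset.range (n + 4), ((a : ℝ) + 1) * (2 * a * b + 1) * (1 / 2) ^ a := by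
          apply Finset.sum_le_sum
          intro a _
          rw [← Finset.sum_mul, Finset.sum_boole]
          exact mul_le_mul_of_nonneg_right (card_bad_le ω a n) (by positivity)
      _ ≤ _ := hs.sum_le_tsum _ (fun a _ => by positivity)
  calc ∑ i ∈ Finset.range n, e i ≤ _ := Finset.sum_le_sum (fun i _ => hele i)
    _ = 2 ^ (a₀ + 1) * ((∑ i ∈ Finset.range n, ∑ a ∈ Finset.range (i + 4),
      (if ¬ GoodScale ω i a then (1 : ℝ) else 0) * (1 / 2) ^ a) +
        ∑ i ∈ Finset.range n, (1 / 2 : ℝ) ^ i) := by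
        rw [← Finset.mul_sum, Finset.sum_add_distrib]
    _ ≤ _ := mul_le_mul_of_nonneg_left (add_le_add hswap hgeo) (by positivity)

end Separation

section DyadicRecursion

theorem exists_potential_le {d ε : ℕ → ℝ} {M S : ℝ} (hmono : Monotone d) (hd0 : 0 ≤ d 0)
    (hε : ∀ i, 0 ≤ ε i) (hsum : ∀ n, ∑ i ∈ Finset.range n, ε i ≤ S)
    (hrec : ∀ i, d (i + 1) ≤ M → d (i + 3) ≤ 2 * d (i + 1) - d i + ε i * d (i + 1))
    (hsmall : 3 * d 1 * Real.exp (2 * S) ≤ M) (N : ℕ) :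
    ∃ i, N ≤ i ∧ d (i + 1) + 2 * (d (i + 1) - d i) ≤
      3 * d 1 * Real.exp (2 * ∑ j ∈ Finset.range i, ε j) := by
  have hnn : ∀ i, 0 ≤ d i := fun i => hd0.trans (hmono (Nat.zero_le i))
  induction N with
  | zero =>
    refine ⟨0, le_rfl, ?_⟩
    simp only [Finset.range_zero, Finset.sum_empty, mul_zero, Real.exp_zero]
    linarith
  | succ N ih =>
    obtain ⟨i, hi, hΦ⟩ := ih
    have h01 : d i ≤ d (i + 1) := hmono (by omega)
    have h12 : d (i + 1) ≤ d (i + 2) := hmono (by omega)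
    have h23 : d (i + 2) ≤ d (i + 3) := hmono (by omega)
    set s := ∑ j ∈ Finset.range i, ε j with hs
    have hexp : Real.exp (2 * s) ≤ Real.exp (2 * S) :=
      Real.exp_le_exp.2 (by linarith [hsum i])
    have hM : d (i + 1) ≤ M := by
      have : 3 * d 1 * Real.exp (2 * s) ≤ 3 * d 1 * Real.exp (2 * S) :=
        mul_le_mul_of_nonneg_left hexp (by linarith [hnn 1])
      linarith
    have hr := hrec i hM
    have hεd : 0 ≤ ε i * d (i + 1) := mul_nonneg (hε i) (hnn _)
    have hstep : ∀ P : ℝ, P ≤ d (i + 1) + 2 * (d (i + 1) - d i) + 2 * (ε i * d (i + 1)) →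
        P ≤ 3 * d 1 * Real.exp (2 * (s + ε i)) := by
      intro P hP
      have h1 : 1 + 2 * ε i ≤ Real.exp (2 * ε i) := by
        linarith [Real.add_one_le_exp (2 * ε i)]
      have h2 : (d (i + 1) + 2 * (d (i + 1) - d i)) * (1 + 2 * ε i) ≤
          (3 * d 1 * Real.exp (2 * s)) * Real.exp (2 * ε i) := by
        apply mul_le_mul hΦ h1
        · linarith [hε i]
        · have := hnn 1; positivity
      have h3 : 0 ≤ ε i * (d (i + 1) - d i) := mul_nonneg (hε i) (by linarith)
      rw [mul_add, Real.exp_add]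
      nlinarith
    rcases le_total (d (i + 2) - d (i + 1)) (d (i + 3) - d (i + 2)) with h | h
    · refine ⟨i + 1, by omega, ?_⟩
      rw [Finset.sum_range_succ, ← hs]
      apply hstep
      have e : i + 1 + 1 = i + 2 := rfl
      rw [e]
      nlinarith
    · refine ⟨i + 2, by omega, ?_⟩
      have : 3 * d 1 * Real.exp (2 * (s + ε i)) ≤
          3 * d 1 * Real.exp (2 * (∑ j ∈ Finset.range (i + 2), ε j)) := by
        rw [Finset.sum_range_succ, Finset.sum_range_succ, ← hs]
        apply mul_le_mul_of_nonneg_left (Real.exp_le_exp.2 _) (by linarith [hnn 1])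
        linarith [hε (i + 1)]
      refine (hstep _ ?_).trans this
      have e : i + 2 + 1 = i + 3 := rfl
      rw [e]
      nlinarith

theorem bounded_of_dyadic_recursion {d ε : ℕ → ℝ} {M S : ℝ} (hmono : Monotone d) (hd0 : 0 ≤ d 0)
    (hε : ∀ i, 0 ≤ ε i) (hsum : ∀ n, ∑ i ∈ Finset.range n, ε i ≤ S)
    (hrec : ∀ i, d (i + 1) ≤ M → d (i + 3) ≤ 2 * d (i + 1) - d i + ε i * d (i + 1))
    (hsmall : 3 * d 1 * Real.exp (2 * S) ≤ M) (n : ℕ) :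
    d n ≤ 3 * d 1 * Real.exp (2 * S) := by
  obtain ⟨i, hi, h⟩ := exists_potential_le hmono hd0 hε hsum hrec hsmall n
  have h0 : 0 ≤ d 1 := hd0.trans (hmono (Nat.zero_le 1))
  have h1 : d n ≤ d (i + 1) := hmono (by omega)
  have h2 : d i ≤ d (i + 1) := hmono (by omega)
  have h3 : 3 * d 1 * Real.exp (2 * ∑ j ∈ Finset.range i, ε j) ≤ 3 * d 1 * Real.exp (2 * S) :=
    mul_le_mul_of_nonneg_left (Real.exp_le_exp.2 (by linarith [hsum i])) (by linarith)
  linarith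

end DyadicRecursion

section LogIntegral

theorem circle_lintegral_sub_log_norm_le {g : ℂ → ℂ} {c : ℂ} {r K : ℝ} (hr : 0 < r) (hK : 0 ≤ K)
    (hg : AnalyticOnNhd ℂ g (Metric.closedBall c r))
    (hbd : ∀ z ∈ Metric.closedBall c r, ‖g z‖ ≤ Real.exp K) (hc : g c ≠ 0) :
    ∫⁻ θ in Set.Ioo (-Real.pi) Real.pi,
      ENNReal.ofReal (K - Real.log ‖g (circleMap c r θ)‖) ≤
      ENNReal.ofReal (2 * Real.pi * (K - Real.log ‖g c‖)) := by
  have hr' : |r| = r := abs_of_pos hr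
  have hlog : ∀ z ∈ Metric.closedBall c r, Real.log ‖g z‖ ≤ K := by
    intro z hz
    rcases eq_or_ne (g z) 0 with h | h
    · simpa [h] using hK
    · rw [Real.log_le_iff_le_exp (norm_pos_iff.2 h)]; exact hbd z hz
  have hci : CircleIntegrable (Real.log ‖g ·‖) c r := by
    apply MeromorphicOn.circleIntegrable_log_norm
    rw [hr']
    exact (hg.mono Metric.sphere_subset_closedBall).meromorphicOn
  have hci' : CircleIntegrable (fun z => K - Real.log ‖g z‖) c r :=
    (circleIntegrable_const K c r).sub hci
  have hav : Real.circleAverage (fun z => K - Real.log ‖g z‖) c r ≤ K - Real.log ‖g c‖ := by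
    rw [Real.circleAverage_fun_sub (circleIntegrable_const K c r) hci, Real.circleAverage_const]
    have hJ := AnalyticOnNhd.circleAverage_log_norm hr.ne' (by rwa [hr']) hc
    have hnn : 0 ≤ ∑ᶠ u, (MeromorphicOn.divisor g (Metric.closedBall c |r|) u : ℝ) *
        Real.log (r * ‖c - u‖⁻¹) := by
      apply finsum_nonneg
      intro u
      by_cases hu : u ∈ Metric.closedBall c |r|
      · apply mul_nonneg
        · have := (MeromorphicOn.AnalyticOnNhd.divisor_nonneg (f := g)
            (U := Metric.closedBall c |r|) (by rwa [hr'])) u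
          exact_mod_cast this
        · rcases eq_or_ne u c with h | h
          · simp [h]
          · apply Real.log_nonneg
            rw [hr', Metric.mem_closedBall, dist_comm, dist_eq_norm] at hu
            have : 0 < ‖c - u‖ := norm_pos_iff.2 (sub_ne_zero.2 h.symm)
            rw [← div_eq_mul_inv, le_div_iff₀ this]
            linarith
      · simp [hu]
    linarith
  rw [Real.circleAverage_eq_integral_add (-Real.pi)] at hav
  have hper : Function.Periodic (fun θ => K - Real.log ‖g (circleMap c r θ)‖) (2 * Real.pi) :=
    fun θ => by simp only [periodic_circleMap c r θ]
  have hint : IntervalIntegrable (fun θ => K - Real.log ‖g (circleMap c r θ)‖) volume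
      (-Real.pi) Real.pi := by
    have h2 : IntervalIntegrable (fun θ => K - Real.log ‖g (circleMap c r θ)‖) volume
      0 (0 + 2 * Real.pi) := by simpa [CircleIntegrable] using hci'
    exact hper.intervalIntegrable (by positivity) h2 _ _
  have hpi := Real.pi_pos
  have heq : ∫ θ in (0 : ℝ)..2 * Real.pi, (K - Real.log ‖g (circleMap c r (θ + -Real.pi))‖) =
      ∫ θ in (-Real.pi)..Real.pi, (K - Real.log ‖g (circleMap c r θ)‖) := by
    rw [intervalIntegral.integral_comp_add_right
      (fun θ => K - Real.log ‖g (circleMap c r θ)‖)]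
    congr 1 <;> ring
  rw [heq, smul_eq_mul, inv_mul_le_iff₀ (by positivity),
    intervalIntegral.integral_of_le (by linarith)] at hav
  rw [intervalIntegrable_iff_integrableOn_Ioc_of_le (by linarith)] at hint
  rw [← restrict_Ioo_eq_restrict_Ioc] at hav
  have hint' := hint.mono_set Set.Ioo_subset_Ioc_self
  rw [← ofReal_integral_eq_lintegral_ofReal hint']
  · exact ENNReal.ofReal_le_ofReal hav
  · filter_upwards with θ
    simp only [Pi.zero_apply, sub_nonneg]
    exact hlog _ (by
      have := circleMap_mem_closedBall c hr.le θ
      exact this)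

theorem lintegral_sub_log_norm_le {g : ℂ → ℂ} {c : ℂ} {R K : ℝ} (hR : 0 < R) (hK : 0 ≤ K)
    (hg : AnalyticOnNhd ℂ g (Metric.closedBall c R))
    (hbd : ∀ z ∈ Metric.closedBall c R, ‖g z‖ ≤ Real.exp K) (hc : g c ≠ 0) :
    ∫⁻ z in Metric.closedBall c R, ENNReal.ofReal (K - Real.log ‖g z‖) ≤
      ENNReal.ofReal (Real.pi * R ^ 2 * (K - Real.log ‖g c‖)) := by
  set Φ : ℂ → ENNReal := (Metric.closedBall c R).indicator
    (fun z => ENNReal.ofReal (K - Real.log ‖g z‖)) with hΦ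
  have hψc : 0 ≤ K - Real.log ‖g c‖ := by
    rw [sub_nonneg, Real.log_le_iff_le_exp (norm_pos_iff.2 hc)]
    exact hbd c (Metric.mem_closedBall_self hR.le)
  have hpi := Real.pi_pos
  rw [← lintegral_indicator measurableSet_closedBall, ← hΦ,
    ← lintegral_add_left_eq_self Φ c, ← Complex.lintegral_comp_polarCoord_symm,
    show polarCoord.target = Set.Ioi (0 : ℝ) ×ˢ Set.Ioo (-Real.pi) Real.pi from rfl,
    Measure.volume_eq_prod, ← Measure.prod_restrict]
  refine (lintegral_prod_le _).trans ?_
  have hin : ∀ r ∈ Set.Ioi (0 : ℝ), ∫⁻ θ in Set.Ioo (-Real.pi) Real.pi,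
      ENNReal.ofReal r • Φ (c + Complex.polarCoord.symm (r, θ)) ≤
      (Set.Ioc 0 R).indicator
        (fun r => ENNReal.ofReal (r * (2 * Real.pi * (K - Real.log ‖g c‖)))) r := by
    intro r hr
    have hr0 : 0 < r := hr
    have hcm : ∀ θ, c + Complex.polarCoord.symm (r, θ) = circleMap c r θ := by
      intro θ
      rw [Complex.polarCoord_symm_apply, circleMap, Complex.exp_mul_I]
      push_cast; ring
    simp only [hcm, smul_eq_mul]
    by_cases hrR : r ≤ R
    · have hsub : Metric.closedBall c r ⊆ Metric.closedBall c R :=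
        Metric.closedBall_subset_closedBall hrR
      rw [Set.indicator_of_mem (show r ∈ Set.Ioc 0 R from ⟨hr0, hrR⟩),
        lintegral_const_mul' _ _ ENNReal.ofReal_ne_top, ENNReal.ofReal_mul hr0.le]
      gcongr
      have := circle_lintegral_sub_log_norm_le hr0 hK (hg.mono hsub)
        (fun z hz => hbd z (hsub hz)) hc
      refine le_trans (lintegral_mono fun θ => ?_) this
      exact Set.indicator_le_self _ _ _
    · have : ∀ θ, Φ (circleMap c r θ) = 0 := by
        intro θ
        apply Set.indicator_of_notMem
        rw [Metric.mem_closedBall, dist_eq_norm, circleMap_sub_center, norm_circleMap_zero,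
          abs_of_pos hr0]
        exact hrR
      simp [this]
  refine (setLIntegral_mono' measurableSet_Ioi hin).trans ?_
  rw [setLIntegral_indicator measurableSet_Ioc]
  have hset : Set.Ioc 0 R ∩ Set.Ioi (0 : ℝ) = Set.Ioc 0 R := by
    ext x; simp only [Set.mem_inter_iff, Set.mem_Ioc, Set.mem_Ioi]; tauto
  rw [hset, ← ofReal_integral_eq_lintegral_ofReal]
  · apply ENNReal.ofReal_le_ofReal
    rw [← intervalIntegral.integral_of_le hR.le, intervalIntegral.integral_mul_const,
      integral_id]
    apply le_of_eq; ring
  · exact (Continuous.integrableOn_Icc (by fun_prop)).mono_set Set.Ioc_subset_Icc_self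
  · rw [EventuallyLE, ae_restrict_iff' measurableSet_Ioc]
    filter_upwards with r hr
    have := hr.1.le
    simp only [Pi.zero_apply]
    positivity

/-- The horizontal strip `|Im z| < R`. -/
def strip (R : ℝ) : Set ℂ := {z | |z.im| < R}

theorem isOpen_strip (R : ℝ) : IsOpen (strip R) :=
  isOpen_lt (Complex.continuous_im.abs) continuous_const

theorem convex_strip (R : ℝ) : Convex ℝ (strip R) := by
  have : strip R = Complex.imLm ⁻¹' Set.Ioo (-R) R := by
    ext z; simp [strip, abs_lt]
  rw [this]
  exact (convex_Ioo _ _).linear_preimage _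

theorem add_ofReal_mem_strip {R : ℝ} {z : ℂ} (hz : z ∈ strip R) (x : ℝ) : z + x ∈ strip R := by
  simpa [strip] using hz

theorem closedBall_subset_strip {R r : ℝ} {c : ℂ} (h : |c.im| + r < R) :
    Metric.closedBall c r ⊆ strip R := by
  intro z hz
  rw [Metric.mem_closedBall, dist_eq_norm] at hz
  have h1 : |(z - c).im| ≤ r := (Complex.abs_im_le_norm _).trans hz
  have h2 : |z.im| ≤ |(z - c).im| + |c.im| := by
    have : z.im = (z - c).im + c.im := by simp
    rw [this]; exact abs_add_le _ _
  change |z.im| < R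
  linarith

theorem ae_strip_ne_zero {g : ℂ → ℂ} {R : ℝ} (hg : DifferentiableOn ℂ g (strip R))
    {c : ℂ} (hc : c ∈ strip R) (hgc : g c ≠ 0) :
    volume {z ∈ strip R | g z = 0} = 0 := by
  have han : AnalyticOnNhd ℂ g (strip R) := hg.analyticOnNhd (isOpen_strip R)
  rcases han.eqOn_zero_or_eventually_ne_zero_of_preconnected (convex_strip R).isPreconnected
    with h | h
  · exact absurd (h hc) hgc
  · have := ae_restrict_le_codiscreteWithin (μ := volume) (isOpen_strip R).measurableSet h
    have h2 : ∀ᵐ z ∂(volume.restrict (strip R)), g z ≠ 0 := this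
    rw [ae_restrict_iff' (isOpen_strip R).measurableSet, ae_iff] at h2
    convert h2 using 2
    ext z; simp

theorem lintegral_shift_le {g : ℂ → ℂ} {R K η : ℝ} (hK : 0 ≤ K) (hη : 0 < η) (hR : 4 * η < R)
    (hg : DifferentiableOn ℂ g (strip R)) (hbd : ∀ z ∈ strip R, ‖g z‖ ≤ Real.exp K)
    (hg0 : g 0 ≠ 0) (x τ : ℝ) (hτ : |τ| ≤ η) :
    ∫⁻ z in Metric.closedBall ((x + τ : ℝ) : ℂ) η, ENNReal.ofReal (K - Real.log ‖g z‖) ≤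
      9 * ∫⁻ z in Metric.closedBall (x : ℂ) η, ENNReal.ofReal (K - Real.log ‖g z‖) := by
  have hpi := Real.pi_pos
  have h0 : (0 : ℂ) ∈ strip R := by 
    simp only [strip, Set.mem_ofPred_eq, Complex.zero_im, abs_zero]; linarith
  have hsub : Metric.closedBall (x : ℂ) η ⊆ strip R :=
    closedBall_subset_strip (by simp only [Complex.ofReal_im, abs_zero]; linarith)
  have hvol : volume (Metric.closedBall (x : ℂ) η) = ENNReal.ofReal (Real.pi * η ^ 2) := by
    rw [Complex.volume_closedBall, ← ENNReal.ofReal_pow hη.le, ← ENNReal.ofReal_coe_nnreal,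
      ← ENNReal.ofReal_mul (by positivity), mul_comm]
    rfl
  have hμ : volume.restrict (Metric.closedBall (x : ℂ) η) ≠ 0 := by
    rw [Ne, Measure.restrict_eq_zero, hvol, ENNReal.ofReal_eq_zero]
    have : 0 < Real.pi * η ^ 2 := by positivity
    linarith
  have hmeas : AEMeasurable (fun z => ENNReal.ofReal (K - Real.log ‖g z‖))
      (volume.restrict (Metric.closedBall (x : ℂ) η)) := by
    have h1 : AEMeasurable g (volume.restrict (Metric.closedBall (x : ℂ) η)) :=
      (hg.continuousOn.mono hsub).aemeasurable measurableSet_closedBall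
    exact (aemeasurable_const.sub (Real.measurable_log.comp_aemeasurable h1.norm)).ennreal_ofReal
  have hN : (volume.restrict (Metric.closedBall (x : ℂ) η))
      ({z ∈ strip R | g z = 0} ∪ (Metric.closedBall (x : ℂ) η)ᶜ) = 0 := by
    apply measure_union_null
    · exact le_antisymm ((Measure.restrict_apply_le _ _).trans
        (ae_strip_ne_zero hg h0 hg0).le) zero_le
    · rw [Measure.restrict_apply measurableSet_closedBall.compl, Set.compl_inter_self,
        measure_empty]
  have : IsFiniteMeasure (volume.restrict (Metric.closedBall (x : ℂ) η)) :=
    ⟨by rw [Measure.restrict_apply_univ, hvol]; exact ENNReal.ofReal_lt_top⟩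
  obtain ⟨s, hs, hle⟩ := exists_notMem_null_le_laverage hμ hmeas hN
  rw [Set.mem_union, not_or, Set.notMem_compl_iff] at hs
  obtain ⟨hs1, hs2⟩ := hs
  have hgs : g s ≠ 0 := fun h => hs1 ⟨hsub hs2, h⟩
  have him : |s.im| ≤ η := by
    rw [Metric.mem_closedBall, dist_eq_norm] at hs2
    have := (Complex.abs_im_le_norm _).trans hs2
    simpa using this
  have hsub3 : Metric.closedBall s (3 * η) ⊆ strip R := closedBall_subset_strip (by linarith)
  have hsubτ : Metric.closedBall ((x + τ : ℝ) : ℂ) η ⊆ Metric.closedBall s (3 * η) := by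
    apply Metric.closedBall_subset_closedBall'
    have h1 : dist ((x + τ : ℝ) : ℂ) x ≤ η := by
      rw [dist_eq_norm]; simpa using hτ
    have h2 : dist (x : ℂ) s ≤ η := by rw [dist_comm]; exact hs2
    have := dist_triangle ((x + τ : ℝ) : ℂ) x s
    linarith
  have hmain := lintegral_sub_log_norm_le (c := s) (R := 3 * η) (by positivity) hK
    ((hg.analyticOnNhd (isOpen_strip R)).mono hsub3) (fun z hz => hbd z (hsub3 hz)) hgs
  rw [setLAverage_eq, hvol] at hle
  calc _ ≤ ∫⁻ z in Metric.closedBall s (3 * η), ENNReal.ofReal (K - Real.log ‖g z‖) :=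
        lintegral_mono_set hsubτ
    _ ≤ ENNReal.ofReal (Real.pi * (3 * η) ^ 2 * (K - Real.log ‖g s‖)) := hmain
    _ = 9 * (ENNReal.ofReal (Real.pi * η ^ 2) * ENNReal.ofReal (K - Real.log ‖g s‖)) := by
        rw [← ENNReal.ofReal_mul (by positivity),
          show (9 : ENNReal) = ENNReal.ofReal 9 by simp, ← ENNReal.ofReal_mul (by norm_num)]
        congr 1; ring
    _ ≤ 9 * ∫⁻ z in Metric.closedBall (x : ℂ) η, ENNReal.ofReal (K - Real.log ‖g z‖) := by
        gcongr
        calc _ ≤ ENNReal.ofReal (Real.pi * η ^ 2) * (_ / ENNReal.ofReal (Real.pi * η ^ 2)) := by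
              gcongr
          _ = _ := by
              apply ENNReal.mul_div_cancel
              · rw [Ne, ENNReal.ofReal_eq_zero]
                have : 0 < Real.pi * η ^ 2 := by positivity
                linarith
              · exact ENNReal.ofReal_ne_top

theorem lintegral_translate_le {g : ℂ → ℂ} {R K η : ℝ} (hK : 0 ≤ K) (hη : 0 < η) (hR : 4 * η < R)
    (hg : DifferentiableOn ℂ g (strip R)) (hbd : ∀ z ∈ strip R, ‖g z‖ ≤ Real.exp K)
    (hg0 : g 0 ≠ 0) (N : ℕ) (x : ℝ) (hx : |x| ≤ N * η) :
    ∫⁻ z in Metric.closedBall (x : ℂ) η, ENNReal.ofReal (K - Real.log ‖g z‖) ≤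
      9 ^ N * ENNReal.ofReal (Real.pi * η ^ 2 * (K - Real.log ‖g 0‖)) := by
  induction N generalizing x with
  | zero =>
    have hx0 : x = 0 := by simpa using hx
    subst hx0
    have hsub : Metric.closedBall (0 : ℂ) η ⊆ strip R :=
      closedBall_subset_strip (by simp only [Complex.zero_im, abs_zero]; linarith)
    simpa using lintegral_sub_log_norm_le (c := 0) hη hK
      ((hg.analyticOnNhd (isOpen_strip R)).mono hsub) (fun z hz => hbd z (hsub hz)) hg0
  | succ N ih =>
    have hN : (0 : ℝ) ≤ N := Nat.cast_nonneg N
    set y := x * (N / (N + 1)) with hy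
    have hxy : x = y + x / (N + 1) := by rw [hy]; field_simp
    have h1 : |y| ≤ N * η := by
      rw [hy, abs_mul, abs_of_nonneg (by positivity : (0 : ℝ) ≤ N / (N + 1))]
      push_cast at hx
      calc |x| * (N / (N + 1)) ≤ (N + 1) * η * (N / (N + 1)) := by gcongr
        _ = N * η := by field_simp
    have h2 : |x / (N + 1)| ≤ η := by
      rw [abs_div, abs_of_pos (by positivity : (0 : ℝ) < (N : ℝ) + 1), div_le_iff₀ (by positivity)]
      push_cast at hx; linarith
    have := lintegral_shift_le hK hη hR hg hbd hg0 y _ h2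
    rw [← hxy] at this
    refine this.trans ?_
    rw [pow_succ, mul_comm ((9 : ENNReal) ^ N), mul_assoc]
    gcongr
    exact ih y h1

theorem exists_window {g : ℂ → ℂ} {R K η δ : ℝ} (hK : 0 ≤ K) (hη : 0 < η) (hR : 4 * η < R)
    (hg : DifferentiableOn ℂ g (strip R)) (hbd : ∀ z ∈ strip R, ‖g z‖ ≤ Real.exp K)
    (hg0 : g 0 ≠ 0) (hδ : 0 ≤ δ) (N J : ℕ) (hJ : J * δ ≤ N * η) :
    ∃ s : ℂ, ‖s‖ ≤ η ∧ (∀ j ≤ J, g (s + (j * δ : ℝ)) ≠ 0) ∧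
      ∑ j ∈ Finset.range (J + 1), (K - Real.log ‖g (s + (j * δ : ℝ))‖) ≤
        (J + 1) * 9 ^ N * (K - Real.log ‖g 0‖) := by
  have hpi := Real.pi_pos
  have h0 : (0 : ℂ) ∈ strip R := by 
    simp only [strip, Set.mem_ofPred_eq, Complex.zero_im, abs_zero]; linarith
  have hlog : ∀ z ∈ strip R, Real.log ‖g z‖ ≤ K := by
    intro z hz
    rcases eq_or_ne (g z) 0 with h | h
    · simpa [h] using hK
    · rw [Real.log_le_iff_le_exp (norm_pos_iff.2 h)]; exact hbd z hz
  set D := Metric.closedBall (0 : ℂ) η with hD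
  have hsub : D ⊆ strip R :=
    closedBall_subset_strip (by simp only [Complex.zero_im, abs_zero]; linarith)
  have hvol : volume D = ENNReal.ofReal (Real.pi * η ^ 2) := by
    rw [hD, Complex.volume_closedBall, ← ENNReal.ofReal_pow hη.le, ← ENNReal.ofReal_coe_nnreal,
      ← ENNReal.ofReal_mul (by positivity), mul_comm]
    rfl
  have hv0 : 0 < Real.pi * η ^ 2 := by positivity
  have hμ : volume.restrict D ≠ 0 := by
    rw [Ne, Measure.restrict_eq_zero, hvol, ENNReal.ofReal_eq_zero]
    linarith
  have hmeas : ∀ j : ℕ, AEMeasurable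
      (fun z : ℂ => ENNReal.ofReal (K - Real.log ‖g (z + (j * δ : ℝ))‖)) (volume.restrict D) := by
    intro j
    have h1 : AEMeasurable (fun z : ℂ => g (z + (j * δ : ℝ))) (volume.restrict D) := by
      apply ContinuousOn.aemeasurable _ measurableSet_closedBall
      exact hg.continuousOn.comp (by fun_prop) (fun z hz => add_ofReal_mem_strip (hsub hz) _)
    exact (aemeasurable_const.sub (Real.measurable_log.comp_aemeasurable h1.norm)).ennreal_ofReal
  have hN : (volume.restrict D)
      ((⋃ j : ℕ, {z ∈ strip R | g (z + (j * δ : ℝ)) = 0}) ∪ Dᶜ) = 0 := by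
    apply measure_union_null
    · apply measure_iUnion_null
      intro j
      refine le_antisymm ((Measure.restrict_apply_le _ _).trans ?_) zero_le
      have hpre : {z ∈ strip R | g (z + (j * δ : ℝ)) = 0} =
          (fun z : ℂ => z + (j * δ : ℝ)) ⁻¹' {z ∈ strip R | g z = 0} := by
        ext z; simp [strip]
      rw [hpre, measure_preimage_add_right]
      exact (ae_strip_ne_zero hg h0 hg0).le
    · rw [Measure.restrict_apply measurableSet_closedBall.compl, Set.compl_inter_self,
        measure_empty]
  have : IsFiniteMeasure (volume.restrict (D)) :=
    ⟨by rw [Measure.restrict_apply_univ, hvol]; exact ENNReal.ofReal_lt_top⟩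
  obtain ⟨s, hs, hle⟩ := exists_notMem_null_le_laverage hμ
    (Finset.aemeasurable_fun_sum (Finset.range (J + 1)) (fun j _ => hmeas j)) hN
  rw [Set.mem_union, not_or, Set.notMem_compl_iff] at hs
  obtain ⟨hs1, hs2⟩ := hs
  have hsR := hsub hs2
  refine ⟨s, by simpa [hD] using hs2, fun j _ h => hs1 (Set.mem_iUnion.2 ⟨j, hsR, h⟩), ?_⟩
  have hψ0 : 0 ≤ K - Real.log ‖g 0‖ := sub_nonneg.2 (hlog 0 h0)
  rw [setLAverage_eq, hvol, lintegral_finsetSum' _ (fun j _ => hmeas j)] at hle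
  have hint : ∀ j ∈ Finset.range (J + 1),
      ∫⁻ z in D, ENNReal.ofReal (K - Real.log ‖g (z + (j * δ : ℝ))‖) ≤
      9 ^ N * ENNReal.ofReal (Real.pi * η ^ 2 * (K - Real.log ‖g 0‖)) := by
    intro j hj
    have hj' : (j : ℝ) ≤ J := by
      exact_mod_cast Nat.lt_succ_iff.1 (Finset.mem_range.1 hj)
    have hjδ : |(j * δ : ℝ)| ≤ N * η := by
      rw [abs_of_nonneg (by positivity)]
      exact (mul_le_mul_of_nonneg_right hj' hδ).trans hJ
    refine le_trans (le_of_eq ?_) (lintegral_translate_le hK hη hR hg hbd hg0 N (j * δ) hjδ)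
    rw [← lintegral_indicator measurableSet_closedBall, ← lintegral_indicator measurableSet_closedBall]
    refine Eq.trans ?_ (lintegral_add_right_eq_self _ (((j * δ : ℝ)) : ℂ))
    congr 1
    ext z
    simp only [Set.indicator, Metric.mem_closedBall, dist_eq_norm, add_sub_cancel_right, sub_zero]
  have hle2 := hle.trans (ENNReal.div_le_div_right (Finset.sum_le_sum hint) _)
  rw [Finset.sum_const, Finset.card_range, nsmul_eq_mul, ← ENNReal.ofReal_sum_of_nonneg
    (fun j _ => sub_nonneg.2 (hlog _ (add_ofReal_mem_strip hsR _)))] at hle2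
  have e : (((J + 1 : ℕ) : ENNReal) * (9 ^ N * ENNReal.ofReal
      (Real.pi * η ^ 2 * (K - Real.log ‖g 0‖)))) / ENNReal.ofReal (Real.pi * η ^ 2) =
      ENNReal.ofReal ((J + 1) * 9 ^ N * (K - Real.log ‖g 0‖)) := by
    have h9 : (9 : ENNReal) ^ N = ENNReal.ofReal (9 ^ N) := by
      rw [ENNReal.ofReal_pow (by norm_num)]; simp
    have hJ1 : ((J + 1 : ℕ) : ENNReal) = ENNReal.ofReal ((J : ℝ) + 1) := by
      rw [← ENNReal.ofReal_natCast]; push_cast; rfl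
    rw [h9, hJ1, ← ENNReal.ofReal_mul (by positivity), ← ENNReal.ofReal_mul (by positivity),
      ← ENNReal.ofReal_div_of_pos hv0]
    congr 1
    field_simp
  rw [e, ENNReal.ofReal_le_ofReal_iff (by positivity)] at hle2
  exact hle2

end LogIntegral

section Cocycle

attribute [local instance] Matrix.frobeniusNormedAddCommGroup Matrix.frobeniusNormedSpace
  Matrix.frobeniusNormedRing Matrix.frobeniusNormedAlgebra

/-- Complex `2 × 2` matrices, with the Frobenius norm. -/
abbrev Mat := Matrix (Fin 2) (Fin 2) ℂ

theorem norm_sq_mat (M : Mat) :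
    ‖M‖ ^ 2 = ‖M 0 0‖ ^ 2 + ‖M 0 1‖ ^ 2 + (‖M 1 0‖ ^ 2 + ‖M 1 1‖ ^ 2) := by
  rw [Matrix.frobenius_norm_def, ← Real.sqrt_eq_rpow, Real.sq_sqrt (by positivity)]
  simp [Fin.sum_univ_two]

theorem norm_entry_le (M : Mat) (i j : Fin 2) : ‖M i j‖ ≤ ‖M‖ := by
  have h := norm_sq_mat M
  apply abs_le_of_sq_le_sq' _ (norm_nonneg M) |>.2
  rw [h]
  have h00 := sq_nonneg ‖M 0 0‖
  have h01 := sq_nonneg ‖M 0 1‖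
  have h10 := sq_nonneg ‖M 1 0‖
  have h11 := sq_nonneg ‖M 1 1‖
  fin_cases i <;> fin_cases j <;> simp only [Fin.zero_eta, Fin.mk_one, Fin.isValue] <;> linarith

theorem exists_norm_le_entry (M : Mat) : ∃ i j, ‖M‖ ≤ 2 * ‖M i j‖ := by
  by_contra! h
  have h00 := h 0 0
  have h01 := h 0 1
  have h10 := h 1 0
  have h11 := h 1 1
  have := norm_sq_mat M
  nlinarith [norm_nonneg (M 0 0), norm_nonneg (M 0 1), norm_nonneg (M 1 0), norm_nonneg (M 1 1)]

theorem norm_one_mat_le : ‖(1 : Mat)‖ ≤ 2 := by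
  have := norm_sq_mat 1
  simp at this
  nlinarith [norm_nonneg (1 : Mat)]

theorem one_le_norm_of_det {M : Mat} (h : M.det = 1) : 1 ≤ ‖M‖ := by
  rw [Matrix.det_fin_two] at h
  have h1 : 1 ≤ ‖M 0 0‖ * ‖M 1 1‖ + ‖M 0 1‖ * ‖M 1 0‖ := by
    rw [← norm_mul, ← norm_mul]
    calc (1 : ℝ) = ‖M 0 0 * M 1 1 - M 0 1 * M 1 0‖ := by rw [h, norm_one]
      _ ≤ _ := norm_sub_le _ _
  have := norm_sq_mat M
  nlinarith [norm_nonneg M, sq_nonneg (‖M 0 0‖ - ‖M 1 1‖), sq_nonneg (‖M 0 1‖ - ‖M 1 0‖)]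

theorem norm_adjugate_mat (M : Mat) : ‖M.adjugate‖ = ‖M‖ := by
  have h : ‖M.adjugate‖ ^ 2 = ‖M‖ ^ 2 := by
    rw [norm_sq_mat, norm_sq_mat, Matrix.adjugate_fin_two]
    simp; ring
  exact (pow_left_inj₀ (norm_nonneg _) (norm_nonneg _) two_ne_zero).1 h

theorem norm_le_norm_mul_left {X Y : Mat} (h : X.det = 1) : ‖Y‖ ≤ ‖X * Y‖ * ‖X‖ := by
  have : Y = X.adjugate * (X * Y) := by
    rw [← mul_assoc, Matrix.adjugate_mul, h, one_smul, one_mul]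
  calc ‖Y‖ = ‖X.adjugate * (X * Y)‖ := by rw [← this]
    _ ≤ ‖X.adjugate‖ * ‖X * Y‖ := norm_mul_le _ _
    _ = _ := by rw [norm_adjugate_mat, mul_comm]

/-- An avalanche-type inequality: overlapping long products multiply. -/
theorem norm_overlap_mul_ge (X : Mat) {Y : Mat} (Q : Mat) (h : Y.det = 1) :
    ‖X * Y‖ * ‖Y * Q‖ ≤ 4 * (‖X * Y * Q‖ * ‖Y‖) + 4 * (‖X‖ * ‖Q‖) := by
  obtain ⟨i, c, hic⟩ := exists_norm_le_entry (X * Y)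
  obtain ⟨a, j, haj⟩ := exists_norm_le_entry (Y * Q)
  have key : ∃ a' c', ‖(X * Y) i c * (Y * Q) a j‖ ≤
      ‖(X * Y * Q) i j * Y a c‖ + ‖X i a' * Q c' j‖ := by
    rw [Matrix.det_fin_two] at h
    have hcomp : ∀ p q r s : ℂ, (p = q + r * s ∨ p = q - r * s) → ‖p‖ ≤ ‖q‖ + ‖r * s‖ := by
      rintro p q r s (rfl | rfl)
      · exact norm_add_le _ _
      · exact norm_sub_le _ _
    refine ⟨1 - a, 1 - c, hcomp _ _ _ _ ?_⟩
    fin_cases a <;> fin_cases c <;>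
      simp only [Matrix.mul_apply, Fin.sum_univ_two, Fin.zero_eta, Fin.mk_one, Fin.isValue,
        sub_zero, sub_self]
    · right; linear_combination (-X i 1 * Q 1 j) * h
    · left; linear_combination (X i 1 * Q 0 j) * h
    · left; linear_combination (X i 0 * Q 1 j) * h
    · right; linear_combination (-X i 0 * Q 0 j) * h
  obtain ⟨a', c', hkey⟩ := key
  simp only [norm_mul] at hkey
  have h1 : ‖X * Y‖ * ‖Y * Q‖ ≤ 4 * (‖(X * Y) i c‖ * ‖(Y * Q) a j‖) := by
    calc _ ≤ (2 * ‖(X * Y) i c‖) * (2 * ‖(Y * Q) a j‖) := by gcongr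
      _ = _ := by ring
  have h2 : ‖(X * Y * Q) i j‖ * ‖Y a c‖ ≤ ‖X * Y * Q‖ * ‖Y‖ := by
    gcongr <;> exact norm_entry_le _ _ _
  have h3 : ‖X i a'‖ * ‖Q c' j‖ ≤ ‖X‖ * ‖Q‖ := by
    gcongr <;> exact norm_entry_le _ _ _
  linarith

/-- The complex cocycle generated by `[[W, -1], [1, 0]]` over the translation by `ω`. -/
def cocycle {b : ℕ} (W : (Fin b → ℂ) → ℂ) (ω : Fin b → ℂ) : ℕ → (Fin b → ℂ) → Mat
  | 0, _ => 1
  | (k + 1), z => !![W (z + (k : ℂ) • ω), -1; 1, 0] * cocycle W ω k z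

theorem det_cocycle {b : ℕ} (W : (Fin b → ℂ) → ℂ) (ω : Fin b → ℂ) (n : ℕ) (z : Fin b → ℂ) :
    (cocycle W ω n z).det = 1 := by
  induction n with
  | zero => simp [cocycle]
  | succ n ih => rw [cocycle, Matrix.det_mul, ih, Matrix.det_fin_two]; simp

theorem cocycle_add {b : ℕ} (W : (Fin b → ℂ) → ℂ) (ω : Fin b → ℂ) (m n : ℕ) (z : Fin b → ℂ) :
    cocycle W ω (m + n) z = cocycle W ω n (z + (m : ℂ) • ω) * cocycle W ω m z := by
  induction n with
  | zero => simp [cocycle]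
  | succ n ih =>
    rw [← add_assoc, cocycle, ih, cocycle, ← mul_assoc, add_assoc z, ← add_smul]
    push_cast; rfl

/-- The complex point `x + ζ v` for real vectors `x`, `v`. -/
def line {b : ℕ} (x v : Fin b → ℝ) (ζ : ℂ) : Fin b → ℂ := fun i => (x i : ℂ) + ζ * (v i : ℂ)

/-- The inclusion of real vectors in complex vectors. -/
def cvec {b : ℕ} (x : Fin b → ℝ) : Fin b → ℂ := fun i => (x i : ℂ)

theorem line_zero {b : ℕ} (x v : Fin b → ℝ) : line x v 0 = cvec x := by
  ext i; simp [line, cvec]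

theorem line_ofReal {b : ℕ} (x v : Fin b → ℝ) (s : ℝ) :
    line x v s = cvec (x + s • v) := by
  ext i; simp [line, cvec]

theorem line_add_smul_cvec {b : ℕ} (x v ω : Fin b → ℝ) (ζ : ℂ) (n : ℕ) :
    line x v ζ + (n : ℂ) • cvec ω = line (x + (n : ℝ) • ω) v ζ := by
  ext i; simp [line, cvec]; ring

theorem line_neg {b : ℕ} (x v : Fin b → ℝ) (ζ : ℂ) : line x (-v) ζ = line x v (-ζ) := by
  ext i; simp [line]

/-- `W` is `ℤ^b`-periodic, holomorphic along real directions and bounded by `Λ` in a strip. -/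
structure StripPotential {b : ℕ} (W : (Fin b → ℂ) → ℂ) (ρ Λ : ℝ) : Prop where
  per : ∀ (m : Fin b → ℤ) z, W (z + fun i => (m i : ℂ)) = W z
  diff : ∀ x v : Fin b → ℝ, ‖v‖ ≤ 1 → DifferentiableOn ℂ (fun ζ => W (line x v ζ)) (strip ρ)
  bdd : ∀ x v : Fin b → ℝ, ‖v‖ ≤ 1 → ∀ ζ ∈ strip ρ, ‖W (line x v ζ)‖ ≤ Λ

variable {b : ℕ} {W : (Fin b → ℂ) → ℂ} {ρ Λ : ℝ}

theorem cocycle_add_int (hper : ∀ (m : Fin b → ℤ) z, W (z + fun i => (m i : ℂ)) = W z)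
    (ω : Fin b → ℂ) (n : ℕ) (m : Fin b → ℤ) (z : Fin b → ℂ) :
    cocycle W ω n (z + fun i => (m i : ℂ)) = cocycle W ω n z := by
  induction n with
  | zero => rfl
  | succ n ih => rw [cocycle, cocycle, ih, add_right_comm, hper]

theorem differentiableOn_cocycle (hW : StripPotential W ρ Λ) (ω x v : Fin b → ℝ) (hv : ‖v‖ ≤ 1)
    (n : ℕ) (i j : Fin 2) :
    DifferentiableOn ℂ (fun ζ => cocycle W (cvec ω) n (line x v ζ) i j) (strip ρ) := by
  induction n generalizing i j with
  | zero => exact differentiableOn_const _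
  | succ n ih =>
    have hd := hW.diff (x + (n : ℝ) • ω) v hv
    fin_cases i <;>
    · simp only [cocycle, Matrix.mul_apply, Fin.sum_univ_two, line_add_smul_cvec]
      simp only [Fin.zero_eta, Fin.mk_one, Matrix.of_apply, Matrix.cons_val_zero,
        Matrix.cons_val_one, Matrix.cons_val', Matrix.cons_val_fin_one]
      have h0 := ih 0 j
      have h1 := ih 1 j
      first
        | exact (hd.mul h0).add (h1.const_mul _)
        | exact (h0.const_mul _).add (h1.const_mul _)

theorem norm_step_le {w : ℂ} {Λ : ℝ} (hw : ‖w‖ ≤ Λ) : ‖(!![w, -1; 1, 0] : Mat)‖ ≤ Λ + 2 := by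
  have := norm_sq_mat (!![w, -1; 1, 0] : Mat)
  simp at this
  nlinarith [norm_nonneg (!![w, -1; 1, 0] : Mat), norm_nonneg w]

theorem norm_cocycle_le (hW : StripPotential W ρ Λ) (ω x v : Fin b → ℝ) (hv : ‖v‖ ≤ 1)
    {ζ : ℂ} (hζ : ζ ∈ strip ρ) (n : ℕ) :
    ‖cocycle W (cvec ω) (n + 1) (line x v ζ)‖ ≤ (Λ + 2) ^ (n + 1) := by
  have hstep : ∀ k : ℕ, ‖(!![W (line x v ζ + (k : ℂ) • cvec ω), -1; 1, 0] : Mat)‖ ≤ Λ + 2 := by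
    intro k
    rw [line_add_smul_cvec]
    exact norm_step_le (hW.bdd _ _ hv _ hζ)
  induction n with
  | zero => simpa [cocycle] using hstep 0
  | succ n ih =>
    rw [cocycle, pow_succ']
    refine (norm_mul_le _ _).trans ?_
    gcongr
    · exact (norm_nonneg _).trans (hstep 0)
    · exact hstep (n + 1)

/-- The supremum over real phases of the norm of the `n`-step cocycle. -/
def supNorm (W : (Fin b → ℂ) → ℂ) (ω : Fin b → ℝ) (n : ℕ) : ℝ :=
  ⨆ θ : Fin b → ℝ, ‖cocycle W (cvec ω) n (cvec θ)‖

/-- The exponential rate bounding the cocycle in the strip, with unit room. -/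
def rate (Λ : ℝ) : ℝ := 1 + Real.log (Λ + 2)

/-- The gap between the trivial bound and the logarithm of the real supremum. -/
def deficit (W : (Fin b → ℂ) → ℂ) (ω : Fin b → ℝ) (Λ : ℝ) (n : ℕ) : ℝ :=
  n * rate Λ - Real.log (supNorm W ω n)

theorem zero_mem_strip (hρ : 0 < ρ) : (0 : ℂ) ∈ strip ρ := by simpa [strip] using hρ

theorem StripPotential.nonneg (hW : StripPotential W ρ Λ) (hρ : 0 < ρ) : 0 ≤ Λ :=
  (norm_nonneg _).trans (hW.bdd 0 0 (by simp) 0 (zero_mem_strip hρ))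

theorem norm_cocycle_cvec_le (hW : StripPotential W ρ Λ) (hρ : 0 < ρ) (ω θ : Fin b → ℝ) (n : ℕ) :
    ‖cocycle W (cvec ω) (n + 1) (cvec θ)‖ ≤ (Λ + 2) ^ (n + 1) := by
  rw [← line_zero θ 0]
  exact norm_cocycle_le hW ω θ 0 (by simp) (zero_mem_strip hρ) n

theorem bddAbove_norm_cocycle (hW : StripPotential W ρ Λ) (hρ : 0 < ρ) (ω : Fin b → ℝ) (n : ℕ) :
    BddAbove (Set.range fun θ : Fin b → ℝ => ‖cocycle W (cvec ω) n (cvec θ)‖) := by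
  cases n with
  | zero => exact ⟨2, by rintro _ ⟨θ, rfl⟩; exact norm_one_mat_le⟩
  | succ n => exact ⟨_, by rintro _ ⟨θ, rfl⟩; exact norm_cocycle_cvec_le hW hρ ω θ n⟩

theorem norm_le_supNorm (hW : StripPotential W ρ Λ) (hρ : 0 < ρ) (ω θ : Fin b → ℝ) (n : ℕ) :
    ‖cocycle W (cvec ω) n (cvec θ)‖ ≤ supNorm W ω n :=
  le_ciSup (bddAbove_norm_cocycle hW hρ ω n) θ

theorem one_le_supNorm (hW : StripPotential W ρ Λ) (hρ : 0 < ρ) (ω : Fin b → ℝ) (n : ℕ) :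
    1 ≤ supNorm W ω n :=
  (one_le_norm_of_det (det_cocycle _ _ _ _)).trans (norm_le_supNorm hW hρ ω 0 n)

theorem supNorm_succ_le (hW : StripPotential W ρ Λ) (hρ : 0 < ρ) (ω : Fin b → ℝ) (n : ℕ) :
    supNorm W ω (n + 1) ≤ (Λ + 2) ^ (n + 1) :=
  ciSup_le fun θ => norm_cocycle_cvec_le hW hρ ω θ n

theorem supNorm_add_le (hW : StripPotential W ρ Λ) (hρ : 0 < ρ) (ω : Fin b → ℝ) (m n : ℕ) :
    supNorm W ω (m + n) ≤ supNorm W ω m * supNorm W ω n := by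
  refine ciSup_le fun θ => ?_
  rw [cocycle_add, mul_comm (supNorm W ω m)]
  refine (norm_mul_le _ _).trans ?_
  have h1 : cvec θ + (m : ℂ) • cvec ω = cvec (θ + (m : ℝ) • ω) := by
    ext i; simp [cvec]
  rw [h1]
  have := one_le_supNorm hW hρ ω n
  gcongr
  · exact norm_le_supNorm hW hρ _ _ _
  · exact norm_le_supNorm hW hρ _ _ _

theorem exists_near_max (hW : StripPotential W ρ Λ) (hρ : 0 < ρ) (ω : Fin b → ℝ) (n : ℕ) :
    ∃ θ : Fin b → ℝ, supNorm W ω n ≤ 2 * ‖cocycle W (cvec ω) n (cvec θ)‖ := by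
  have h1 := one_le_supNorm hW hρ ω n
  have : supNorm W ω n / 2 < supNorm W ω n := by linarith
  obtain ⟨θ, hθ⟩ := exists_lt_of_lt_ciSup this
  exact ⟨θ, by linarith⟩

theorem log_supNorm_add_le (hW : StripPotential W ρ Λ) (hρ : 0 < ρ) (ω : Fin b → ℝ) (m n : ℕ) :
    Real.log (supNorm W ω (m + n)) ≤ Real.log (supNorm W ω m) + Real.log (supNorm W ω n) := by
  have hm := one_le_supNorm hW hρ ω m
  have hn := one_le_supNorm hW hρ ω n
  have hmn := one_le_supNorm hW hρ ω (m + n)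
  rw [← Real.log_mul (by linarith) (by linarith)]
  exact Real.log_le_log (by linarith) (supNorm_add_le hW hρ ω m n)

theorem deficit_add_le (hW : StripPotential W ρ Λ) (hρ : 0 < ρ) (ω : Fin b → ℝ) (m n : ℕ) :
    deficit W ω Λ m + deficit W ω Λ n ≤ deficit W ω Λ (m + n) := by
  have := log_supNorm_add_le hW hρ ω m n
  unfold deficit
  push_cast
  linarith

theorem le_deficit (hW : StripPotential W ρ Λ) (hρ : 0 < ρ) (ω : Fin b → ℝ) {n : ℕ} (hn : 1 ≤ n) :
    (n : ℝ) ≤ deficit W ω Λ n := by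
  obtain ⟨n, rfl⟩ := Nat.exists_eq_add_of_le' hn
  have h1 := one_le_supNorm hW hρ ω (n + 1)
  have := Real.log_le_log (by linarith) (supNorm_succ_le hW hρ ω n)
  rw [Real.log_pow] at this
  unfold deficit rate
  linarith

theorem deficit_mono (hW : StripPotential W ρ Λ) (hρ : 0 < ρ) (ω : Fin b → ℝ) :
    Monotone (deficit W ω Λ) := by
  refine monotone_nat_of_le_succ fun n => ?_
  have h1 := deficit_add_le hW hρ ω n 1
  have h2 := le_deficit hW hρ ω le_rfl
  push_cast at h2
  linarith

theorem rate_pos (hW : StripPotential W ρ Λ) (hρ : 0 < ρ) : 1 ≤ rate Λ := by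
  have := Real.log_nonneg (show 1 ≤ Λ + 2 by linarith [hW.nonneg hρ])
  unfold rate; linarith

theorem pow_le_exp_rate (hW : StripPotential W ρ Λ) (hρ : 0 < ρ) (n : ℕ) :
    (Λ + 2) ^ n ≤ Real.exp (n * rate Λ) := by
  have h2 : 0 < Λ + 2 := by linarith [hW.nonneg hρ]
  rw [Real.exp_nat_mul]
  have : Λ + 2 ≤ Real.exp (rate Λ) := by
    rw [rate, Real.exp_add, Real.exp_log h2]
    nlinarith [Real.add_one_le_exp 1]
  gcongr

theorem norm_cocycle_line_ofReal_le (hW : StripPotential W ρ Λ) (hρ : 0 < ρ) (ω x v : Fin b → ℝ)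
    (n : ℕ) {ζ : ℂ} (h : ζ.im = 0) :
    ‖cocycle W (cvec ω) n (line x v ζ)‖ ≤ supNorm W ω n := by
  have : ζ = (ζ.re : ℂ) := by apply Complex.ext <;> simp [h]
  rw [this, line_ofReal]
  exact norm_le_supNorm hW hρ _ _ _

theorem differentiableOn_cocycle_mat (hW : StripPotential W ρ Λ) (ω x v : Fin b → ℝ)
    (hv : ‖v‖ ≤ 1) (n : ℕ) :
    DifferentiableOn ℂ (fun ζ => cocycle W (cvec ω) n (line x v ζ)) (strip ρ) := by
  have h := differentiableOn_cocycle hW ω x v hv n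
  have e : (fun ζ => cocycle W (cvec ω) n (line x v ζ)) = fun ζ =>
      ∑ i, ∑ j, cocycle W (cvec ω) n (line x v ζ) i j • Matrix.single i j (1 : ℂ) := by
    ext ζ i j
    conv_lhs => rw [Matrix.matrix_eq_sum_single (cocycle W (cvec ω) n (line x v ζ))]
    simp
  rw [e]
  exact DifferentiableOn.fun_sum fun i _ => DifferentiableOn.fun_sum fun j _ =>
    (h i j).smul_const _

theorem norm_cocycle_three_lines_aux (hW : StripPotential W ρ Λ) (hρ : 0 < ρ) (ω x v : Fin b → ℝ)
    (hv : ‖v‖ ≤ 1) {n : ℕ} (hn : 1 ≤ n) {t : ℝ} (ht : t ≤ 1) {ζ : ℂ} (hζ0 : 0 ≤ ζ.im)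
    (hζ : ζ.im ≤ t * (ρ / 2)) :
    ‖cocycle W (cvec ω) n (line x v ζ)‖ ≤
      Real.exp (Real.log (supNorm W ω n) + t * deficit W ω Λ n) := by
  obtain ⟨n, rfl⟩ := Nat.exists_eq_add_of_le' hn
  have hS := one_le_supNorm hW hρ ω (n + 1)
  have hD : 0 ≤ deficit W ω Λ (n + 1) :=
    (Nat.cast_nonneg (n + 1)).trans (le_deficit hW hρ ω hn)
  set φ : ℂ → ℂ := fun w => w * ((ρ / 2 : ℝ) * Complex.I) with hφ
  have him : ∀ w : ℂ, (φ w).im = w.re * (ρ / 2) := by intro w; simp [hφ]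
  set w : ℂ := ζ / ((ρ / 2 : ℝ) * Complex.I) with hw
  have hne : ((ρ / 2 : ℝ) * Complex.I : ℂ) ≠ 0 :=
    mul_ne_zero (Complex.ofReal_ne_zero.2 (by positivity)) Complex.I_ne_zero
  have hφw : φ w = ζ := by exact div_mul_cancel₀ ζ hne
  have hwre : w.re * (ρ / 2) = ζ.im := by rw [← him, hφw]
  have hw0 : 0 ≤ w.re := by
    by_contra h
    push Not at h
    nlinarith
  have hwt : w.re ≤ t := by
    rw [← hwre] at hζ
    exact le_of_mul_le_mul_right hζ (by positivity)
  have hmaps : ∀ w : ℂ, w.re ∈ Set.Icc (0 : ℝ) 1 → φ w ∈ strip ρ := by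
    intro w h
    rw [strip, Set.mem_ofPred_eq, him, abs_of_nonneg (by have := h.1; positivity)]
    nlinarith [h.1, h.2]
  have hdiff : DifferentiableOn ℂ (fun w => cocycle W (cvec ω) (n + 1) (line x v (φ w)))
      {w | φ w ∈ strip ρ} :=
    (differentiableOn_cocycle_mat hW ω x v hv (n + 1)).comp
      (by simp only [hφ]; fun_prop) (fun w hw => hw)
  have hopen : IsOpen {w | φ w ∈ strip ρ} :=
    (isOpen_strip ρ).preimage (by simp only [hφ]; fun_prop)
  have hclosed : closure (Complex.HadamardThreeLines.verticalStrip 0 1) ⊆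
      {w | φ w ∈ strip ρ} := by
    have : closure (Complex.HadamardThreeLines.verticalStrip 0 1) ⊆
        Complex.HadamardThreeLines.verticalClosedStrip 0 1 :=
      closure_minimal (Set.preimage_mono Set.Ioo_subset_Icc_self)
        (isClosed_Icc.preimage Complex.continuous_re)
    exact this.trans fun w hw => hmaps w hw
  have hbd : ∀ w : ℂ, w.re ∈ Set.Icc (0 : ℝ) 1 →
      ‖cocycle W (cvec ω) (n + 1) (line x v (φ w))‖ ≤ Real.exp ((n + 1 : ℕ) * rate Λ) := fun w hw =>
    (norm_cocycle_le hW ω x v hv (hmaps w hw) n).trans (pow_le_exp_rate hW hρ _)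
  have key := Complex.HadamardThreeLines.norm_le_interp_of_mem_verticalClosedStrip₀₁'
    (fun w => cocycle W (cvec ω) (n + 1) (line x v (φ w))) (z := w)
    (a := supNorm W ω (n + 1)) (b := Real.exp ((n + 1 : ℕ) * rate Λ))
    ⟨hw0, hwt.trans ht⟩ ⟨hdiff.mono (subset_closure.trans hclosed), (hdiff.continuousOn).mono hclosed⟩
    ⟨Real.exp ((n + 1 : ℕ) * rate Λ), by
      rintro _ ⟨w, hw, rfl⟩
      exact hbd w hw⟩
    (fun w hw => norm_cocycle_line_ofReal_le hW hρ ω x v _ (by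
      have hw' : w.re = 0 := hw
      rw [him, hw', zero_mul]))
    (fun w hw => hbd w (by
      have hw' : w.re = 1 := hw
      rw [hw']; simp))
  simp only [hφw] at key
  refine key.trans ?_
  rw [Real.rpow_def_of_pos (by linarith), Real.rpow_def_of_pos (Real.exp_pos _), Real.log_exp,
    ← Real.exp_add]
  apply Real.exp_le_exp.2
  have e : Real.log (supNorm W ω (n + 1)) * (1 - w.re) + (n + 1 : ℕ) * rate Λ * w.re =
      Real.log (supNorm W ω (n + 1)) + w.re * deficit W ω Λ (n + 1) := by
    unfold deficit; ring
  rw [e]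
  gcongr

theorem norm_cocycle_three_lines (hW : StripPotential W ρ Λ) (hρ : 0 < ρ) (ω x v : Fin b → ℝ)
    (hv : ‖v‖ ≤ 1) {n : ℕ} (hn : 1 ≤ n) {t : ℝ} (ht : t ≤ 1) {ζ : ℂ}
    (hζ : |ζ.im| ≤ t * (ρ / 2)) :
    ‖cocycle W (cvec ω) n (line x v ζ)‖ ≤
      Real.exp (Real.log (supNorm W ω n) + t * deficit W ω Λ n) := by
  rcases le_total 0 ζ.im with h | h
  · rw [abs_of_nonneg h] at hζ
    exact norm_cocycle_three_lines_aux hW hρ ω x v hv hn ht h hζ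
  · rw [abs_of_nonpos h] at hζ
    have := norm_cocycle_three_lines_aux hW hρ ω x (-v) (by simpa using hv) hn ht (ζ := -ζ)
      (by simpa using h) (by simpa using hζ)
    rwa [line_neg, neg_neg] at this

/-- An avalanche principle for products `P` covered by overlapping windows `U`. -/
theorem prod_norm_le_of_overlap {P U X Y Q : ℕ → Mat} {J : ℕ} (h0 : P 0 = U 0)
    (hP : ∀ j < J, P (j + 1) = X j * P j) (hU : ∀ j < J, U (j + 1) = X j * Y j)
    (hQ : ∀ j < J, P j = Y j * Q j) (hY : ∀ j, (Y j).det = 1)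
    (hX : ∀ j < J, 4 * ‖X j‖ ≤ ‖U (j + 1)‖) (hQ0 : 2 * ‖Q 0‖ ≤ ‖P 0‖)
    (hstep : ∀ j < J, 16 * ‖Q (j + 1)‖ * ‖Y j‖ ≤ ‖U (j + 1)‖ * ‖P j‖) :
    ∏ j ∈ Finset.range (J + 1), ‖U j‖ ≤ 8 ^ J * ‖P J‖ * ∏ j ∈ Finset.range J, ‖Y j‖ := by
  suffices H : ∀ j ≤ J, 2 * ‖Q j‖ ≤ ‖P j‖ ∧
      ∏ i ∈ Finset.range (j + 1), ‖U i‖ ≤ 8 ^ j * ‖P j‖ * ∏ i ∈ Finset.range j, ‖Y i‖ from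
    (H J le_rfl).2
  intro j
  induction j with
  | zero => exact fun _ => ⟨hQ0, by simp [h0]⟩
  | succ j ih =>
    intro hj
    obtain ⟨h1, h2⟩ := ih (by omega)
    have hov := norm_overlap_mul_ge (X j) (Q j) (hY j)
    rw [Matrix.mul_assoc, ← hQ j hj, ← hP j hj, ← hU j hj] at hov
    have h3 : 4 * (‖X j‖ * ‖Q j‖) ≤ ‖U (j + 1)‖ * ‖P j‖ / 2 := by
      have := mul_le_mul (hX j hj) h1 (by positivity) (norm_nonneg _)
      linarith
    have h4 : ‖U (j + 1)‖ * ‖P j‖ ≤ 8 * (‖P (j + 1)‖ * ‖Y j‖) := by linarith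
    have hYpos : 0 < ‖Y j‖ := zero_lt_one.trans_le (one_le_norm_of_det (hY j))
    refine ⟨?_, ?_⟩
    · have := hstep j hj
      refine le_of_mul_le_mul_right (a := ‖Y j‖) ?_ hYpos
      linarith
    · rw [Finset.prod_range_succ _ (j + 1), Finset.prod_range_succ (fun i => ‖Y i‖) j]
      have hprod : 0 ≤ ∏ i ∈ Finset.range j, ‖Y i‖ := Finset.prod_nonneg fun _ _ => norm_nonneg _
      have h5 := mul_le_mul_of_nonneg_right h2 (norm_nonneg (U (j + 1)))
      have h6 := mul_le_mul_of_nonneg_left h4 (mul_nonneg (pow_nonneg (by norm_num : (0 : ℝ) ≤ 8) j) hprod)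
      rw [pow_succ]
      linarith

theorem norm_cocycle_le_two_exp (hW : StripPotential W ρ Λ) (ω x v : Fin b → ℝ) (hρ : 0 < ρ)
    (hv : ‖v‖ ≤ 1) {ζ : ℂ} (hζ : ζ ∈ strip ρ) (n : ℕ) :
    ‖cocycle W (cvec ω) n (line x v ζ)‖ ≤ 2 * Real.exp (n * rate Λ) := by
  cases n with
  | zero => simpa [cocycle] using norm_one_mat_le
  | succ n =>
    have := (norm_cocycle_le hW ω x v hv hζ n).trans (pow_le_exp_rate hW hρ _)
    linarith [Real.exp_pos ((n + 1 : ℕ) * rate Λ)]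

/-- A complex phase at which the `n`-step cocycle is large at `J + 1` shifted points. -/
theorem exists_cocycle_window (hW : StripPotential W ρ Λ) (hρ : 0 < ρ) (ω v : Fin b → ℝ)
    (hv : ‖v‖ ≤ 1) {n : ℕ} (hn : 1 ≤ n) {η δ : ℝ} (hη : 0 < η) (hηρ : 10 * η ≤ ρ) (hδ : 0 ≤ δ)
    {N J : ℕ} (hJ : J * δ ≤ N * η) :
    ∃ (θ : Fin b → ℝ) (s : ℂ) (ψ : ℕ → ℝ), ‖s‖ ≤ η ∧ (∀ j ≤ J, 0 ≤ ψ j) ∧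
      (∀ j ≤ J, Real.exp (Real.log (supNorm W ω n) - ψ j) ≤
        ‖cocycle W (cvec ω) n (line θ v (s + (j * δ : ℝ)))‖) ∧
      ∑ j ∈ Finset.range (J + 1), ψ j ≤
        (J + 1) * 9 ^ N * (10 * η / ρ * deficit W ω Λ n + Real.log 4) := by
  obtain ⟨θ, hθ⟩ := exists_near_max hW hρ ω n
  obtain ⟨p, q, hpq⟩ := exists_norm_le_entry (cocycle W (cvec ω) n (cvec θ))
  have hS := one_le_supNorm hW hρ ω n
  have hD : 0 ≤ deficit W ω Λ n := (Nat.cast_nonneg n).trans (le_deficit hW hρ ω hn)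
  set t := 10 * η / ρ with ht
  have ht0 : 0 ≤ t := by positivity
  have ht1 : t ≤ 1 := (div_le_one hρ).2 hηρ
  set K := Real.log (supNorm W ω n) + t * deficit W ω Λ n with hK
  set g : ℂ → ℂ := fun ζ => cocycle W (cvec ω) n (line θ v ζ) p q with hg
  have htρ : t * (ρ / 2) = 5 * η := by rw [ht]; field_simp; norm_num
  have hbd : ∀ z ∈ strip (5 * η), ‖g z‖ ≤ Real.exp K := fun z hz =>
    (norm_entry_le _ _ _).trans (norm_cocycle_three_lines hW hρ ω θ v hv hn ht1 (by
      rw [htρ]; exact le_of_lt hz))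
  have hdiff : DifferentiableOn ℂ g (strip (5 * η)) :=
    (differentiableOn_cocycle hW ω θ v hv n p q).mono fun z (hz : |z.im| < 5 * η) =>
      show |z.im| < ρ by linarith
  have hg0 : supNorm W ω n ≤ 4 * ‖g 0‖ := by
    simp only [hg, line_zero]
    linarith
  have hg0pos : 0 < ‖g 0‖ := by linarith
  have hlog : Real.log (supNorm W ω n) ≤ Real.log 4 + Real.log ‖g 0‖ := by
    rw [← Real.log_mul (by norm_num) hg0pos.ne']
    exact Real.log_le_log (by linarith) hg0
  have hlogS := Real.log_nonneg hS
  obtain ⟨s, hs, hne, hsum⟩ := exists_window (K := K) (by positivity) hη (by linarith) hdiff hbd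
    (norm_pos_iff.1 hg0pos) hδ N J hJ
  have hmem : ∀ j : ℕ, s + (j * δ : ℝ) ∈ strip (5 * η) := by
    intro j
    have := Complex.abs_im_le_norm s
    have h : (s + ((j * δ : ℝ) : ℂ)).im = s.im := by simp
    show |(s + ((j * δ : ℝ) : ℂ)).im| < 5 * η
    rw [h]; linarith
  refine ⟨θ, s, fun j => K - Real.log ‖g (s + (j * δ : ℝ))‖, hs, ?_, ?_, ?_⟩
  · intro j hj
    have := Real.log_le_log (norm_pos_iff.2 (hne j hj)) (hbd _ (hmem j))
    rw [Real.log_exp] at this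
    linarith
  · intro j hj
    refine le_trans ?_ (norm_entry_le _ p q)
    have h : Real.log (supNorm W ω n) - (K - Real.log ‖g (s + (j * δ : ℝ))‖) ≤
        Real.log ‖g (s + (j * δ : ℝ))‖ := by
      have : 0 ≤ t * deficit W ω Λ n := by positivity
      linarith
    refine (Real.exp_le_exp.2 h).trans ?_
    rw [Real.exp_log (norm_pos_iff.2 (hne j hj))]
  · refine hsum.trans ?_
    gcongr
    linarith

theorem line_shift (θ v ω : Fin b → ℝ) (l : Fin b → ℤ) (δ : ℝ) (m j : ℕ) (s : ℂ)
    (h : (m : ℝ) • ω = (fun i => (l i : ℝ)) + δ • v) :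
    line θ v s + ((j * m : ℕ) : ℂ) • cvec ω =
      line θ v (s + (j * δ : ℝ)) + fun i => (((j : ℤ) * l i : ℤ) : ℂ) := by
  ext i
  have hi := congrFun h i
  simp only [Pi.smul_apply, Pi.add_apply, smul_eq_mul] at hi
  have hc : (m : ℂ) * (ω i : ℂ) = (l i : ℂ) + δ * v i := by exact_mod_cast congrArg Complex.ofReal hi
  simp only [line, cvec, Pi.add_apply, Pi.smul_apply, smul_eq_mul]
  push_cast
  linear_combination (j : ℂ) * hc

theorem avalanche_deficit (hW : StripPotential W ρ Λ) (hρ : 0 < ρ) (ω v : Fin b → ℝ)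
    (hv : ‖v‖ ≤ 1) {k m J N : ℕ} {η δ Ψ : ℝ} (hk : 1 ≤ k) (hmk : m ≤ k) (hkm : 7 * k ≤ 8 * m)
    (l : Fin b → ℤ) (hm : (m : ℝ) • ω = (fun i => (l i : ℝ)) + δ • v)
    (hη : 0 < η) (hηρ : 10 * η ≤ ρ) (hδ : 0 ≤ δ) (hJ : J * δ ≤ N * η)
    (hΨ : (J + 1) * 9 ^ N * (10 * η / ρ * deficit W ω Λ (2 * k) + Real.log 4) ≤ Ψ)
    (hsmall : deficit W ω Λ (2 * k) + Ψ + Real.log 64 ≤ 5 / 8 * (k * rate Λ)) :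
    (1 - 10 * η / ρ) * deficit W ω Λ (J * m + 2 * k) ≤
      (J + 1) * deficit W ω Λ (2 * k) - J * ((1 - 10 * η / ρ) * deficit W ω Λ k)
        + Ψ + J * Real.log 8 := by
  obtain ⟨θ, s, ψ, hs, hψ0, hψ, hsum⟩ :=
    exists_cocycle_window hW hρ ω v hv (n := 2 * k) (by omega) hη hηρ hδ hJ
  set t := 10 * η / ρ with ht
  have ht1 : t ≤ 1 := (div_le_one hρ).2 hηρ
  have htρ : t * (ρ / 2) = 5 * η := by rw [ht]; field_simp; norm_num
  set B := rate Λ with hB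
  have hB1 : 1 ≤ B := rate_pos hW hρ
  have hsim : |s.im| ≤ η := (Complex.abs_im_le_norm s).trans hs
  have hsmem : s ∈ strip ρ := show |s.im| < ρ by linarith
  have hψle : ∀ j ≤ J, ψ j ≤ Ψ := fun j hj =>
    (Finset.single_le_sum (f := ψ) (fun i hi => hψ0 i (by simpa [Nat.lt_succ_iff] using hi))
      (Finset.mem_range.2 (Nat.lt_succ_of_le hj))).trans (hsum.trans hΨ)
  obtain ⟨q, hq⟩ : ∃ q, 2 * k = m + (m + q) := ⟨2 * k - 2 * m, by omega⟩
  have hqR : 2 * (k : ℝ) = m + (m + q) := by exact_mod_cast hq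
  have hkmR : 7 * (k : ℝ) ≤ 8 * m := by exact_mod_cast hkm
  have hmkR : (m : ℝ) ≤ k := by exact_mod_cast hmk
  set z := line θ v s with hz
  set w := cvec ω with hw
  set P : ℕ → Mat := fun j => cocycle W w (j * m + 2 * k) z with hPdef
  set U : ℕ → Mat := fun j => cocycle W w (2 * k) (z + ((j * m : ℕ) : ℂ) • w) with hUdef
  set X : ℕ → Mat := fun j => cocycle W w m (z + ((j * m + 2 * k : ℕ) : ℂ) • w) with hXdef
  set Y : ℕ → Mat := fun j => cocycle W w (m + q) (z + (((j + 1) * m : ℕ) : ℂ) • w) with hYdef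
  set Z : ℕ → Mat := fun j => cocycle W w q (z + (((j + 2) * m : ℕ) : ℂ) • w) with hZdef
  set Q : ℕ → Mat := fun j => cocycle W w ((j + 1) * m) z with hQdef
  have hYdet : ∀ j, (Y j).det = 1 := fun j => det_cocycle _ _ _ _
  have hP : ∀ j, P (j + 1) = X j * P j := by
    intro j
    simp only [hPdef, hXdef]
    rw [← cocycle_add]
    congr 1; ring
  have hPY : ∀ j, P j = Y j * Q j := by
    intro j
    simp only [hPdef, hYdef, hQdef]
    rw [← cocycle_add]
    congr 1; rw [hq]; ring
  have hPZ : ∀ j, P j = Z j * Q (j + 1) := by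
    intro j
    simp only [hPdef, hZdef, hQdef]
    rw [← cocycle_add]
    congr 1; rw [hq]; ring
  have hU : ∀ j, U (j + 1) = X j * Y j := by
    intro j
    have e : z + ((j * m + 2 * k : ℕ) : ℂ) • w =
        z + (((j + 1) * m : ℕ) : ℂ) • w + ((m + q : ℕ) : ℂ) • w := by
      rw [add_assoc, ← add_smul, hq]
      push_cast
      ring_nf
    simp only [hUdef, hXdef, hYdef]
    rw [e, ← cocycle_add]
    congr 1; omega
  have hbound : ∀ n i : ℕ, ‖cocycle W w n (z + (i : ℂ) • w)‖ ≤ 2 * Real.exp (n * B) := by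
    intro n i
    rw [hz, hw, line_add_smul_cvec]
    exact norm_cocycle_le_two_exp hW ω _ v hρ hv hsmem n
  have hUge : ∀ j ≤ J, Real.exp (Real.log (supNorm W ω (2 * k)) - ψ j) ≤ ‖U j‖ := by
    intro j hj
    refine (hψ j hj).trans (le_of_eq ?_)
    simp only [hUdef]
    rw [hz, hw, line_shift θ v ω l δ m j s hm, cocycle_add_int hW.per]
  have hS2k : Real.log (supNorm W ω (2 * k)) = 2 * k * B - deficit W ω Λ (2 * k) := by
    unfold deficit; push_cast; ring
  have hUge' : ∀ j ≤ J, ∀ x : ℝ, x ≤ 2 * k - 5 / 8 * k → 64 * Real.exp (x * B) ≤ ‖U j‖ := by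
    intro j hj x hx
    refine le_trans ?_ (hUge j hj)
    rw [← Real.exp_log (show (0 : ℝ) < 64 by norm_num), ← Real.exp_add]
    apply Real.exp_le_exp.2
    rw [hS2k]
    have := hψle j hj
    have : x * B ≤ (2 * k - 5 / 8 * k) * B := by gcongr
    linarith
  have key := prod_norm_le_of_overlap (J := J) (P := P) (U := U) (X := X) (Y := Y) (Q := Q)
    (by simp [hPdef, hUdef]) (fun j _ => hP j) (fun j _ => hU j) (fun j _ => hPY j) hYdet
    (fun j hj => by
      have h1 : ‖X j‖ ≤ 2 * Real.exp (m * B) := hbound _ _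
      have h2 := hUge' (j + 1) hj m (by linarith)
      linarith [Real.exp_pos (m * B)])
    (by
      have h1 : ‖Q 0‖ ≤ 2 * Real.exp (m * B) := by simpa [hQdef] using hbound m 0
      have h2 := hUge' 0 (Nat.zero_le _) m (by linarith)
      have h3 : P 0 = U 0 := by simp [hPdef, hUdef]
      rw [h3]
      linarith [Real.exp_pos (m * B)])
    (fun j hj => by
      have h1 : ‖Y j‖ ≤ 2 * Real.exp ((m + q : ℕ) * B) := hbound _ _
      have h2 : ‖Z j‖ ≤ 2 * Real.exp (q * B) := hbound _ _
      have h3 : ‖Q (j + 1)‖ ≤ ‖P j‖ * ‖Z j‖ := by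
        rw [hPZ j]; exact norm_le_norm_mul_left (det_cocycle _ _ _ _)
      have h4 := hUge' (j + 1) hj (m + 2 * q) (by linarith)
      calc 16 * ‖Q (j + 1)‖ * ‖Y j‖
          ≤ 16 * (‖P j‖ * (2 * Real.exp (q * B))) * (2 * Real.exp ((m + q : ℕ) * B)) := by
            gcongr
            exact h3.trans (by gcongr)
        _ = 64 * (Real.exp (q * B) * Real.exp ((m + q : ℕ) * B)) * ‖P j‖ := by ring
        _ = 64 * Real.exp ((m + 2 * q) * B) * ‖P j‖ := by
            rw [← Real.exp_add]; push_cast; ring_nf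
        _ ≤ ‖U (j + 1)‖ * ‖P j‖ := by gcongr)
  have hUpos : ∀ j ≤ J, 0 < ‖U j‖ := fun j hj => (Real.exp_pos _).trans_le (hUge j hj)
  have hPpos : 0 < ‖P J‖ := zero_lt_one.trans_le (one_le_norm_of_det (det_cocycle _ _ _ _))
  have hYpos : ∀ j, 0 < ‖Y j‖ := fun j => zero_lt_one.trans_le (one_le_norm_of_det (hYdet j))
  have hlog := Real.log_le_log (Finset.prod_pos fun j hj =>
    hUpos j (by simpa [Nat.lt_succ_iff] using hj)) key
  have hprodY : (∏ j ∈ Finset.range J, ‖Y j‖) ≠ 0 := (Finset.prod_pos fun j _ => hYpos j).ne'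
  rw [Real.log_prod fun j hj => (hUpos j (by simpa [Nat.lt_succ_iff] using hj)).ne',
    Real.log_mul (by positivity) hprodY, Real.log_mul (by positivity) hPpos.ne', Real.log_pow,
    Real.log_prod fun j _ => (hYpos j).ne'] at hlog
  have hUsum : ((J : ℝ) + 1) * (2 * k * B - deficit W ω Λ (2 * k)) - Ψ ≤
      ∑ j ∈ Finset.range (J + 1), Real.log ‖U j‖ := by
    have h : ∑ j ∈ Finset.range (J + 1), (Real.log (supNorm W ω (2 * k)) - ψ j) ≤
        ∑ j ∈ Finset.range (J + 1), Real.log ‖U j‖ := by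
      refine Finset.sum_le_sum fun j hj => ?_
      have hj' : j ≤ J := by simpa [Nat.lt_succ_iff] using hj
      exact (Real.le_log_iff_exp_le (hUpos j hj')).2 (hUge j hj')
    rw [Finset.sum_sub_distrib, Finset.sum_const, Finset.card_range, nsmul_eq_mul, hS2k] at h
    push_cast at h
    linarith [hsum.trans hΨ]
  have hs5 : |s.im| ≤ t * (ρ / 2) := by rw [htρ]; linarith
  have hPle : Real.log ‖P J‖ ≤ (J * m + 2 * k) * B - (1 - t) * deficit W ω Λ (J * m + 2 * k) := by
    have h := Real.log_le_log hPpos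
      (norm_cocycle_three_lines hW hρ ω θ v hv (n := J * m + 2 * k) (by omega) ht1 hs5)
    rw [Real.log_exp] at h
    refine h.trans (le_of_eq ?_)
    unfold deficit
    push_cast
    ring
  have hYle : ∀ j, Real.log ‖Y j‖ ≤ (m + q) * B - (1 - t) * deficit W ω Λ k := by
    intro j
    have h : ‖Y j‖ ≤ Real.exp
        (Real.log (supNorm W ω (m + q)) + t * deficit W ω Λ (m + q)) := by
      simp only [hYdef]
      rw [hz, hw, line_add_smul_cvec]
      exact norm_cocycle_three_lines hW hρ ω _ v hv (n := m + q) (by omega) ht1 hs5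
    have h := Real.log_le_log (hYpos j) h
    rw [Real.log_exp] at h
    have hmono : deficit W ω Λ k ≤ deficit W ω Λ (m + q) := deficit_mono hW hρ ω (by omega)
    have : (1 - t) * deficit W ω Λ k ≤ (1 - t) * deficit W ω Λ (m + q) :=
      mul_le_mul_of_nonneg_left hmono (by linarith)
    refine h.trans (le_trans (le_of_eq ?_) (sub_le_sub_left this _))
    unfold deficit
    push_cast
    ring
  have hYsum : ∑ j ∈ Finset.range J, Real.log ‖Y j‖ ≤
      J * ((m + q) * B - (1 - t) * deficit W ω Λ k) := by
    have := Finset.sum_le_sum fun j (_ : j ∈ Finset.range J) => hYle j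
    rwa [Finset.sum_const, Finset.card_range, nsmul_eq_mul] at this
  have e : (J : ℝ) * ((m + q) * B) = J * (2 * k * B) - J * m * B := by rw [hqR]; ring
  linarith

/-- The deficit per step at dyadic times. -/
def dyadicDeficit (W : (Fin b → ℂ) → ℂ) (ω : Fin b → ℝ) (Λ : ℝ) (i : ℕ) : ℝ :=
  deficit W ω Λ (2 ^ i) / 2 ^ i

theorem deficit_two_pow (W : (Fin b → ℂ) → ℂ) (ω : Fin b → ℝ) (Λ : ℝ) (i : ℕ) :
    deficit W ω Λ (2 ^ i) = 2 ^ i * dyadicDeficit W ω Λ i := by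
  unfold dyadicDeficit; field_simp

theorem one_le_dyadicDeficit (hW : StripPotential W ρ Λ) (hρ : 0 < ρ) (ω : Fin b → ℝ) (i : ℕ) :
    1 ≤ dyadicDeficit W ω Λ i := by
  have := le_deficit hW hρ ω (Nat.one_le_two_pow (n := i))
  rw [dyadicDeficit, le_div_iff₀ (by positivity), one_mul]
  simpa using this

theorem dyadicDeficit_mono (hW : StripPotential W ρ Λ) (hρ : 0 < ρ) (ω : Fin b → ℝ) :
    Monotone (dyadicDeficit W ω Λ) := by
  refine monotone_nat_of_le_succ fun i => ?_
  have h := deficit_add_le hW hρ ω (2 ^ i) (2 ^ i)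
  rw [← two_mul, ← two_mul, ← pow_succ', deficit_two_pow, deficit_two_pow, pow_succ',
    mul_assoc] at h
  have h2 : (0 : ℝ) < 2 ^ i := by positivity
  nlinarith

theorem log_four_le : Real.log 4 ≤ 2 := by
  rw [show (4 : ℝ) = 2 ^ 2 by norm_num, Real.log_pow]
  have := Real.log_two_lt_d9
  push_cast; linarith

theorem log_eight_le : Real.log 8 ≤ 3 := by
  rw [show (8 : ℝ) = 2 ^ 3 by norm_num, Real.log_pow]
  have := Real.log_two_lt_d9
  push_cast; linarith

theorem log_sixtyfour_le : Real.log 64 ≤ 6 := by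
  rw [show (64 : ℝ) = 2 ^ 6 by norm_num, Real.log_pow]
  have := Real.log_two_lt_d9
  push_cast; linarith

theorem le_of_scaled_recursion {x y z t η J k C : ℝ} (hk : 0 < k) (hJ : 0 < J) (hη : 0 ≤ η)
    (hJη : J * η = 1) (ht0 : 0 ≤ t) (ht : t ≤ 1 / 2) (hy : 0 ≤ y) (hC : 0 ≤ C)
    (h : (1 - t) * (J * k * (z + x)) ≤ J * k * (2 * y) + k * ((26 + 2 * C) * y)) :
    z + x ≤ 2 * y + (4 * t + (52 + 4 * C) * η) * y := by
  set w := (26 + 2 * C) * η * y with hw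
  have hw0 : 0 ≤ w := by positivity
  have h1 : (1 - t) * (z + x) ≤ 2 * y + w := by
    refine le_of_mul_le_mul_left (a := J * k) ?_ (by positivity)
    calc J * k * ((1 - t) * (z + x)) = (1 - t) * (J * k * (z + x)) := by ring
      _ ≤ _ := h
      _ = J * k * (2 * y) + (J * η) * k * ((26 + 2 * C) * y) := by rw [hJη]; ring
      _ = _ := by rw [hw]; ring
  have h2 : (1 : ℝ) ≤ (1 - t) * (1 + 2 * t) := by nlinarith
  have h3 : z + x ≤ (1 + 2 * t) * (2 * y + w) := by
    refine le_of_mul_le_mul_left (h1.trans ?_) (by linarith : 0 < 1 - t)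
    rw [← mul_assoc]
    exact le_mul_of_one_le_left (by positivity) h2
  have h4 : 2 * t * w ≤ w := mul_le_of_le_one_left hw0 (by linarith)
  have h5 : 2 * w = (52 + 4 * C) * η * y := by rw [hw]; ring
  linarith

theorem dyadicDeficit_fine (hW : StripPotential W ρ Λ) (hρ : 0 < ρ) (ω : Fin b → ℝ) {i a : ℕ}
    (ha : 3 ≤ a) (haρ : 20 * (1 / 2 : ℝ) ^ a ≤ ρ) (hai : a ≤ i + 3) (hg : GoodScale ω i a)
    (hsmall : dyadicDeficit W ω Λ (i + 1) ≤ 5 / 16 / (4 + 9 * (20 / ρ + 16)) * rate Λ) :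
    dyadicDeficit W ω Λ (i + 3) ≤ 2 * dyadicDeficit W ω Λ (i + 1) - dyadicDeficit W ω Λ i +
      (40 / ρ + 52 + 4 * (9 * (20 / ρ + 16))) * (1 / 2) ^ a * dyadicDeficit W ω Λ (i + 1) := by
  obtain ⟨m, hm1, hm2, l, hl⟩ := hg
  set d := dyadicDeficit W ω Λ with hd
  set δ : ℝ := (1 / 4) ^ a with hδ
  have hδ0 : 0 < δ := by positivity
  set η : ℝ := (1 / 2) ^ a with hη
  have hη0 : 0 < η := by positivity
  set v : Fin b → ℝ := fun j => (((m : ℝ) • ω) j - l j) / δ with hv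
  have hv1 : ‖v‖ ≤ 1 := by
    refine (pi_norm_le_iff_of_nonneg zero_le_one).2 fun j => ?_
    rw [Real.norm_eq_abs, hv, abs_div, abs_of_pos hδ0]
    exact (div_le_one hδ0).2 (hl j)
  have hmv : (m : ℝ) • ω = (fun i => (l i : ℝ)) + δ • v := by
    ext j
    simp only [hv, Pi.add_apply, Pi.smul_apply, smul_eq_mul]
    field_simp
    ring
  have hJη : (2 : ℝ) ^ a * η = 1 := by rw [hη, ← mul_pow]; norm_num
  have hJδ : (2 : ℝ) ^ a * δ = η := by rw [hδ, hη, ← mul_pow]; norm_num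
  have hkm : 7 * 2 ^ i ≤ 8 * m := by
    obtain ⟨c, rfl⟩ := Nat.exists_eq_add_of_le ha
    have h1 : 0 < 2 ^ c := by positivity
    have h2 : 2 ^ (3 + c) = 8 * 2 ^ c := by rw [pow_add]; norm_num
    rw [h2] at hm1
    have h3 : 2 ^ i ≤ 2 ^ i * 2 ^ c := Nat.le_mul_of_pos_right _ h1
    nlinarith
  set k : ℝ := 2 ^ i with hk
  have hk0 : 0 < k := by positivity
  have hk1 : 1 ≤ k := one_le_pow₀ (by norm_num)
  set J : ℝ := 2 ^ a with hJ
  have hJ0 : 0 < J := by positivity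
  have hJk : J ≤ 8 * k := by
    have : J ≤ 2 ^ (i + 3) := pow_le_pow_right₀ (by norm_num) hai
    rw [pow_add] at this
    linarith
  have hJ1 : 1 ≤ J := one_le_pow₀ (by norm_num)
  have hd1 : 1 ≤ d (i + 1) := one_le_dyadicDeficit hW hρ ω _
  have hD1 : deficit W ω Λ (2 * 2 ^ i) = 2 * k * d (i + 1) := by
    rw [← pow_succ', deficit_two_pow, pow_succ']
  have hD0 : deficit W ω Λ (2 ^ i) = k * d i := deficit_two_pow _ _ _ _
  set C := 9 * (20 / ρ + 16) with hC
  set t := 10 * η / ρ with ht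
  have hJt : J * t = 10 / ρ := by rw [ht, mul_div_assoc', mul_left_comm, hJη, mul_one]
  have ht0 : 0 ≤ t := by positivity
  have ht2 : t ≤ 1 / 2 := by rw [ht, div_le_iff₀ hρ]; linarith
  have hρinv : 0 < 1 / ρ := by positivity
  have e20 : 20 / ρ = 20 * (1 / ρ) := by ring
  have e10 : 10 / ρ = 10 * (1 / ρ) := by ring
  have e40 : 40 / ρ = 40 * (1 / ρ) := by ring
  have hC0 : 0 < C := by positivity
  have key := avalanche_deficit hW hρ ω v hv1 (k := 2 ^ i) (m := m) (J := 2 ^ a) (N := 1) (η := η)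
    (δ := δ) (Ψ := C * (2 * k * d (i + 1))) Nat.one_le_two_pow hm2 hkm l hmv hη0 (by linarith)
    hδ0.le (by push_cast; rw [hJδ, one_mul]) (by
      rw [hD1]
      push_cast
      have h1 : (J + 1) * (t * (2 * k * d (i + 1))) ≤ 20 / ρ * (2 * k * d (i + 1)) := by
        rw [← mul_assoc]
        gcongr
        rw [e20]; nlinarith
      have h2 : (J + 1) * Real.log 4 ≤ 16 * (2 * k * d (i + 1)) := by
        calc (J + 1) * Real.log 4 ≤ (16 * k) * 2 := by
              gcongr
              · linarith
              · exact log_four_le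
          _ ≤ _ := by nlinarith
      rw [hC]
      linarith) (by
      have h1 : Real.log 64 ≤ 3 * (2 * k * d (i + 1)) := by nlinarith [log_sixtyfour_le]
      rw [div_mul_eq_mul_div, le_div_iff₀ (by positivity)] at hsmall
      rw [hD1]
      push_cast
      have := mul_le_mul_of_nonneg_left hsmall hk0.le
      linarith)
  have hmono : J * k * d (i + 3) ≤ deficit W ω Λ (2 ^ a * m + 2 * 2 ^ i) := by
    calc J * k * d (i + 3) ≤ J * k * d (i + a) := by
          gcongr
          exact dyadicDeficit_mono hW hρ ω (by omega)
      _ = deficit W ω Λ (2 ^ (i + a)) := by rw [deficit_two_pow, pow_add, mul_comm J k]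
      _ ≤ _ := deficit_mono hW hρ ω (by rw [pow_add, mul_comm (2 ^ i)]; omega)
  rw [hD1, hD0] at key
  push_cast at key
  have h1t : 0 < 1 - t := by linarith
  have h2 := (mul_le_mul_of_nonneg_left hmono h1t.le).trans key
  have h3 : J * Real.log 8 ≤ J * 3 := by gcongr; exact log_eight_le
  have h4 : (1 - t) * (J * k * (d (i + 3) + d i)) ≤
      J * k * (2 * d (i + 1)) + k * ((26 + 2 * C) * d (i + 1)) := by
    have : J * 3 ≤ k * (24 * d (i + 1)) := by nlinarith
    linarith
  have h5 := le_of_scaled_recursion hk0 hJ0 hη0.le hJη ht0 ht2 (by linarith) hC0.le h4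
  have hteq : 4 * t = 40 / ρ * η := by rw [ht]; ring
  rw [hteq] at h5
  linarith

theorem dyadicDeficit_coarse (hW : StripPotential W ρ Λ) (hρ : 0 < ρ) (ω : Fin b → ℝ) {N : ℕ}
    (hN : 160 / ρ ≤ N) {i : ℕ}
    (hsmall : dyadicDeficit W ω Λ (i + 1) ≤ 5 / 16 / (4 + 18 * 9 ^ N) * rate Λ) :
    dyadicDeficit W ω Λ (i + 3) ≤ 2 * dyadicDeficit W ω Λ (i + 1) - dyadicDeficit W ω Λ i +
      (9 + 9 * 9 ^ N) * dyadicDeficit W ω Λ (i + 1) := by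
  set d := dyadicDeficit W ω Λ with hd
  set v : Fin b → ℝ := fun j => Int.fract (((2 ^ i : ℕ) : ℝ) * ω j) with hv
  have hv1 : ‖v‖ ≤ 1 := by
    refine (pi_norm_le_iff_of_nonneg zero_le_one).2 fun j => ?_
    rw [Real.norm_eq_abs, hv, abs_of_nonneg (Int.fract_nonneg _)]
    exact (Int.fract_lt_one _).le
  have hmv : ((2 ^ i : ℕ) : ℝ) • ω =
      (fun j => ((⌊((2 ^ i : ℕ) : ℝ) * ω j⌋ : ℤ) : ℝ)) + (1 : ℝ) • v := by
    ext j
    simp only [hv, Pi.add_apply, Pi.smul_apply, smul_eq_mul, one_mul]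
    exact (Int.floor_add_fract _).symm
  set k : ℝ := 2 ^ i with hk
  have hk0 : 0 < k := by positivity
  have hk1 : 1 ≤ k := one_le_pow₀ (by norm_num)
  have hd1 : 1 ≤ d (i + 1) := one_le_dyadicDeficit hW hρ ω _
  have hD1 : deficit W ω Λ (2 * 2 ^ i) = 2 * k * d (i + 1) := by
    rw [← pow_succ', deficit_two_pow, pow_succ']
  have hD0 : deficit W ω Λ (2 ^ i) = k * d i := deficit_two_pow _ _ _ _
  have hDk : 2 ≤ 2 * k * d (i + 1) := by nlinarith
  set G : ℝ := 9 ^ N with hG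
  have hG0 : 0 < G := by positivity
  have ht : 10 * (ρ / 20) / ρ = 1 / 2 := by field_simp; norm_num
  have key := avalanche_deficit hW hρ ω v hv1 (k := 2 ^ i) (m := 2 ^ i) (J := 8) (N := N)
    (η := ρ / 20) (δ := 1) (Ψ := 18 * G * (2 * k * d (i + 1))) Nat.one_le_two_pow le_rfl
    (by omega) _ hmv (by positivity) (by linarith) zero_le_one (by
      rw [div_le_iff₀ hρ] at hN
      push_cast; linarith) (by
      rw [hD1, ht]
      push_cast
      have : 1 / 2 * (2 * k * d (i + 1)) + Real.log 4 ≤ 2 * (2 * k * d (i + 1)) := by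
        linarith [log_four_le]
      calc _ ≤ (8 + 1) * G * (2 * (2 * k * d (i + 1))) := by gcongr
        _ = _ := by ring) (by
      have h1 : Real.log 64 ≤ 3 * (2 * k * d (i + 1)) := by linarith [log_sixtyfour_le]
      rw [div_mul_eq_mul_div, le_div_iff₀ (by positivity)] at hsmall
      rw [hD1]
      push_cast
      have := mul_le_mul_of_nonneg_left hsmall hk0.le
      linarith)
  have hmono : 8 * k * d (i + 3) ≤ deficit W ω Λ (8 * 2 ^ i + 2 * 2 ^ i) := by
    calc 8 * k * d (i + 3) = deficit W ω Λ (2 ^ (i + 3)) := by rw [deficit_two_pow, pow_add]; ring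
      _ ≤ _ := deficit_mono hW hρ ω (by rw [pow_add]; omega)
  rw [hD1, hD0, ht] at key
  push_cast at key
  have h2 := mul_le_mul_of_nonneg_left hmono (show (0 : ℝ) ≤ 1 / 2 by norm_num)
  have h3 := log_eight_le
  refine le_of_mul_le_mul_left (a := 4 * k) ?_ (by positivity)
  have h4 : 24 ≤ 12 * (2 * k * d (i + 1)) := by linarith
  have hkd : 0 ≤ k * d (i + 1) := by positivity
  linarith [mul_nonneg hG0.le hkd]

/-- The dyadic deficits stay bounded as soon as the first one is small relative to the rate. -/
theorem exists_dyadicDeficit_bound (b : ℕ) {ρ : ℝ} (hρ : 0 < ρ) :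
    ∃ c C : ℝ, 0 < c ∧ 0 < C ∧ ∀ (W : (Fin b → ℂ) → ℂ) (Λ : ℝ) (ω : Fin b → ℝ),
      StripPotential W ρ Λ → C * dyadicDeficit W ω Λ 1 ≤ c * rate Λ →
        ∀ n, dyadicDeficit W ω Λ n ≤ C * dyadicDeficit W ω Λ 1 := by
  obtain ⟨N, hN⟩ := exists_nat_ge (160 / ρ)
  obtain ⟨a₁, ha₁⟩ := exists_pow_lt_of_lt_one (show 0 < ρ / 20 by positivity)
    (show (1 / 2 : ℝ) < 1 by norm_num)
  obtain ⟨S, hS⟩ := exists_summable_errors b (max a₁ 3)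
  set c₁ : ℝ := 5 / 16 / (4 + 9 * (20 / ρ + 16)) with hc₁
  set c₂ : ℝ := 5 / 16 / (4 + 18 * 9 ^ N) with hc₂
  set C₁ : ℝ := 40 / ρ + 52 + 4 * (9 * (20 / ρ + 16)) with hC₁
  set C₂ : ℝ := 9 + 9 * 9 ^ N with hC₂
  have hC₁0 : 0 < C₁ := by positivity
  have hC₂0 : 0 < C₂ := by positivity
  refine ⟨min c₁ c₂, 3 * Real.exp (2 * (max C₁ C₂ * S)), lt_min (by positivity) (by positivity),
    by positivity, fun W Λ ω hW hsmall n => ?_⟩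
  have hB := rate_pos hW hρ
  obtain ⟨e, he0, hesum, he⟩ := hS ω
  have hd := one_le_dyadicDeficit hW hρ ω
  have := bounded_of_dyadic_recursion (d := dyadicDeficit W ω Λ) (ε := fun i => max C₁ C₂ * e i)
    (M := min c₁ c₂ * rate Λ) (S := max C₁ C₂ * S) (dyadicDeficit_mono hW hρ ω)
    (by linarith [hd 0]) (fun i => mul_nonneg (le_max_of_le_left hC₁0.le) (he0 i))
    (fun n => by
      rw [← Finset.mul_sum]
      exact mul_le_mul_of_nonneg_left (hesum n) (le_max_of_le_left hC₁0.le))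
    (fun i hi => by
      have hdi : 0 ≤ dyadicDeficit W ω Λ (i + 1) := by linarith [hd (i + 1)]
      rcases he i with h | ⟨a, ha, hai, hga, h⟩
      · refine (dyadicDeficit_coarse hW hρ ω hN (hi.trans ?_)).trans ?_
        · gcongr; exact min_le_right _ _
        · rw [h, mul_one]
          gcongr
          exact le_max_right _ _
      · refine (dyadicDeficit_fine hW hρ ω ((le_max_right _ _).trans ha) ?_ hai hga
          (hi.trans ?_)).trans ?_
        · have : (1 / 2 : ℝ) ^ a ≤ (1 / 2) ^ a₁ :=
            pow_le_pow_of_le_one (by norm_num) (by norm_num) ((le_max_left _ _).trans ha)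
          linarith
        · gcongr; exact min_le_left _ _
        · rw [h]
          gcongr
          exact le_max_left _ _)
    (by linarith) n
  linarith

theorem StripPotential.const_sub_mul {F : (Fin b → ℂ) → ℂ} {C₀ : ℝ} (hF : StripPotential F ρ C₀)
    (E : ℝ) {lam : ℝ} (hlam : 0 ≤ lam) :
    StripPotential (fun z => (E : ℂ) - lam * F z) ρ (|E| + lam * C₀) where
  per m z := by rw [hF.per]
  diff x v hv := (differentiableOn_const _).sub ((hF.diff x v hv).const_mul _)
  bdd x v hv ζ hζ := by
    refine (norm_sub_le _ _).trans ?_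
    rw [norm_mul, Complex.norm_real, Complex.norm_real, Real.norm_eq_abs, Real.norm_eq_abs,
      abs_of_nonneg hlam]
    have := hF.bdd x v hv ζ hζ
    gcongr

theorem exists_large_potential {F : (Fin b → ℂ) → ℂ} {C₀ : ℝ} (hρ : 0 < ρ)
    (hF : StripPotential F ρ C₀) {x y : Fin b → ℝ} (hxy : F (cvec x) ≠ F (cvec y)) :
    ∃ c > 0, ∀ E lam : ℝ, 0 ≤ lam → ∃ θ : Fin b → ℝ,
      c * (|E| + lam) ≤ ‖(E : ℂ) - lam * F (cvec θ)‖ := by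
  have hbd : ∀ θ : Fin b → ℝ, ‖F (cvec θ)‖ ≤ C₀ := fun θ => by
    rw [← line_zero θ 0]
    exact hF.bdd θ 0 (by simp) 0 (zero_mem_strip hρ)
  have hC₀ : 0 ≤ C₀ := (norm_nonneg _).trans (hbd x)
  set κ := ‖F (cvec x) - F (cvec y)‖ with hκ
  have hκ0 : 0 < κ := norm_pos_iff.2 (sub_ne_zero.2 hxy)
  refine ⟨(1 + 2 * (C₀ + 1) / κ)⁻¹, by positivity, fun E lam hlam => ?_⟩
  have main : ∀ a : ℝ, ‖(E : ℂ) - lam * F (cvec x)‖ ≤ a → ‖(E : ℂ) - lam * F (cvec y)‖ ≤ a →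
      (1 + 2 * (C₀ + 1) / κ)⁻¹ * (|E| + lam) ≤ a := by
    intro a hx hy
    have h1 : lam * κ ≤ 2 * a := by
      have e : (lam : ℂ) * (F (cvec x) - F (cvec y)) =
        ((E : ℂ) - lam * F (cvec y)) - ((E : ℂ) - lam * F (cvec x)) := by ring
      have := norm_sub_le ((E : ℂ) - lam * F (cvec y)) ((E : ℂ) - lam * F (cvec x))
      rw [← e, norm_mul, Complex.norm_real, Real.norm_eq_abs, abs_of_nonneg hlam] at this
      linarith
    have h2 : |E| ≤ a + lam * C₀ := by
      have := norm_add_le ((E : ℂ) - lam * F (cvec x)) (lam * F (cvec x))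
      rw [sub_add_cancel, norm_mul, Complex.norm_real, Complex.norm_real, Real.norm_eq_abs,
        Real.norm_eq_abs, abs_of_nonneg hlam] at this
      have h := mul_le_mul_of_nonneg_left (hbd x) hlam
      linarith
    have h3 : lam ≤ 2 * a / κ := (le_div_iff₀ hκ0).2 h1
    rw [inv_mul_le_iff₀ (by positivity)]
    have h4 := mul_le_mul_of_nonneg_right h3 (by linarith : 0 ≤ C₀ + 1)
    have e : (1 + 2 * (C₀ + 1) / κ) * a = a + 2 * a / κ * (C₀ + 1) := by ring
    linarith
  rcases le_total ‖(E : ℂ) - lam * F (cvec x)‖ ‖(E : ℂ) - lam * F (cvec y)‖ with h | h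
  · exact ⟨y, main _ h le_rfl⟩
  · exact ⟨x, main _ le_rfl h⟩

theorem norm_mul_sub_one_le_cocycle_two (W : (Fin b → ℂ) → ℂ) (w z : Fin b → ℂ) :
    ‖W (z + w) * W z‖ - 1 ≤ ‖cocycle W w 2 z‖ := by
  have h := norm_entry_le (cocycle W w 2 z) 0 0
  have e : cocycle W w 2 z 0 0 = W (z + w) * W z - 1 := by
    simp [cocycle, Matrix.mul_apply, Fin.sum_univ_two]
    ring
  rw [e] at h
  have := norm_sub_norm_le (W (z + w) * W z) 1
  rw [norm_one] at this
  linarith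

/-- The first dyadic deficit is controlled by the ratio of the strip bound to the real maximum. -/
theorem dyadicDeficit_one_le (hW : StripPotential W ρ Λ) (hρ : 0 < ρ) (ω θ : Fin b → ℝ) {N : ℕ}
    (hN : 20 / ρ ≤ N) (hΛ : 1 ≤ Λ) {A : ℝ} (hθ0 : W (cvec θ) ≠ 0)
    (hθ : 2 * 9 ^ N * (Real.log Λ - Real.log ‖W (cvec θ)‖) ≤ A)
    (hlarge : Real.log 2 ≤ 2 * Real.log Λ - A) :
    dyadicDeficit W ω Λ 1 ≤ 7 + A := by
  set v : Fin b → ℝ := fun j => Int.fract (ω j) with hv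
  have hv1 : ‖v‖ ≤ 1 := by
    refine (pi_norm_le_iff_of_nonneg zero_le_one).2 fun j => ?_
    rw [Real.norm_eq_abs, hv, abs_of_nonneg (Int.fract_nonneg _)]
    exact (Int.fract_lt_one _).le
  have hmv : ((1 : ℕ) : ℝ) • ω = (fun j => ((⌊ω j⌋ : ℤ) : ℝ)) + (1 : ℝ) • v := by
    ext j
    simp [hv]
  have hΛ0 : 0 < Λ := by linarith
  obtain ⟨s, hs, hne, hsum⟩ := exists_window (g := fun ζ => W (line θ v ζ)) (K := Real.log Λ)
    (R := ρ) (η := ρ / 20) (δ := 1) (Real.log_nonneg hΛ) (by positivity) (by linarith)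
    (hW.diff θ v hv1) (fun z hz => by rw [Real.exp_log hΛ0]; exact hW.bdd θ v hv1 z hz)
    (by rwa [line_zero]) zero_le_one N 1 (by
      rw [div_le_iff₀ hρ] at hN
      push_cast; linarith)
  rw [Finset.sum_range_succ, Finset.sum_range_one, line_zero] at hsum
  have h0 := hne 0 (by omega)
  have h1 := hne 1 (by omega)
  simp only [Nat.cast_zero, zero_mul, Complex.ofReal_zero, add_zero] at hsum h0
  have hshift := line_shift θ v ω _ 1 1 1 s hmv
  have hWshift : W (line θ v s + cvec ω) = W (line θ v (s + ((1 : ℕ) * (1 : ℝ) : ℝ))) := by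
    rw [← hW.per _ (line θ v (s + ((1 : ℕ) * (1 : ℝ) : ℝ))), ← hshift]
    simp
  rw [← hWshift] at hsum h1
  have hsum' : 2 * Real.log Λ - A ≤
      Real.log ‖W (line θ v s + cvec ω) * W (line θ v s)‖ := by
    rw [norm_mul, Real.log_mul (norm_ne_zero_iff.2 h1) (norm_ne_zero_iff.2 h0)]
    push_cast at hsum
    linarith
  have hpos : 0 < ‖W (line θ v s + cvec ω) * W (line θ v s)‖ :=
    norm_pos_iff.2 (mul_ne_zero h1 h0)
  have hexp := (Real.le_log_iff_exp_le hpos).1 hsum'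
  have h2 : 2 ≤ Real.exp (2 * Real.log Λ - A) := by
    rw [← Real.log_le_iff_le_exp two_pos]; exact hlarge
  have h3 := norm_mul_sub_one_le_cocycle_two W (cvec ω) (line θ v s)
  have h4 := norm_cocycle_three_lines hW hρ ω θ v hv1 (n := 2) (by norm_num) (t := 1 / 2)
    (by norm_num) (ζ := s) (by
      have := Complex.abs_im_le_norm s
      linarith)
  have h5 : Real.exp (2 * Real.log Λ - A - 1) ≤
      Real.exp (Real.log (supNorm W ω 2) + 1 / 2 * deficit W ω Λ 2) := by
    refine le_trans ?_ h4
    refine le_trans ?_ h3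
    rw [Real.exp_sub _ 1]
    have he : 2 ≤ Real.exp 1 := by linarith [Real.add_one_le_exp 1]
    have : Real.exp (2 * Real.log Λ - A) / Real.exp 1 ≤ Real.exp (2 * Real.log Λ - A) / 2 := by
      gcongr
    linarith
  have h6 := Real.exp_le_exp.1 h5
  have h7 : Real.log (Λ + 2) ≤ Real.log Λ + 2 := by
    have h : Real.log (Λ + 2) ≤ Real.log (Λ * 4) := Real.log_le_log (by linarith) (by linarith)
    rw [Real.log_mul (by linarith) (by norm_num)] at h
    linarith [log_four_le]
  have h8 : deficit W ω Λ 2 = 2 * (1 + Real.log (Λ + 2)) - Real.log (supNorm W ω 2) := by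
    unfold deficit rate; push_cast; ring
  have h9 : dyadicDeficit W ω Λ 1 = deficit W ω Λ 2 / 2 := by
    unfold dyadicDeficit; norm_num
  rw [h9]
  linarith

/-- Lower bound for the growth of the cocycle at large coupling, uniform in the frequency. -/
theorem exists_log_supNorm_ge {F : (Fin b → ℂ) → ℂ} {C₀ : ℝ} (hρ : 0 < ρ)
    (hF : StripPotential F ρ C₀) {x y : Fin b → ℝ} (hxy : F (cvec x) ≠ F (cvec y)) :
    ∃ C lam₁ : ℝ, ∀ lam, lam₁ < lam → ∀ (E : ℝ) (ω : Fin b → ℝ) (n : ℕ),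
      2 ^ n * (Real.log lam - C) ≤
        Real.log (supNorm (fun z => (E : ℂ) - lam * F z) ω (2 ^ n)) := by
  obtain ⟨c₁, hc₁, hlarge⟩ := exists_large_potential hρ hF hxy
  obtain ⟨c, C, hc, hC, hbound⟩ := exists_dyadicDeficit_bound b hρ
  obtain ⟨N, hN⟩ := exists_nat_ge (20 / ρ)
  set C₁ := max C₀ 1 with hC₁
  have hF' : StripPotential F ρ C₁ :=
    ⟨hF.per, hF.diff, fun x v hv ζ hζ => (hF.bdd x v hv ζ hζ).trans (le_max_left _ _)⟩
  have hC₁1 : 1 ≤ C₁ := le_max_right _ _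
  set A := 2 * 9 ^ N * (Real.log C₁ - Real.log c₁) with hA
  refine ⟨C * (7 + A), max 1 (max (Real.exp (1 + |A|)) (Real.exp (C * (7 + A) / c))),
    fun lam hlam E ω n => ?_⟩
  rw [max_lt_iff, max_lt_iff] at hlam
  obtain ⟨hl1, hl2, hl3⟩ := hlam
  have hl0 : 0 < lam := by linarith
  have hW := hF'.const_sub_mul E hl0.le
  set W : (Fin b → ℂ) → ℂ := fun z => (E : ℂ) - lam * F z with hWdef
  set Λ := |E| + lam * C₁ with hΛ
  have hE := abs_nonneg E
  have hlamΛ : lam ≤ Λ := by nlinarith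
  have hloglam := Real.log_le_log hl0 hlamΛ
  obtain ⟨θ, hθ⟩ := hlarge E lam hl0.le
  have hWθ : 0 < ‖W (cvec θ)‖ := lt_of_lt_of_le (by positivity) hθ
  have hl2' : 1 + |A| ≤ Real.log lam := (Real.le_log_iff_exp_le hl0).2 hl2.le
  have hl3' : C * (7 + A) / c ≤ Real.log lam := (Real.le_log_iff_exp_le hl0).2 hl3.le
  have hd := dyadicDeficit_one_le (A := A) hW hρ ω θ hN (by linarith) (norm_pos_iff.1 hWθ) (by
      rw [hA]
      refine mul_le_mul_of_nonneg_left ?_ (by positivity)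
      change _ - Real.log ‖(E : ℂ) - lam * F (cvec θ)‖ ≤ _
      have h1 := Real.log_le_log (by positivity) hθ
      rw [Real.log_mul hc₁.ne' (by positivity)] at h1
      have h2 : Real.log Λ ≤ Real.log (C₁ * (|E| + lam)) :=
        Real.log_le_log (by linarith) (by nlinarith)
      rw [Real.log_mul (by positivity) (by positivity)] at h2
      linarith) (by
      have := Real.log_two_lt_d9
      linarith [le_abs_self A, abs_nonneg A])
  have hrate : Real.log lam ≤ rate Λ := by
    have := Real.log_le_log hl0 (show lam ≤ Λ + 2 by linarith)
    unfold rate; linarith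
  have h1 : C * dyadicDeficit W ω Λ 1 ≤ C * (7 + A) := mul_le_mul_of_nonneg_left hd hC.le
  have h2 : C * (7 + A) ≤ c * rate Λ := by
    rw [div_le_iff₀ hc] at hl3'
    have := mul_le_mul_of_nonneg_left hrate hc.le
    linarith
  have h3 := (hbound W Λ ω hW (h1.trans h2) n).trans h1
  have h4 := deficit_two_pow W ω Λ n
  have h5 : (0 : ℝ) < 2 ^ n := by positivity
  have h6 : deficit W ω Λ (2 ^ n) = 2 ^ n * rate Λ - Real.log (supNorm W ω (2 ^ n)) := by
    unfold deficit; push_cast; ring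
  have h7 := mul_le_mul_of_nonneg_left h3 h5.le
  have h8 := mul_le_mul_of_nonneg_left hrate h5.le
  linarith

end Cocycle

section Equidistribution

variable {b : ℕ}

/-- The projection of `ℝ^b` onto the torus. -/
def torusMk (θ : Fin b → ℝ) : UnitAddTorus (Fin b) := fun i => (θ i : UnitAddCircle)

theorem isOpenQuotientMap_torusMk : IsOpenQuotientMap (torusMk (b := b)) :=
  IsOpenQuotientMap.piMap fun _ => QuotientAddGroup.isOpenQuotientMap_mk

theorem volume_unit_cube : volume (Set.Icc (0 : Fin b → ℝ) 1) = 1 := by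
  rw [Real.volume_Icc_pi]; simp

theorem mFourier_torusMk (n : Fin b → ℤ) (θ : Fin b → ℝ) :
    UnitAddTorus.mFourier n (torusMk θ) =
      Complex.exp (2 * Real.pi * Complex.I * ((∑ i, (n i : ℝ) * θ i : ℝ) : ℂ)) := by
  simp only [UnitAddTorus.mFourier, ContinuousMap.coe_mk, torusMk, fourier_coe_apply]
  rw [← Complex.exp_sum]
  congr 1
  push_cast
  rw [Finset.mul_sum]
  refine Finset.sum_congr rfl fun i _ => ?_
  ring

theorem integral_fourier_Icc {n : ℤ} (hn : n ≠ 0) :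
    ∫ x in Set.Icc (0 : ℝ) 1, fourier n (x : UnitAddCircle) = 0 := by
  rw [integral_Icc_eq_integral_Ioc, ← intervalIntegral.integral_of_le zero_le_one]
  have hc : (2 * Real.pi * Complex.I * n : ℂ) ≠ 0 := by
    have := Complex.two_pi_I_ne_zero
    exact mul_ne_zero this (Int.cast_ne_zero.2 hn)
  have h : ∀ x : ℝ, fourier n (x : UnitAddCircle) =
      Complex.exp (2 * Real.pi * Complex.I * n * x) := fun x => by
    rw [fourier_coe_apply]; simp
  simp_rw [h]
  rw [integral_exp_mul_complex hc]
  have : Complex.exp (2 * Real.pi * Complex.I * n * (1 : ℝ)) = 1 := by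
    rw [Complex.ofReal_one, mul_one, mul_comm]
    exact Complex.exp_int_mul_two_pi_mul_I n
  rw [this]
  simp

theorem integral_mFourier_Icc {n : Fin b → ℤ} (hn : n ≠ 0) :
    ∫ θ in Set.Icc (0 : Fin b → ℝ) 1, UnitAddTorus.mFourier n (torusMk θ) = 0 := by
  obtain ⟨i, hi⟩ := Function.ne_iff.1 hn
  rw [← Set.pi_univ_Icc, volume_pi, Measure.restrict_pi_pi]
  have := integral_fintype_prod_eq_prod (𝕜 := ℂ) (ι := Fin b) (E := fun _ => ℝ)
    (μ := fun i => (volume : Measure ℝ).restrict (Set.Icc ((0 : Fin b → ℝ) i) ((1 : Fin b → ℝ) i)))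
    (fun (i : Fin b) (x : ℝ) => (fourier (n i) (x : UnitAddCircle) : ℂ))
  simp only [UnitAddTorus.mFourier, ContinuousMap.coe_mk, torusMk]
  rw [this]
  exact Finset.prod_eq_zero (Finset.mem_univ i) (integral_fourier_Icc hi)

/-- Birkhoff sums of `G` over the rotation by `ω` are uniformly close to `N ∫ G`. -/
def UniformlyAveraged (ω : Fin b → ℝ) (G : C(UnitAddTorus (Fin b), ℂ)) : Prop :=
  ∀ ε > 0, ∃ N₀ : ℕ, ∀ N ≥ N₀, ∀ θ : Fin b → ℝ,
    ‖∑ q ∈ Finset.range N, G (torusMk (θ + (q : ℝ) • ω)) -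
      N * ∫ φ in Set.Icc (0 : Fin b → ℝ) 1, G (torusMk φ)‖ ≤ ε * N

theorem integrableOn_torusMk (G : C(UnitAddTorus (Fin b), ℂ)) :
    IntegrableOn (fun φ : Fin b → ℝ => G (torusMk φ)) (Set.Icc 0 1) :=
  ((G.continuous.comp isOpenQuotientMap_torusMk.continuous).continuousOn).integrableOn_compact
    isCompact_Icc

theorem uniformlyAveraged_mFourier {ω : Fin b → ℝ} (hω : Incommensurate b ω) (n : Fin b → ℤ) :
    UniformlyAveraged ω (UnitAddTorus.mFourier n) := by
  intro ε hε
  rcases eq_or_ne n 0 with rfl | hn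
  · refine ⟨0, fun N _ θ => ?_⟩
    rw [UnitAddTorus.mFourier_zero]
    simp [volume_unit_cube, Measure.real]
    positivity
  set c : ℝ := ∑ i, (n i : ℝ) * ω i with hc
  set z : ℂ := Complex.exp (2 * Real.pi * Complex.I * c) with hz
  have hz1 : z ≠ 1 := by
    intro h
    obtain ⟨m, hm⟩ := Complex.exp_eq_one_iff.1 h
    have h2 := Complex.two_pi_I_ne_zero
    rw [mul_comm] at hm
    exact hω n hn m (by exact_mod_cast mul_right_cancel₀ h2 hm)
  have hznorm : ‖z‖ = 1 := by
    rw [hz, show (2 * Real.pi * Complex.I * c : ℂ) = ((2 * Real.pi * c : ℝ) : ℂ) * Complex.I by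
      push_cast; ring]
    exact Complex.norm_exp_ofReal_mul_I _
  have hpos : 0 < ‖z - 1‖ := norm_pos_iff.2 (sub_ne_zero.2 hz1)
  obtain ⟨N₀, hN₀⟩ := exists_nat_ge (2 / ‖z - 1‖ / ε)
  refine ⟨N₀, fun N hN θ => ?_⟩
  rw [integral_mFourier_Icc hn, mul_zero, sub_zero]
  have hterm : ∀ q : ℕ, UnitAddTorus.mFourier n (torusMk (θ + (q : ℝ) • ω)) =
      UnitAddTorus.mFourier n (torusMk θ) * z ^ q := by
    intro q
    rw [mFourier_torusMk, mFourier_torusMk, hz, ← Complex.exp_nat_mul, ← Complex.exp_add]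
    congr 1
    have : ∑ i, (n i : ℝ) * (θ + (q : ℝ) • ω) i = (∑ i, (n i : ℝ) * θ i) + q * c := by
      rw [hc, Finset.mul_sum, ← Finset.sum_add_distrib]
      refine Finset.sum_congr rfl fun i _ => ?_
      simp only [Pi.add_apply, Pi.smul_apply, smul_eq_mul]
      ring
    rw [this]
    push_cast
    ring
  simp_rw [hterm]
  rw [← Finset.mul_sum, geom_sum_eq hz1, norm_mul, norm_div]
  have h1 : ‖UnitAddTorus.mFourier n (torusMk θ)‖ ≤ 1 :=
    (ContinuousMap.norm_coe_le_norm _ _).trans UnitAddTorus.mFourier_norm.le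
  have h2 : ‖z ^ N - 1‖ ≤ 2 := by
    refine (norm_sub_le _ _).trans ?_
    rw [norm_pow, hznorm, one_pow, norm_one]
    norm_num
  have h3 : 2 / ‖z - 1‖ ≤ ε * N := by
    rw [div_le_iff₀ hε] at hN₀
    have : (N₀ : ℝ) ≤ N := by exact_mod_cast hN
    nlinarith
  calc _ ≤ 1 * (2 / ‖z - 1‖) := by gcongr
    _ ≤ _ := by rwa [one_mul]

theorem UniformlyAveraged.add {ω : Fin b → ℝ} {G H : C(UnitAddTorus (Fin b), ℂ)}
    (hG : UniformlyAveraged ω G) (hH : UniformlyAveraged ω H) : UniformlyAveraged ω (G + H) := by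
  intro ε hε
  obtain ⟨N₁, h₁⟩ := hG (ε / 2) (by positivity)
  obtain ⟨N₂, h₂⟩ := hH (ε / 2) (by positivity)
  refine ⟨max N₁ N₂, fun N hN θ => ?_⟩
  have e₁ := h₁ N ((le_max_left _ _).trans hN) θ
  have e₂ := h₂ N ((le_max_right _ _).trans hN) θ
  simp only [ContinuousMap.add_apply]
  rw [integral_add (integrableOn_torusMk G) (integrableOn_torusMk H), Finset.sum_add_distrib,
    mul_add, add_sub_add_comm]
  refine (norm_add_le _ _).trans ?_
  linarith

theorem UniformlyAveraged.smul {ω : Fin b → ℝ} {G : C(UnitAddTorus (Fin b), ℂ)} (a : ℂ)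
    (hG : UniformlyAveraged ω G) : UniformlyAveraged ω (a • G) := by
  intro ε hε
  obtain ⟨N₁, h₁⟩ := hG (ε / (‖a‖ + 1)) (by positivity)
  refine ⟨N₁, fun N hN θ => ?_⟩
  have e₁ := h₁ N hN θ
  simp only [ContinuousMap.smul_apply, smul_eq_mul]
  rw [integral_const_mul, ← Finset.mul_sum, mul_left_comm, ← mul_sub, norm_mul]
  calc _ ≤ ‖a‖ * (ε / (‖a‖ + 1) * N) := by gcongr
    _ = ‖a‖ / (‖a‖ + 1) * (ε * N) := by ring
    _ ≤ 1 * (ε * N) := by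
      gcongr
      rw [div_le_one (by positivity)]; linarith
    _ = _ := one_mul _

theorem UniformlyAveraged.of_approx {ω : Fin b → ℝ} {G : C(UnitAddTorus (Fin b), ℂ)}
    (h : ∀ ε > 0, ∃ H, ‖G - H‖ ≤ ε ∧ UniformlyAveraged ω H) : UniformlyAveraged ω G := by
  intro ε hε
  obtain ⟨H, hGH, hH⟩ := h (ε / 3) (by positivity)
  obtain ⟨N₁, h₁⟩ := hH (ε / 3) (by positivity)
  refine ⟨N₁, fun N hN θ => ?_⟩
  have e₁ := h₁ N hN θ
  have hpt : ∀ y, ‖(G - H) y‖ ≤ ε / 3 := fun y => (ContinuousMap.norm_coe_le_norm _ _).trans hGH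
  have e₂ : ‖∑ q ∈ Finset.range N, (G - H) (torusMk (θ + (q : ℝ) • ω))‖ ≤ N * (ε / 3) := by
    refine (norm_sum_le_of_le _ fun q _ => hpt _).trans ?_
    simp
  have e₃ : ‖∫ φ in Set.Icc (0 : Fin b → ℝ) 1, (G - H) (torusMk φ)‖ ≤ ε / 3 := by
    have := norm_setIntegral_le_of_norm_le_const (μ := volume) (s := Set.Icc (0 : Fin b → ℝ) 1)
      (by rw [volume_unit_cube]; exact ENNReal.one_lt_top) (fun φ _ => hpt (torusMk φ))
    simpa [Measure.real, volume_unit_cube] using this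
  have hsum : ∑ q ∈ Finset.range N, (G - H) (torusMk (θ + (q : ℝ) • ω)) =
      ∑ q ∈ Finset.range N, G (torusMk (θ + (q : ℝ) • ω)) -
        ∑ q ∈ Finset.range N, H (torusMk (θ + (q : ℝ) • ω)) := by
    rw [← Finset.sum_sub_distrib]; rfl
  have hint : ∫ φ in Set.Icc (0 : Fin b → ℝ) 1, (G - H) (torusMk φ) =
      (∫ φ in Set.Icc (0 : Fin b → ℝ) 1, G (torusMk φ)) -
        ∫ φ in Set.Icc (0 : Fin b → ℝ) 1, H (torusMk φ) :=
    integral_sub (integrableOn_torusMk G) (integrableOn_torusMk H)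
  rw [hsum] at e₂
  rw [hint] at e₃
  set A := ∑ q ∈ Finset.range N, G (torusMk (θ + (q : ℝ) • ω))
  set B := ∑ q ∈ Finset.range N, H (torusMk (θ + (q : ℝ) • ω))
  set I₁ := ∫ φ in Set.Icc (0 : Fin b → ℝ) 1, G (torusMk φ)
  set I₂ := ∫ φ in Set.Icc (0 : Fin b → ℝ) 1, H (torusMk φ)
  have e : A - N * I₁ = (A - B) + (B - N * I₂) - N * (I₁ - I₂) := by ring
  rw [e]
  refine (norm_sub_le _ _).trans ?_
  have := norm_add_le (A - B) (B - N * I₂)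
  rw [norm_mul, Complex.norm_natCast]
  have h4 : (N : ℝ) * ‖I₁ - I₂‖ ≤ N * (ε / 3) := by gcongr
  linarith

/-- Weyl equidistribution, uniformly in the starting point. -/
theorem uniformlyAveraged {ω : Fin b → ℝ} (hω : Incommensurate b ω)
    (G : C(UnitAddTorus (Fin b), ℂ)) : UniformlyAveraged ω G := by
  have hspan : ∀ H ∈ Submodule.span ℂ (Set.range (UnitAddTorus.mFourier (d := Fin b))),
      UniformlyAveraged ω H := by
    intro H hH
    induction hH using Submodule.span_induction with
    | mem H h => obtain ⟨n, rfl⟩ := h; exact uniformlyAveraged_mFourier hω n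
    | zero =>
      have e : (0 : C(UnitAddTorus (Fin b), ℂ)) = (0 : ℂ) • UnitAddTorus.mFourier 0 := by
        ext; simp
      rw [e]
      exact (uniformlyAveraged_mFourier hω 0).smul 0
    | add H K _ _ h₁ h₂ => exact h₁.add h₂
    | smul a H _ h => exact h.smul a
  refine UniformlyAveraged.of_approx fun ε hε => ?_
  have hmem : G ∈ closure (Submodule.span ℂ
      (Set.range (UnitAddTorus.mFourier (d := Fin b))) : Set C(UnitAddTorus (Fin b), ℂ)) := by
    rw [← Submodule.topologicalClosure_coe, UnitAddTorus.span_mFourier_closure_eq_top]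
    trivial
  obtain ⟨H, hH, hd⟩ := Metric.mem_closure_iff.1 hmem ε hε
  exact ⟨H, by rw [← dist_eq_norm]; exact hd.le, hspan H hH⟩

theorem exists_sum_le_integral {ω : Fin b → ℝ} (hω : Incommensurate b ω) {g : (Fin b → ℝ) → ℝ}
    (hg : Continuous g) (hper : ∀ (m : Fin b → ℤ) x, g (x + fun i => (m i : ℝ)) = g x)
    {ε : ℝ} (hε : 0 < ε) : ∃ N₀ : ℕ, ∀ N ≥ N₀, ∀ θ : Fin b → ℝ,
      ∑ q ∈ Finset.range N, g (θ + (q : ℝ) • ω) ≤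
        N * ((∫ φ in Set.Icc (0 : Fin b → ℝ) 1, g φ) + ε) := by
  have hq := isOpenQuotientMap_torusMk (b := b)
  have hlift : ∀ x y : Fin b → ℝ, torusMk x = torusMk y → g x = g y := by
    intro x y hxy
    have : ∀ i, ∃ m : ℤ, y i + m = x i := fun i => by
      have h := congrFun hxy i
      have h0 : ((x i - y i : ℝ) : UnitAddCircle) = 0 := by
        rw [AddCircle.coe_sub]; exact sub_eq_zero.2 h
      obtain ⟨m, hm⟩ := (AddCircle.coe_eq_zero_iff 1).1 h0
      refine ⟨m, ?_⟩
      rw [zsmul_eq_mul, mul_one] at hm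
      linarith
    choose m hm using this
    rw [← hper m y]
    congr 1
    ext i
    exact (hm i).symm
  set G : C(UnitAddTorus (Fin b), ℂ) :=
    ⟨fun y => (g (Function.surjInv hq.surjective y) : ℂ), by
      rw [← hq.continuous_comp_iff]
      have : (fun y => (g (Function.surjInv hq.surjective y) : ℂ)) ∘ torusMk =
          fun x => (g x : ℂ) := by
        ext x
        simp only [Function.comp_apply]
        rw [hlift _ x (Function.surjInv_eq hq.surjective _)]
      rw [this]
      exact Complex.continuous_ofReal.comp hg⟩ with hG
  have hGx : ∀ x, G (torusMk x) = (g x : ℂ) := fun x => by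
    simp only [hG, ContinuousMap.coe_mk]
    rw [hlift _ x (Function.surjInv_eq hq.surjective _)]
  obtain ⟨N₀, hN₀⟩ := uniformlyAveraged hω G ε hε
  refine ⟨N₀, fun N hN θ => ?_⟩
  have h := hN₀ N hN θ
  simp_rw [hGx] at h
  rw [integral_complex_ofReal] at h
  have h' : ‖((∑ q ∈ Finset.range N, g (θ + (q : ℝ) • ω) -
      N * ∫ φ in Set.Icc (0 : Fin b → ℝ) 1, g φ : ℝ) : ℂ)‖ ≤ ε * N := by
    push_cast; exact h
  rw [Complex.norm_real, Real.norm_eq_abs] at h'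
  linarith [le_abs_self (∑ q ∈ Finset.range N, g (θ + (q : ℝ) • ω) -
      N * ∫ φ in Set.Icc (0 : Fin b → ℝ) 1, g φ)]

end Equidistribution

section LyapunovExponent

attribute [local instance] Matrix.frobeniusNormedAddCommGroup Matrix.frobeniusNormedSpace
  Matrix.frobeniusNormedRing Matrix.frobeniusNormedAlgebra
variable {b : ℕ} {W : (Fin b → ℂ) → ℂ} {ρ Λ : ℝ}

theorem cvec_add_smul (θ ω : Fin b → ℝ) (k : ℕ) :
    cvec θ + (k : ℂ) • cvec ω = cvec (θ + (k : ℝ) • ω) := by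
  ext i; simp [cvec]

/-- The logarithm of the norm of the `n`-step cocycle at the real phase `θ`. -/
def logNorm (W : (Fin b → ℂ) → ℂ) (ω : Fin b → ℝ) (n : ℕ) (θ : Fin b → ℝ) : ℝ :=
  Real.log ‖cocycle W (cvec ω) n (cvec θ)‖

theorem one_le_norm_cocycle (ω z : Fin b → ℂ) (n : ℕ) : 1 ≤ ‖cocycle W ω n z‖ :=
  one_le_norm_of_det (det_cocycle _ _ _ _)

theorem logNorm_le (hW : StripPotential W ρ Λ) (hρ : 0 < ρ) (ω θ : Fin b → ℝ) (n : ℕ) :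
    logNorm W ω n θ ≤ Real.log (supNorm W ω n) :=
  Real.log_le_log (zero_lt_one.trans_le (one_le_norm_cocycle _ _ _))
    (norm_le_supNorm hW hρ ω θ n)

theorem logNorm_add_le (ω θ : Fin b → ℝ) (m n : ℕ) :
    logNorm W ω (m + n) θ ≤ logNorm W ω m θ + logNorm W ω n (θ + (m : ℝ) • ω) := by
  have pos : ∀ (k : ℕ) (φ : Fin b → ℝ), 0 < ‖cocycle W (cvec ω) k (cvec φ)‖ := fun k φ =>
    zero_lt_one.trans_le (one_le_norm_cocycle _ _ _)
  unfold logNorm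
  rw [← Real.log_mul (pos _ _).ne' (pos _ _).ne', ← cvec_add_smul]
  refine Real.log_le_log (pos _ _) ?_
  rw [cocycle_add, mul_comm ‖cocycle W (cvec ω) m (cvec θ)‖]
  exact norm_mul_le _ _

theorem logNorm_mul_le (ω θ : Fin b → ℝ) (n N : ℕ) :
    logNorm W ω (n * N) θ ≤
      2 + ∑ q ∈ Finset.range N, logNorm W ω n (θ + (q : ℝ) • ((n : ℝ) • ω)) := by
  induction N with
  | zero =>
    simp only [mul_zero, Finset.range_zero, Finset.sum_empty, add_zero]
    have h := norm_one_mat_le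
    refine (Real.log_le_sub_one_of_pos ?_).trans ?_
    · exact zero_lt_one.trans_le (one_le_norm_cocycle _ _ _)
    · simp only [cocycle]; linarith
  | succ N ih =>
    rw [Finset.sum_range_succ, mul_add, mul_one]
    have h := logNorm_add_le (W := W) ω θ (n * N) n
    rw [Nat.cast_mul, mul_comm (n : ℝ), mul_smul] at h
    linarith

theorem continuous_logNorm (hc : Continuous fun x => W (cvec x)) (ω : Fin b → ℝ) (n : ℕ) :
    Continuous (logNorm W ω n) := by
  have h : Continuous fun θ => cocycle W (cvec ω) n (cvec θ) := by
    induction n with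
    | zero => exact continuous_const
    | succ n ih =>
      simp only [cocycle]
      refine Continuous.mul ?_ ih
      refine continuous_matrix fun i j => ?_
      have := hc.comp (continuous_id.add (continuous_const (y := (n : ℝ) • ω)))
      simp_rw [cvec_add_smul]
      fin_cases i <;> fin_cases j
      · exact this
      all_goals exact continuous_const
  exact h.norm.log fun θ => (zero_lt_one.trans_le (one_le_norm_cocycle _ _ _)).ne'

theorem logNorm_add_int (hW : StripPotential W ρ Λ) (ω : Fin b → ℝ) (n : ℕ) (m : Fin b → ℤ)
    (θ : Fin b → ℝ) : logNorm W ω n (θ + fun i => (m i : ℝ)) = logNorm W ω n θ := by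
  unfold logNorm
  rw [← cocycle_add_int hW.per (cvec ω) n m (cvec θ)]
  congr 4
  ext i; simp [cvec]

theorem Incommensurate.nat_smul {ω : Fin b → ℝ} (hω : Incommensurate b ω) {n : ℕ} (hn : n ≠ 0) :
    Incommensurate b ((n : ℝ) • ω) := by
  intro k hk m h
  refine hω ((n : ℤ) • k) (smul_ne_zero (by exact_mod_cast hn) hk) m ?_
  rw [← h]
  refine Finset.sum_congr rfl fun i _ => ?_
  simp
  ring

/-- The mean and the maximal exponential growth rates of the cocycle coincide. -/
theorem exists_tendsto_logNorm (hW : StripPotential W ρ Λ) (hρ : 0 < ρ)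
    (hc : Continuous fun x => W (cvec x)) {ω : Fin b → ℝ} (hω : Incommensurate b ω) :
    ∃ γ, Tendsto (fun n : ℕ => Real.log (supNorm W ω n) / n) atTop (nhds γ) ∧
      Tendsto (fun k : ℕ => (1 / (k : ℝ)) * ∫ θ in Set.Icc (0 : Fin b → ℝ) 1, logNorm W ω k θ)
        atTop (nhds γ) := by
  have hsub : Subadditive fun n => Real.log (supNorm W ω n) := log_supNorm_add_le hW hρ ω
  have hbdd : BddBelow (Set.range fun n : ℕ => Real.log (supNorm W ω n) / n) := by
    refine ⟨0, ?_⟩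
    rintro _ ⟨n, rfl⟩
    exact div_nonneg (Real.log_nonneg (one_le_supNorm hW hρ ω n)) n.cast_nonneg
  have hlim := hsub.tendsto_lim hbdd
  refine ⟨hsub.lim, hlim, ?_⟩
  refine tendsto_of_tendsto_of_tendsto_of_le_of_le' (tendsto_const_nhds (x := hsub.lim)) hlim ?_ ?_
  · filter_upwards [eventually_ge_atTop 1] with n hn
    have hn0 : (0 : ℝ) < n := by exact_mod_cast hn
    set I := ∫ θ in Set.Icc (0 : Fin b → ℝ) 1, logNorm W ω n θ
    rw [one_div_mul_eq_div, le_div_iff₀ hn0]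
    refine le_of_forall_pos_le_add fun ε hε => ?_
    obtain ⟨N₀, hN₀⟩ := exists_sum_le_integral (hω.nat_smul (n := n) (by omega))
      (continuous_logNorm hc ω n) (logNorm_add_int hW ω n) hε
    have hbound : ∀ N ≥ N₀, hsub.lim * n * N ≤ 3 + N * (I + ε) := by
      intro N hN
      rcases Nat.eq_zero_or_pos N with rfl | hNpos
      · norm_num
      obtain ⟨θ, hθ⟩ := exists_near_max hW hρ ω (n * N)
      have h1 := one_le_supNorm hW hρ ω (n * N)
      have h2 : 0 < ‖cocycle W (cvec ω) (n * N) (cvec θ)‖ := by linarith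
      have h3 : Real.log (supNorm W ω (n * N)) ≤ Real.log 2 + logNorm W ω (n * N) θ := by
        rw [logNorm, ← Real.log_mul two_ne_zero h2.ne']
        exact Real.log_le_log (by linarith) hθ
      have h4 : Real.log 2 ≤ 1 := by linarith [Real.log_two_lt_d9]
      have h5 := logNorm_mul_le (W := W) ω θ n N
      have h6 := hN₀ N hN θ
      have h7 := hsub.lim_le_div hbdd (n := n * N) (by positivity)
      have h8 : (0 : ℝ) < (n * N : ℕ) := by positivity
      rw [le_div_iff₀ h8, Nat.cast_mul, ← mul_assoc] at h7
      linarith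
    by_contra! hlt
    obtain ⟨M, hM⟩ := exists_nat_gt (3 / (hsub.lim * n - (I + ε)))
    have h1 := hbound (max M N₀) (le_max_right _ _)
    have h2 : (M : ℝ) ≤ (max M N₀ : ℕ) := by exact_mod_cast le_max_left _ _
    rw [div_lt_iff₀ (by linarith)] at hM
    nlinarith
  · filter_upwards [eventually_ge_atTop 1] with n hn
    have hn0 : (0 : ℝ) < n := by exact_mod_cast hn
    rw [one_div_mul_eq_div]
    gcongr
    have h := setIntegral_mono (μ := volume) (s := Set.Icc (0 : Fin b → ℝ) 1)
      ((continuous_logNorm hc ω n).continuousOn.integrableOn_compact isCompact_Icc)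
      (g := fun _ => Real.log (supNorm W ω n))
      (integrableOn_const (by rw [volume_unit_cube]; exact ENNReal.one_ne_top)) (fun θ => logNorm_le hW hρ ω θ n)
    simpa [Measure.real, volume_unit_cube] using h

theorem cocycle_eq_map_transfer {f : (Fin b → ℝ) → ℝ} {F : (Fin b → ℂ) → ℂ}
    (hF : ∀ x, F (cvec x) = f x) (lam E : ℝ) (ω θ : Fin b → ℝ) (n : ℕ) :
    cocycle (fun z => (E : ℂ) - lam * F z) (cvec ω) n (cvec θ) =
      (transfer b f lam E ω θ n).map Complex.ofReal := by
  induction n with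
  | zero => simp [cocycle, transfer, Matrix.map_one]
  | succ n ih =>
    simp only [cocycle, transfer]
    rw [ih, cvec_add_smul, hF]
    have := Matrix.map_mul (f := Complex.ofRealHom)
      (L := !![E - lam * f (θ + (n : ℝ) • ω), -1; 1, 0]) (M := transfer b f lam E ω θ n)
    refine Eq.trans ?_ this.symm
    congr 1
    ext i j
    fin_cases i <;> fin_cases j <;> simp

theorem norm_map_ofReal (M : Matrix (Fin 2) (Fin 2) ℝ) :
    ‖M.map Complex.ofReal‖ = matNorm M := by
  rw [matNorm, ← Real.sqrt_sq (norm_nonneg (M.map Complex.ofReal)), norm_sq_mat]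
  simp [Fin.sum_univ_two]

theorem log_matNorm_transfer {f : (Fin b → ℝ) → ℝ} {F : (Fin b → ℂ) → ℂ}
    (hF : ∀ x, F (cvec x) = f x) (lam E : ℝ) (ω θ : Fin b → ℝ) (n : ℕ) :
    Real.log (matNorm (transfer b f lam E ω θ n)) =
      logNorm (fun z => (E : ℂ) - lam * F z) ω n θ := by
  rw [logNorm, cocycle_eq_map_transfer hF, norm_map_ofReal]

/-- Positivity of the Lyapunov exponent for a potential with a holomorphic extension. -/
theorem exists_hasLyapunov_gt {f : (Fin b → ℝ) → ℝ} {F : (Fin b → ℂ) → ℂ} {C₀ : ℝ} (hρ : 0 < ρ)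
    (hS : StripPotential F ρ C₀) (hF : ∀ x, F (cvec x) = f x) (hf : Continuous f)
    (hne : ∃ x y, f x ≠ f y) :
    ∃ lam₀ : ℝ, ∀ lam : ℝ, lam₀ < lam → ∀ E : ℝ, ∀ ω : Fin b → ℝ, Incommensurate b ω →
      ∃ γ : ℝ, HasLyapunov b f lam E ω γ ∧ (1 / 2) * Real.log lam < γ := by
  obtain ⟨x, y, hxy⟩ := hne
  obtain ⟨C, lam₁, hC⟩ := exists_log_supNorm_ge hρ hS (x := x) (y := y)
    (by rw [hF, hF]; exact_mod_cast hxy)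
  refine ⟨max lam₁ (Real.exp (2 * C)), fun lam hlam E ω hω => ?_⟩
  have hlam1 : lam₁ < lam := (le_max_left _ _).trans_lt hlam
  have hlamC : Real.exp (2 * C) < lam := (le_max_right _ _).trans_lt hlam
  have hlam0 : 0 < lam := (Real.exp_pos _).trans hlamC
  have hlog : 2 * C < Real.log lam := (Real.lt_log_iff_exp_lt hlam0).2 hlamC
  have hW := hS.const_sub_mul E hlam0.le
  obtain ⟨γ, h₁, h₂⟩ := exists_tendsto_logNorm hW hρ
    (by simp_rw [hF]; fun_prop) hω
  refine ⟨γ, ?_, ?_⟩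
  · unfold HasLyapunov
    simp_rw [log_matNorm_transfer hF]
    exact h₂
  · have hge : Real.log lam - C ≤ γ := by
      have htend := h₁.comp (tendsto_pow_atTop_atTop_of_one_lt (one_lt_two (α := ℕ)))
      refine ge_of_tendsto' htend fun n => ?_
      have hp : (0 : ℝ) < 2 ^ n := by positivity
      simp only [Function.comp_apply, Nat.cast_pow, Nat.cast_ofNat]
      rw [le_div_iff₀ hp, mul_comm]
      exact hC lam hlam1 E ω n
    linarith

end LyapunovExponent

section Complexification

open scoped NNReal ENNReal in
theorem AnalyticAt.exists_line_extension {V : Type*} [NormedAddCommGroup V] [NormedSpace ℝ V]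
    {f : V → ℝ} {x₀ : V} (hf : AnalyticAt ℝ f x₀) :
    ∃ δ > 0, ∃ B : ℝ, ∀ x ∈ Metric.ball x₀ δ, ∀ v : V, ‖v‖ < δ → ∃ G : ℂ → ℂ,
      DifferentiableOn ℂ G (Metric.ball 0 4) ∧ (∀ ζ ∈ Metric.ball (0 : ℂ) 4, ‖G ζ‖ ≤ B) ∧
        ∀ t : ℝ, |t| < 4 → G t = f (x + t • v) := by
  obtain ⟨p, r, hp⟩ := hf
  obtain ⟨c, hc0, hcr⟩ := ENNReal.lt_iff_exists_nnreal_btwn.1 hp.r_pos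
  have hc0' : 0 < c := by exact_mod_cast hc0
  set δ : ℝ≥0 := c / 6 with hδ
  have hδ0 : 0 < δ := by positivity
  have h5 : (δ + (4 * δ : ℝ≥0) : ℝ≥0∞) < r := by
    refine lt_of_le_of_lt ?_ hcr
    norm_cast
    rw [hδ, ← NNReal.coe_le_coe]; push_cast
    linarith [c.2, (show (0 : ℝ) ≤ c from c.2)]
  have h5p : (δ + (4 * δ : ℝ≥0) : ℝ≥0∞) < p.radius := h5.trans_le hp.r_le
  have hδp : (δ : ℝ≥0∞) < p.radius := (le_add_right le_rfl).trans_lt h5p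
  set S : ℕ → ℝ≥0 := fun k =>
    ∑' s : Σ l : ℕ, { s : Finset (Fin (k + l)) // s.card = l }, ‖p (k + s.1)‖₊ * δ ^ s.1 with hS
  have hSsum : Summable fun k => S k * (4 * δ) ^ k := by
    simpa only [hS, ← NNReal.tsum_mul_right] using
      (NNReal.summable_sigma.1 (p.changeOriginSeries_summable_aux₁ h5p)).2
  have hSsum' : Summable fun k => (S k * (4 * δ) ^ k : ℝ) := by exact_mod_cast hSsum
  refine ⟨δ, hδ0, ∑' k, (S k * (4 * δ) ^ k : ℝ), fun x hx v hv => ?_⟩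
  set y := x - x₀ with hy
  have hyδ : ‖y‖₊ ≤ δ := by
    rw [← NNReal.coe_le_coe]; rw [mem_ball_iff_norm] at hx; exact hx.le
  have hyp : (‖y‖₊ : ℝ≥0∞) < p.radius := lt_of_le_of_lt (by exact_mod_cast hyδ) hδp
  have hyr : (‖y‖₊ : ℝ≥0∞) < r :=
    lt_of_le_of_lt (by exact_mod_cast hyδ) ((le_add_right le_rfl).trans_lt h5)
  have hq := hp.changeOrigin hyr
  have hxy : x₀ + y = x := by rw [hy]; abel
  rw [hxy] at hq
  set q := p.changeOrigin y with hq_def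
  have hqS : ∀ k, ‖q k‖₊ ≤ S k := fun k => by
    refine (p.nnnorm_changeOrigin_le k hyp).trans ?_
    refine Summable.tsum_le_tsum (fun s => ?_) (p.changeOriginSeries_summable_aux₂ hyp k)
      (p.changeOriginSeries_summable_aux₂ hδp k)
    gcongr
  have hterm : ∀ k, ∀ ζ ∈ Metric.ball (0 : ℂ) 4,
      ‖ζ ^ k * ((q k fun _ => v : ℝ) : ℂ)‖ ≤ S k * (4 * δ) ^ k := by
    intro k ζ hζ
    rw [mem_ball_zero_iff] at hζ
    have h1 : ‖q k fun _ => v‖ ≤ S k * δ ^ k := by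
      refine ((q k).le_opNorm _).trans ?_
      have := NNReal.coe_le_coe.2 (hqS k)
      rw [coe_nnnorm] at this
      simp only [Finset.prod_const, Finset.card_univ, Fintype.card_fin]
      gcongr
    rw [norm_mul, norm_pow, Complex.norm_real]
    calc ‖ζ‖ ^ k * ‖q k fun _ => v‖ ≤ 4 ^ k * (S k * δ ^ k) := by gcongr
      _ = _ := by rw [mul_pow]; ring
  refine ⟨fun ζ => ∑' k, ζ ^ k * ((q k fun _ => v : ℝ) : ℂ), ?_, ?_, ?_⟩
  · exact Complex.differentiableOn_tsum_of_summable_norm hSsum'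
      (fun k => by fun_prop) Metric.isOpen_ball hterm
  · exact fun ζ hζ => tsum_of_norm_bounded hSsum'.hasSum fun k => hterm k ζ hζ
  · intro t ht
    have hmem : t • v ∈ Metric.eball (0 : V) (r - ‖y‖₊) := by
      rw [mem_eball_zero_iff]
      refine lt_of_lt_of_le (b := ((4 * δ : ℝ≥0) : ℝ≥0∞)) ?_ ?_
      · rw [← ofReal_norm, ENNReal.ofReal_lt_coe_iff (by positivity), norm_smul, Real.norm_eq_abs]
        push_cast
        have := abs_nonneg t
        have := norm_nonneg v
        have hδr : (0 : ℝ) < δ := hδ0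
        nlinarith
      · refine ENNReal.le_sub_of_add_le_left ENNReal.coe_ne_top ?_
        refine le_trans ?_ h5.le
        gcongr
    have h := hq.hasSum hmem
    have h2 : (fun k => t ^ k * (q k fun _ => v)) = fun k => q k fun _ => t • v := by
      ext k
      rw [(q k).map_smul_univ (fun _ => t) (fun _ => v)]
      simp
    rw [← h2] at h
    rw [← h.tsum_eq, Complex.ofReal_tsum]
    push_cast
    rfl

open scoped Classical in
/-- A choice of holomorphic extension of `g` to the disc of radius two, if there is one. -/
def discExtension (g : ℝ → ℝ) : ℂ → ℂ :=
  if h : ∃ G : ℂ → ℂ, DifferentiableOn ℂ G (Metric.ball 0 2) ∧ ∀ t : ℝ, |t| < 2 → G t = g t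
  then h.choose else 0

theorem discExtension_eq {g : ℝ → ℝ} {G : ℂ → ℂ} (hG : DifferentiableOn ℂ G (Metric.ball 0 2))
    (hg : ∀ t : ℝ, |t| < 2 → G t = g t) {ζ : ℂ} (hζ : ζ ∈ Metric.ball (0 : ℂ) 2) :
    discExtension g ζ = G ζ := by
  have h : ∃ G : ℂ → ℂ, DifferentiableOn ℂ G (Metric.ball 0 2) ∧ ∀ t : ℝ, |t| < 2 → G t = g t :=
    ⟨G, hG, hg⟩
  obtain ⟨hd, he⟩ := h.choose_spec
  rw [discExtension, dif_pos h]
  have h0 : (0 : ℂ) ∈ Metric.ball (0 : ℂ) 2 := by simp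
  refine (hd.analyticOnNhd Metric.isOpen_ball).eqOn_of_preconnected_of_frequently_eq
    (hG.analyticOnNhd Metric.isOpen_ball) (convex_ball _ _).isPreconnected h0 ?_ hζ
  have htend : Tendsto (fun n : ℕ => (((1 : ℝ) / (n + 1) : ℝ) : ℂ)) atTop (nhdsWithin 0 {0}ᶜ) := by
    refine tendsto_nhdsWithin_iff.2 ⟨?_, Eventually.of_forall fun n => ?_⟩
    · rw [← Complex.ofReal_zero]
      exact (Complex.continuous_ofReal.tendsto _).comp tendsto_one_div_add_atTop_nhds_zero_nat
    · have : (0 : ℝ) < 1 / ((n : ℝ) + 1) := by positivity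
      simpa using Complex.ofReal_ne_zero.2 this.ne'
  refine htend.frequently (Frequently.of_forall fun n => ?_)
  have h1 : |(1 : ℝ) / (n + 1)| < 2 := by
    rw [abs_of_pos (by positivity), div_lt_iff₀ (by positivity)]
    have : (0 : ℝ) ≤ n := n.cast_nonneg
    linarith
  rw [he _ h1, hg _ h1]

variable {b : ℕ} {f : (Fin b → ℝ) → ℝ}

theorem exists_uniform_line_extension (hf : ∀ x, AnalyticAt ℝ f x)
    (hper : ∀ (m : Fin b → ℤ) (x : Fin b → ℝ), f (x + fun i => (m i : ℝ)) = f x) :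
    ∃ δ > 0, ∃ B : ℝ, ∀ x v : Fin b → ℝ, ‖v‖ < δ → ∃ G : ℂ → ℂ,
      DifferentiableOn ℂ G (Metric.ball 0 4) ∧ (∀ ζ ∈ Metric.ball (0 : ℂ) 4, ‖G ζ‖ ≤ B) ∧
        ∀ t : ℝ, |t| < 4 → G t = f (x + t • v) := by
  have key : ∃ δ > 0, ∃ B : ℝ, ∀ x ∈ Set.Icc (0 : Fin b → ℝ) 1, ∀ v : Fin b → ℝ, ‖v‖ < δ →
      ∃ G : ℂ → ℂ, DifferentiableOn ℂ G (Metric.ball 0 4) ∧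
        (∀ ζ ∈ Metric.ball (0 : ℂ) 4, ‖G ζ‖ ≤ B) ∧ ∀ t : ℝ, |t| < 4 → G t = f (x + t • v) := by
    refine isCompact_Icc.induction_on (p := fun s => ∃ δ > 0, ∃ B : ℝ, ∀ x ∈ s,
      ∀ v : Fin b → ℝ, ‖v‖ < δ → ∃ G : ℂ → ℂ, DifferentiableOn ℂ G (Metric.ball 0 4) ∧
        (∀ ζ ∈ Metric.ball (0 : ℂ) 4, ‖G ζ‖ ≤ B) ∧ ∀ t : ℝ, |t| < 4 → G t = f (x + t • v))
      ⟨1, one_pos, 0, fun x hx => hx.elim⟩ ?_ ?_ ?_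
    · rintro s t hst ⟨δ, hδ, B, h⟩
      exact ⟨δ, hδ, B, fun x hx => h x (hst hx)⟩
    · rintro s t ⟨δ, hδ, B, h⟩ ⟨δ', hδ', B', h'⟩
      refine ⟨min δ δ', lt_min hδ hδ', max B B', fun x hx v hv => ?_⟩
      rcases hx with hx | hx
      · obtain ⟨G, h1, h2, h3⟩ := h x hx v (hv.trans_le (min_le_left _ _))
        exact ⟨G, h1, fun ζ hζ => (h2 ζ hζ).trans (le_max_left _ _), h3⟩
      · obtain ⟨G, h1, h2, h3⟩ := h' x hx v (hv.trans_le (min_le_right _ _))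
        exact ⟨G, h1, fun ζ hζ => (h2 ζ hζ).trans (le_max_right _ _), h3⟩
    · intro x _
      obtain ⟨δ, hδ, B, h⟩ := (hf x).exists_line_extension
      exact ⟨Metric.ball x δ, mem_nhdsWithin_of_mem_nhds (Metric.ball_mem_nhds x hδ), δ, hδ, B, h⟩
  obtain ⟨δ, hδ, B, h⟩ := key
  refine ⟨δ, hδ, B, fun x v hv => ?_⟩
  obtain ⟨G, h1, h2, h3⟩ := h (fun i => Int.fract (x i))
    ⟨fun i => Int.fract_nonneg _, fun i => (Int.fract_lt_one _).le⟩ v hv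
  refine ⟨G, h1, h2, fun t ht => ?_⟩
  rw [h3 t ht, ← hper (fun i => ⌊x i⌋)]
  congr 2
  ext i
  simp only [Pi.add_apply, Pi.smul_apply]
  linarith [Int.fract_add_floor (x i)]

/-- The extension of `f` to complex phases near the reals. -/
def complexify (f : (Fin b → ℝ) → ℝ) (z : Fin b → ℂ) : ℂ :=
  discExtension (fun t => f ((fun i => (z i).re) + t • fun i => (z i).im)) Complex.I

theorem I_mem_ball : Complex.I ∈ Metric.ball (0 : ℂ) 2 := by simp

theorem complexify_cvec (f : (Fin b → ℝ) → ℝ) (x : Fin b → ℝ) : complexify f (cvec x) = f x := by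
  rw [complexify, discExtension_eq (G := fun _ => (f x : ℂ)) (differentiableOn_const _) _ I_mem_ball]
  intro t _
  congr 2
  ext i; simp [cvec]

theorem complexify_line {x v : Fin b → ℝ} {ρ : ℝ} (hρ : 0 < ρ) {s₀ : ℝ} {G : ℂ → ℂ}
    (hG : DifferentiableOn ℂ G (Metric.ball 0 4))
    (hg : ∀ t : ℝ, |t| < 4 → G t = f (x + s₀ • v + t • (ρ • v))) {ζ : ℂ}
    (hre : |ζ.re - s₀| < ρ) (him : |ζ.im| < ρ) :
    complexify f (line x v ζ) = G ((ζ - s₀) / ρ) := by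
  have hbd : ∀ w : ℂ, ‖w‖ < 2 → ‖((ζ.re - s₀ : ℝ) + w * (ζ.im : ℝ)) / (ρ : ℂ)‖ < 4 := by
    intro w hw
    rw [norm_div, Complex.norm_real, Real.norm_of_nonneg hρ.le, div_lt_iff₀ hρ]
    refine (norm_add_le _ _).trans_lt ?_
    rw [norm_mul, Complex.norm_real, Complex.norm_real, Real.norm_eq_abs, Real.norm_eq_abs]
    nlinarith [abs_nonneg ζ.im, norm_nonneg w]
  rw [complexify, discExtension_eq
    (G := fun w => G (((ζ.re - s₀ : ℝ) + w * (ζ.im : ℝ)) / (ρ : ℂ))) _ _ I_mem_ball]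
  · congr 2
    apply Complex.ext <;> simp
  · refine hG.comp (by fun_prop) fun w hw => ?_
    rw [mem_ball_zero_iff] at hw ⊢
    exact hbd w hw
  · intro t ht
    have h1 := hbd t (by rwa [Complex.norm_real])
    have e : ((ζ.re - s₀ : ℝ) + (t : ℂ) * (ζ.im : ℝ)) / (ρ : ℂ) =
        (((ζ.re - s₀ + t * ζ.im) / ρ : ℝ) : ℂ) := by push_cast; ring
    rw [e] at h1 ⊢
    rw [Complex.norm_real, Real.norm_eq_abs] at h1
    rw [hg _ h1]
    congr 2
    ext i
    simp [line]
    field_simp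
    ring

/-- A periodic real analytic function extends holomorphically to a strip. -/
theorem exists_stripPotential (hf : ∀ x, AnalyticAt ℝ f x)
    (hper : ∀ (m : Fin b → ℤ) (x : Fin b → ℝ), f (x + fun i => (m i : ℝ)) = f x) :
    ∃ ρ > 0, ∃ C₀, StripPotential (complexify f) ρ C₀ := by
  obtain ⟨δ, hδ, B, h⟩ := exists_uniform_line_extension hf hper
  have hρ : 0 < δ / 2 := by positivity
  have hv' : ∀ v : Fin b → ℝ, ‖v‖ ≤ 1 → ‖(δ / 2) • v‖ < δ := fun v hv => by
    rw [norm_smul, Real.norm_of_nonneg hρ.le]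
    nlinarith
  have hmem : ∀ ζ ∈ strip (δ / 2), (ζ - ζ.re) / (δ / 2 : ℝ) ∈ Metric.ball (0 : ℂ) 4 := by
    intro ζ hζ
    have e : ζ - ζ.re = (ζ.im : ℝ) * Complex.I := by apply Complex.ext <;> simp
    have hζ' : |ζ.im| < δ / 2 := hζ
    rw [mem_ball_zero_iff, norm_div, e, norm_mul, Complex.norm_I, mul_one, Complex.norm_real,
      Complex.norm_real, Real.norm_of_nonneg hρ.le, div_lt_iff₀ hρ, Real.norm_eq_abs]
    linarith
  refine ⟨δ / 2, hρ, B, ⟨fun m z => ?_, fun x v hv ζ hζ => ?_, fun x v hv ζ hζ => ?_⟩⟩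
  · unfold complexify
    congr 2
    ext t
    conv_rhs => rw [← hper m]
    congr 1
    ext i
    simp
    ring
  · obtain ⟨G, h1, -, h3⟩ := h (x + ζ.re • v) _ (hv' v hv)
    have hev : ∀ᶠ w in nhds ζ, complexify f (line x v w) = G ((w - ζ.re) / (δ / 2 : ℝ)) := by
      have o1 : IsOpen {w : ℂ | |w.re - ζ.re| < δ / 2} :=
        isOpen_lt (by fun_prop) continuous_const
      have o2 : IsOpen {w : ℂ | |w.im| < δ / 2} := isOpen_lt (by fun_prop) continuous_const
      filter_upwards [o1.mem_nhds (show |ζ.re - ζ.re| < δ / 2 by simpa using hρ),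
        o2.mem_nhds hζ] with w hw1 hw2
      exact complexify_line hρ h1 h3 hw1 hw2
    refine (DifferentiableAt.congr_of_eventuallyEq ?_ hev).differentiableWithinAt
    refine DifferentiableAt.fun_comp' ζ (g := G) ?_ (by fun_prop)
    refine h1.differentiableAt (Metric.isOpen_ball.mem_nhds (hmem ζ hζ))
  · obtain ⟨G, h1, h2, h3⟩ := h (x + ζ.re • v) _ (hv' v hv)
    rw [complexify_line hρ h1 h3 (by simpa using hρ) hζ]
    exact h2 _ (hmem ζ hζ)

end Complexification

/-- **Bourgain**: for a nonconstant real analytic `f` on `𝕋^b` there is `λ₀(f)` such that for all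
`λ > λ₀`, all energies `E` and all incommensurate `ω`, the Lyapunov exponent of the
quasiperiodic Schrödinger cocycle satisfies `γ(E) > (1/2) log λ`. -/
theorem lyapunov_positive_large_coupling
    (b : ℕ) (hb : 1 ≤ b) (f : (Fin b → ℝ) → ℝ)
    (hf_an : ∀ x, AnalyticAt ℝ f x)
    (hf_per : ∀ (m : Fin b → ℤ) (x : Fin b → ℝ), f (x + fun i => (m i : ℝ)) = f x)
    (hf_nonconst : ∃ x y, f x ≠ f y) :
    ∃ lam₀ : ℝ, ∀ lam : ℝ, lam₀ < lam → ∀ E : ℝ, ∀ ω : Fin b → ℝ, Incommensurate b ω →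
      ∃ γ : ℝ, HasLyapunov b f lam E ω γ ∧ (1 / 2) * Real.log lam < γ := by
  obtain ⟨ρ, hρ, C₀, hS⟩ := exists_stripPotential hf_an hf_per
  exact exists_hasLyapunov_gt hρ hS (complexify_cvec f)
    (continuous_iff_continuousAt.2 fun x => (hf_an x).continuousAt) hf_nonconst
end
end

section
/- For the almost Mathieu operator with coupling λ > 2 and any irrational frequency ω, the Lyapunov exponent satisfies γ(E) ≥ ln(λ/2) > 0 for every energy E ∈ ℝ. -/
open MeasureTheory Filter

noncomputable section

/-- The `k`-step transfer matrix `M_k(θ,E) = ∏_{n=k-1}^{0} A(θ + nω, E)` of the almost Mathieu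
cocycle, where `A(θ,E) = [[E - λ cos(2πθ), -1],[1,0]]`. -/
def transferAM (lam E ω θ : ℝ) : ℕ → Matrix (Fin 2) (Fin 2) ℝ
  | 0 => 1
  | (k + 1) =>
      !![E - lam * Real.cos (2 * Real.pi * (θ + (k : ℝ) * ω)), -1; 1, 0] * transferAM lam E ω θ k

/-- `γ` is the Lyapunov exponent of the almost Mathieu cocycle at energy `E`:
`γ = lim_{k→∞} (1/k) ∫_𝕋 log ‖M_k(θ,E)‖ dθ`. -/
def HasLyapunovAM (lam E ω : ℝ) (γ : ℝ) : Prop :=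
  Tendsto (fun k : ℕ => (1 / (k : ℝ)) *
      ∫ θ in Set.Icc (0 : ℝ) 1, Real.log (matNorm (transferAM lam E ω θ k)))
    atTop (nhds γ)

open Polynomial

lemma matNorm_eq_sqrt (M : Matrix (Fin 2) (Fin 2) ℝ) :
    matNorm M = √(M 0 0 ^ 2 + M 0 1 ^ 2 + (M 1 0 ^ 2 + M 1 1 ^ 2)) := by
  simp [matNorm, Fin.sum_univ_two]

lemma matNorm_mul_le (A B : Matrix (Fin 2) (Fin 2) ℝ) :
    matNorm (A * B) ≤ matNorm A * matNorm B := by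
  simp only [matNorm_eq_sqrt]
  rw [← Real.sqrt_mul (by positivity)]
  apply Real.sqrt_le_sqrt
  simp only [Matrix.mul_apply, Fin.sum_univ_two]
  nlinarith [sq_nonneg (A 0 0 * B 1 0 - A 0 1 * B 0 0), sq_nonneg (A 0 0 * B 1 1 - A 0 1 * B 0 1),
    sq_nonneg (A 1 0 * B 1 0 - A 1 1 * B 0 0), sq_nonneg (A 1 0 * B 1 1 - A 1 1 * B 0 1)]

lemma one_le_matNorm_of_det_eq_one {M : Matrix (Fin 2) (Fin 2) ℝ} (h : M.det = 1) :
    1 ≤ matNorm M := by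
  rw [matNorm_eq_sqrt, Real.one_le_sqrt]
  rw [Matrix.det_fin_two] at h
  nlinarith [sq_nonneg (M 0 0 - M 1 1), sq_nonneg (M 0 1 + M 1 0)]

lemma abs_apply_zero_zero_le_matNorm (M : Matrix (Fin 2) (Fin 2) ℝ) : |M 0 0| ≤ matNorm M := by
  rw [matNorm_eq_sqrt]
  apply Real.abs_le_sqrt
  nlinarith [sq_nonneg (M 0 1), sq_nonneg (M 1 0), sq_nonneg (M 1 1)]

lemma det_transferAM (lam E ω θ : ℝ) (k : ℕ) : (transferAM lam E ω θ k).det = 1 := by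
  induction k with
  | zero => simp [transferAM]
  | succ k ih => rw [transferAM, Matrix.det_mul, ih, Matrix.det_fin_two_of]; ring

lemma one_le_matNorm_transferAM (lam E ω θ : ℝ) (k : ℕ) :
    1 ≤ matNorm (transferAM lam E ω θ k) :=
  one_le_matNorm_of_det_eq_one (det_transferAM ..)

lemma transferAM_add (lam E ω θ : ℝ) (m n : ℕ) :
    transferAM lam E ω θ (m + n) =
      transferAM lam E ω (θ + m * ω) n * transferAM lam E ω θ m := by
  induction n with
  | zero => simp [transferAM]
  | succ n ih =>
    rw [← add_assoc, transferAM, transferAM, ih, Matrix.mul_assoc]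
    have : θ + ((m + n : ℕ) : ℝ) * ω = θ + m * ω + n * ω := by push_cast; ring
    rw [this]

lemma transferAM_add_one (lam E ω θ : ℝ) (k : ℕ) :
    transferAM lam E ω (θ + 1) k = transferAM lam E ω θ k := by
  induction k with
  | zero => rfl
  | succ k ih =>
    have : 2 * Real.pi * (θ + 1 + k * ω) = 2 * Real.pi * (θ + k * ω) + 2 * Real.pi := by ring
    rw [transferAM, transferAM, ih, this, Real.cos_add_two_pi]

lemma continuous_transferAM (lam E ω : ℝ) (k : ℕ) :
    Continuous fun θ => transferAM lam E ω θ k := by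
  induction k with
  | zero => exact continuous_const
  | succ k ih =>
    simp only [transferAM]
    refine Continuous.matrix_mul ?_ ih
    refine continuous_matrix fun i j => ?_
    fin_cases i <;> fin_cases j <;> simp <;> fun_prop

lemma continuous_log_matNorm_transferAM (lam E ω : ℝ) (k : ℕ) :
    Continuous fun θ => Real.log (matNorm (transferAM lam E ω θ k)) := by
  have h := continuous_transferAM lam E ω k
  refine Continuous.log ?_ fun θ =>
    (zero_lt_one.trans_le (one_le_matNorm_transferAM lam E ω θ k)).ne'
  unfold matNorm
  refine Real.continuous_sqrt.comp ?_
  exact continuous_finsetSum _ fun i _ => continuous_finsetSum _ fun j _ =>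
    (h.matrix_elem i j).pow 2

lemma log_matNorm_transferAM_add_le (lam E ω θ : ℝ) (m n : ℕ) :
    Real.log (matNorm (transferAM lam E ω θ (m + n))) ≤
      Real.log (matNorm (transferAM lam E ω θ m)) +
        Real.log (matNorm (transferAM lam E ω (θ + m * ω) n)) := by
  have h1 := one_le_matNorm_transferAM lam E ω θ m
  have h2 := one_le_matNorm_transferAM lam E ω (θ + m * ω) n
  have h3 := one_le_matNorm_transferAM lam E ω θ (m + n)
  rw [← Real.log_mul (by positivity) (by positivity), mul_comm]
  apply Real.log_le_log (by positivity)
  rw [transferAM_add]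
  exact matNorm_mul_le _ _

lemma subadditive_integral_log_matNorm_transferAM (lam E ω : ℝ) :
    Subadditive fun k : ℕ =>
      ∫ θ in (0 : ℝ)..1, Real.log (matNorm (transferAM lam E ω θ k)) := by
  intro m n
  have hc := continuous_log_matNorm_transferAM lam E ω
  have hper : Function.Periodic
      (fun θ => Real.log (matNorm (transferAM lam E ω θ n))) 1 := fun θ => by
    simp only [transferAM_add_one]
  have hshift : ∫ θ in (0 : ℝ)..1, Real.log (matNorm (transferAM lam E ω (θ + m * ω) n)) =
      ∫ θ in (0 : ℝ)..1, Real.log (matNorm (transferAM lam E ω θ n)) := by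
    rw [intervalIntegral.integral_comp_add_right
      (fun θ => Real.log (matNorm (transferAM lam E ω θ n)))]
    simpa [add_comm] using hper.intervalIntegral_add_eq (m * ω) 0
  have hcs : Continuous fun θ => Real.log (matNorm (transferAM lam E ω (θ + m * ω) n)) :=
    (hc n).comp (continuous_id.add continuous_const)
  dsimp only
  rw [← hshift, ← intervalIntegral.integral_add ((hc m).intervalIntegrable _ _)
    (hcs.intervalIntegrable _ _)]
  exact intervalIntegral.integral_mono_on zero_le_one ((hc _).intervalIntegrable _ _)
    (((hc m).add hcs).intervalIntegrable _ _) fun θ _ => log_matNorm_transferAM_add_le ..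

/-- After multiplication by `z ^ k`, where `z = exp (2πiθ)`, the first column of the `k`-step
transfer matrix is polynomial in `z`, and the top left entry has degree `2 * k` and leading
coefficient of modulus `(|λ| / 2) ^ k`. -/
lemma exists_polynomial_transferAM (lam E ω : ℝ) (k : ℕ) :
    ∃ P Q : ℂ[X], P.natDegree ≤ 2 * k ∧ (X * Q).natDegree ≤ 2 * k ∧
      ‖P.coeff (2 * k)‖ = (|lam| / 2) ^ k ∧
      ∀ θ : ℝ,
        P.eval (Complex.exp (2 * Real.pi * θ * Complex.I)) =
          Complex.exp (2 * Real.pi * θ * Complex.I) ^ k * (transferAM lam E ω θ k 0 0 : ℂ) ∧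
        Q.eval (Complex.exp (2 * Real.pi * θ * Complex.I)) =
          Complex.exp (2 * Real.pi * θ * Complex.I) ^ k * (transferAM lam E ω θ k 1 0 : ℂ) := by
  induction k with
  | zero => exact ⟨1, 0, by simp, by simp, by simp, fun θ => by simp [transferAM]⟩
  | succ k ih =>
    obtain ⟨P, Q, hP, hQ, hlead, heval⟩ := ih
    set w : ℂ := Complex.exp (2 * Real.pi * (k * ω) * Complex.I) with hw
    have hw0 : w ≠ 0 := Complex.exp_ne_zero _
    have hwn : ‖w‖ = 1 := by
      have : w = Complex.exp ((2 * Real.pi * (k * ω) : ℝ) * Complex.I) := by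
        rw [hw]; push_cast; rfl
      rw [this, Complex.norm_exp_ofReal_mul_I]
    set T : ℂ[X] := C (-(lam / 2) * w) * X ^ 2 + C (E : ℂ) * X + C (-(lam / 2) * w⁻¹) with hT
    have hTdeg : T.natDegree ≤ 2 := natDegree_quadratic_le
    have hTc : T.coeff 2 = -(lam / 2) * w := by
      simp only [hT, coeff_add, coeff_C_mul, coeff_X_pow, coeff_X, coeff_C]
      norm_num
    have hTP : (T * P).natDegree ≤ 2 * (k + 1) :=
      natDegree_mul_le.trans (by omega)
    refine ⟨T * P - X * Q, X * P, ?_, ?_, ?_, fun θ => ?_⟩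
    · exact (natDegree_sub_le _ _).trans (by omega)
    · refine natDegree_mul_le.trans ?_
      have := natDegree_mul_le (p := X) (q := P)
      rw [natDegree_X] at this ⊢
      omega
    · have h1 : (T * P).coeff (2 * (k + 1)) = T.coeff 2 * P.coeff (2 * k) := by
        rw [show 2 * (k + 1) = 2 + 2 * k by ring]
        exact coeff_mul_add_eq_of_natDegree_le hTdeg hP
      have h2 : (X * Q).coeff (2 * (k + 1)) = 0 :=
        coeff_eq_zero_of_natDegree_lt (by omega)
      rw [coeff_sub, h1, h2, sub_zero, norm_mul, hlead, hTc, norm_mul, hwn]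
      simp [pow_succ, mul_comm]
    · obtain ⟨h1, h2⟩ := heval θ
      set z : ℂ := Complex.exp (2 * Real.pi * θ * Complex.I) with hz
      have hz0 : z ≠ 0 := Complex.exp_ne_zero _
      have hcos : Complex.cos (2 * Real.pi * (θ + k * ω)) = (z * w + z⁻¹ * w⁻¹) / 2 := by
        rw [Complex.cos, hz, hw, ← Complex.exp_neg, ← Complex.exp_neg, ← Complex.exp_add,
          ← Complex.exp_add]
        ring_nf
      constructor
      · simp only [hT, eval_sub, eval_mul, eval_add, eval_pow, eval_C, eval_X, h1, h2, transferAM,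
          Matrix.mul_apply, Fin.sum_univ_two]
        simp [hcos]
        field_simp
        ring
      · simp only [eval_mul, eval_X, h1, transferAM, Matrix.mul_apply, Fin.sum_univ_two]
        simp
        ring

lemma log_norm_leadingCoeff_le_integral {p : ℂ[X]} (hp : p ≠ 0) :
    Real.log ‖p.leadingCoeff‖ ≤
      ∫ t in (0 : ℝ)..1, Real.log ‖p.eval (Complex.exp (2 * Real.pi * t * Complex.I))‖ := by
  have h : p.logMahlerMeasure =
      ∫ t in (0 : ℝ)..1, Real.log ‖p.eval (Complex.exp (2 * Real.pi * t * Complex.I))‖ := by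
    have := intervalIntegral.integral_comp_mul_left (a := 0) (b := 1)
      (fun x => Real.log ‖p.eval (circleMap 0 1 x)‖) Real.two_pi_pos.ne'
    rw [mul_zero, mul_one] at this
    rw [logMahlerMeasure_def, Real.circleAverage_def, ← this]
    simp [circleMap]
  rw [← h, logMahlerMeasure_eq_log_MahlerMeasure]
  exact Real.log_le_log (by simpa using hp) p.leadingCoeff_le_mahlerMeasure

lemma intervalIntegrable_log_norm_eval_exp (p : ℂ[X]) :
    IntervalIntegrable
      (fun t : ℝ => Real.log ‖p.eval (Complex.exp (2 * Real.pi * t * Complex.I))‖)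
      volume 0 1 := by
  have := p.intervalIntegrable_mahlerMeasure.comp_mul_left (c := 2 * Real.pi)
  simpa [circleMap, Real.pi_ne_zero] using this

/-- **Herman's lower bound** for the integrated logarithm of the norm of the transfer matrices. -/
lemma mul_log_le_integral_log_matNorm_transferAM {lam : ℝ} (hlam : lam ≠ 0) (E ω : ℝ) (k : ℕ) :
    k * Real.log (|lam| / 2) ≤
      ∫ θ in (0 : ℝ)..1, Real.log (matNorm (transferAM lam E ω θ k)) := by
  obtain ⟨P, Q, hdeg, -, hlead, heval⟩ := exists_polynomial_transferAM lam E ω k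
  have hcoeff : P.coeff (2 * k) ≠ 0 := by
    rw [← norm_ne_zero_iff, hlead]
    positivity
  have hP : P ≠ 0 := fun h => hcoeff (by simp [h])
  have hnat : P.natDegree = 2 * k := hdeg.antisymm (le_natDegree_of_ne_zero hcoeff)
  rw [← Real.log_pow, ← hlead, ← hnat, coeff_natDegree]
  refine (log_norm_leadingCoeff_le_integral hP).trans ?_
  refine intervalIntegral.integral_mono_on zero_le_one (intervalIntegrable_log_norm_eval_exp P)
    ((continuous_log_matNorm_transferAM lam E ω k).intervalIntegrable _ _) fun θ _ => ?_
  have hz : ‖Complex.exp (2 * Real.pi * θ * Complex.I)‖ = 1 := by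
    simpa using Complex.norm_exp_ofReal_mul_I (2 * Real.pi * θ)
  rw [(heval θ).1, norm_mul, norm_pow, hz, one_pow, one_mul, Complex.norm_real, Real.norm_eq_abs]
  rcases eq_or_ne (transferAM lam E ω θ k 0 0) 0 with h0 | h0
  · simpa [h0] using Real.log_nonneg (one_le_matNorm_transferAM lam E ω θ k)
  · exact Real.log_le_log (abs_pos.2 h0) (abs_apply_zero_zero_le_matNorm _)

/-- For the almost Mathieu operator with coupling `λ > 2` and irrational frequency `ω`, the
Lyapunov exponent satisfies `γ(E) ≥ log (λ/2) > 0` for every energy `E`. -/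
theorem almostMathieu_lyapunov_lower_bound
    (lam ω : ℝ) (hlam : 2 < lam) (hω : Irrational ω) (E : ℝ) :
    ∃ γ : ℝ, HasLyapunovAM lam E ω γ ∧ 0 < Real.log (lam / 2) ∧ Real.log (lam / 2) ≤ γ := by
  have hset : ∀ k : ℕ, ∫ θ in Set.Icc (0 : ℝ) 1, Real.log (matNorm (transferAM lam E ω θ k)) =
      ∫ θ in (0 : ℝ)..1, Real.log (matNorm (transferAM lam E ω θ k)) := fun k => by
    rw [intervalIntegral.integral_of_le zero_le_one, integral_Icc_eq_integral_Ioc]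
  have hpos : 0 < Real.log (lam / 2) := Real.log_pos (by linarith)
  have hsub := subadditive_integral_log_matNorm_transferAM lam E ω
  have hbound (k : ℕ) : k * Real.log (lam / 2) ≤
      ∫ θ in (0 : ℝ)..1, Real.log (matNorm (transferAM lam E ω θ k)) := by
    have := mul_log_le_integral_log_matNorm_transferAM (lam := lam) (by linarith) E ω k
    rwa [abs_of_pos (by linarith)] at this
  have hlim := hsub.tendsto_lim ⟨0, by
    rintro _ ⟨k, rfl⟩
    exact div_nonneg ((mul_nonneg k.cast_nonneg hpos.le).trans (hbound k)) k.cast_nonneg⟩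
  refine ⟨hsub.lim, ?_, hpos, ge_of_tendsto hlim ?_⟩
  · simpa only [HasLyapunovAM, hset, one_div_mul_eq_div] using hlim
  · filter_upwards [eventually_gt_atTop 0] with k hk
    rw [le_div_iff₀ (by exact_mod_cast hk), mul_comm]
    exact hbound k
end
end
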